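/- De Giorgi type growth lemma (Lemma 3.3). Let v be a local weak supersolution of the homogeneous equation ∂_t v − div(𝒜(t,x,Dv)) + ℒv = 0 in Ω_T. For every R ∈ (0,1] and (t₀,x₀) with I_{2R}^⊖(t₀) × B_{2R}(x₀) compactly contained in I × Ω, every δ ∈ (0,1], q ∈ (1,2] and H > 0, there exists λ ∈ (0,1) depending only on d, s, Λ, q, δ such that: if v ≥ 0 a.e. in Q_{2R}(t₀,x₀), |{(t,x) ∈ I_{δR}^⊖(t₀) × B_R(x₀) : v(t,x) ≤ H}| ≤ λ |I_{δR}^⊖(t₀) × B_R(x₀)|, and (⨍_{I_{2R}^⊖(t₀)} Tail(v₋(t); x₀, 2R)^q dt)^{1/q} ≤ H, then v ≥ H/2 a.e. in I_{δR/2}^⊖(t₀) × B_{R/2}(x₀). Here v₋ = max{−v, 0} and |·| denotes Lebesgue measure. -/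

import Mathlib

open MeasureTheory Set Filter Metric
open scoped ENNReal NNReal Topology RealInnerProductSpace

noncomputable section

/-- Euclidean space `ℝ^d`. -/
abbrev Ed (d : ℕ) : Type := EuclideanSpace ℝ (Fin d)

variable {d : ℕ}

/-- Backward time interval `I_r^⊖(t₀) = (t₀ - r², t₀)`. -/
def Iminus (t₀ r : ℝ) : Set ℝ := Set.Ioo (t₀ - r ^ 2) t₀

/-- Parabolic cylinder `Q_r(t₀,x₀) = I_r^⊖(t₀) × B_r(x₀)`. -/
def pCyl (t₀ : ℝ) (x₀ : Ed d) (r : ℝ) : Set (ℝ × Ed d) :=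
  (Iminus t₀ r) ×ˢ (Metric.ball x₀ r)

/-- Nonlocal tail `Tail(v; x₀, R) = R² ∫_{ℝ^d ∖ B_R(x₀)} |v(y)| |x₀ - y|^{-d-2s} dy`. -/
def Tail (s : ℝ) (v : Ed d → ℝ) (x₀ : Ed d) (R : ℝ) : ℝ :=
  R ^ 2 * ∫ y in (Metric.ball x₀ R)ᶜ, |v y| / ‖x₀ - y‖ ^ ((d : ℝ) + 2 * s)

/-- Caloric Riesz potential `ℐ^ν_α(t₀,x₀;R) = ∫₀^R ν(Q_ρ(t₀,x₀)) ρ^{-(d+2-α)} dρ/ρ`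
for a nonnegative measure `ν`. -/
def RieszPot (ν : Measure (ℝ × Ed d)) (α : ℝ) (t₀ : ℝ) (x₀ : Ed d) (R : ℝ) : ℝ :=
  ∫ ρ in Set.Ioo (0 : ℝ) R, (ν (pCyl t₀ x₀ ρ)).toReal / ρ ^ ((d : ℝ) + 2 - α) / ρ

/-- The structure conditions (1.2)-(1.3) on the vector field `𝒜`. -/
structure VectorFieldHyp (d : ℕ) (Λ : ℝ) (A : ℝ → Ed d → Ed d → Ed d) : Prop where
  meas : ∀ ξ : Ed d, Measurable fun p : ℝ × Ed d => A p.1 p.2 ξ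
  cont : ∀ t x, Continuous (A t x)
  growth : ∀ t x ξ, ‖A t x ξ‖ ≤ Λ * ‖ξ‖
  monotone : ∀ t x ξ η, Λ⁻¹ * ‖η - ξ‖ ^ 2 ≤ ⟪A t x η - A t x ξ, η - ξ⟫

/-- The ellipticity and symmetry conditions on the jump kernel `K`. -/
structure KernelHyp (d : ℕ) (s Λ : ℝ) (K : ℝ → Ed d → Ed d → ℝ) : Prop where
  meas : Measurable fun p : ℝ × Ed d × Ed d => K p.1 p.2.1 p.2.2
  symm : ∀ t x y, K t x y = K t y x
  lower : ∀ t x y, x ≠ y → Λ⁻¹ / ‖x - y‖ ^ ((d : ℝ) + 2 * s) ≤ K t x y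
  upper : ∀ t x y, x ≠ y → K t x y ≤ Λ / ‖x - y‖ ^ ((d : ℝ) + 2 * s)

/-- Membership of `v` (with weak spatial gradient `Dv`) in the function space
`L²_loc(J; W^{1,2}_loc(Ω)) ∩ L^∞_loc(J; L²_loc(Ω)) ∩ L²_loc(J; 𝓛¹_{2s}(ℝ^d))`. -/
structure LocalWeakReg (d : ℕ) (s : ℝ) (J : Set ℝ) (Ω : Set (Ed d))
    (v : ℝ → Ed d → ℝ) (Dv : ℝ → Ed d → Ed d) : Prop where
  meas : Measurable (Function.uncurry v)
  measD : Measurable (Function.uncurry Dv)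
  grad : ∀ t ∈ J, ∀ φ : Ed d → ℝ, ContDiff ℝ (⊤ : ℕ∞) φ → HasCompactSupport φ →
    tsupport φ ⊆ Ω → ∀ e : Ed d,
      ∫ x, v t x * (fderiv ℝ φ x) e = - ∫ x, φ x * ⟪Dv t x, e⟫
  l2w12 : ∀ t₁ t₂ : ℝ, Set.Icc t₁ t₂ ⊆ J → ∀ Kc : Set (Ed d), IsCompact Kc → Kc ⊆ Ω →
    MeasureTheory.IntegrableOn
      (fun p : ℝ × Ed d => (v p.1 p.2) ^ 2 + ‖Dv p.1 p.2‖ ^ 2) ((Set.Ioo t₁ t₂) ×ˢ Kc)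
  linfl2 : ∀ t₁ t₂ : ℝ, Set.Icc t₁ t₂ ⊆ J → ∀ Kc : Set (Ed d), IsCompact Kc → Kc ⊆ Ω →
    ∃ M : ℝ, ∀ᵐ t ∂(volume.restrict (Set.Ioo t₁ t₂)), (∫ x in Kc, (v t x) ^ 2) ≤ M
  tail_ae : ∀ᵐ t : ℝ, t ∈ J →
    MeasureTheory.Integrable fun y : Ed d => |v t y| / (1 + ‖y‖ ^ ((d : ℝ) + 2 * s))
  tail_l2 : ∀ t₁ t₂ : ℝ, Set.Icc t₁ t₂ ⊆ J →
    MeasureTheory.IntegrableOn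
      (fun t => (∫ y : Ed d, |v t y| / (1 + ‖y‖ ^ ((d : ℝ) + 2 * s))) ^ 2) (Set.Ioo t₁ t₂)

/-- Smooth test functions with compact spatial support contained in `Ω`. -/
def IsTestFunction (Ω : Set (Ed d)) (φ : ℝ → Ed d → ℝ) : Prop :=
  ContDiff ℝ (⊤ : ℕ∞) (Function.uncurry φ) ∧
    ∃ Kc : Set (Ed d), IsCompact Kc ∧ Kc ⊆ Ω ∧ ∀ t, tsupport (φ t) ⊆ Kc

/-- The left-hand side of the weak formulation of
`∂_t u - div(𝒜(t,x,Du)) + ℒu` tested against `φ` on `(t₁,t₂] × Ω`. -/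
def mixedLHS (A : ℝ → Ed d → Ed d → Ed d) (K : ℝ → Ed d → Ed d → ℝ)
    (Ω : Set (Ed d)) (u : ℝ → Ed d → ℝ) (Du : ℝ → Ed d → Ed d)
    (φ : ℝ → Ed d → ℝ) (t₁ t₂ : ℝ) : ℝ :=
  -(∫ t in Set.Ioc t₁ t₂, ∫ x in Ω, u t x * deriv (fun τ => φ τ x) t)
    + (∫ x in Ω, u t₂ x * φ t₂ x) - (∫ x in Ω, u t₁ x * φ t₁ x)
    + (∫ t in Set.Ioc t₁ t₂, ∫ x in Ω, ⟪A t x (Du t x), gradient (φ t) x⟫)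
    + ∫ t in Set.Ioc t₁ t₂, ∫ x : Ed d, ∫ y : Ed d,
        (u t x - u t y) * (φ t x - φ t y) * K t x y

/-- Integral of a function against a finite signed measure. -/
def signedIntegral (μ : MeasureTheory.SignedMeasure (ℝ × Ed d)) (f : ℝ × Ed d → ℝ) : ℝ :=
  (∫ p, f p ∂μ.toJordanDecomposition.posPart)
    - ∫ p, f p ∂μ.toJordanDecomposition.negPart

/-- Local weak solution of `∂_t u - div(𝒜(t,x,Du)) + ℒu = μ` in `J × Ω`. -/
def IsLocalWeakSolution (A : ℝ → Ed d → Ed d → Ed d) (K : ℝ → Ed d → Ed d → ℝ)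
    (J : Set ℝ) (Ω : Set (Ed d)) (μ : MeasureTheory.SignedMeasure (ℝ × Ed d))
    (u : ℝ → Ed d → ℝ) (Du : ℝ → Ed d → Ed d) : Prop :=
  ∀ t₁ t₂ : ℝ, t₁ ≤ t₂ → Set.Icc t₁ t₂ ⊆ J →
    ∀ φ : ℝ → Ed d → ℝ, IsTestFunction Ω φ →
      mixedLHS A K Ω u Du φ t₁ t₂ =
        signedIntegral μ (Set.indicator ((Set.Ioc t₁ t₂) ×ˢ Ω) fun p => φ p.1 p.2)

/-- Local weak solution of the homogeneous equation
`∂_t v - div(𝒜(t,x,Dv)) + ℒv = 0` in `J × Ω`. -/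
def IsLocalWeakSolutionHom (A : ℝ → Ed d → Ed d → Ed d) (K : ℝ → Ed d → Ed d → ℝ)
    (J : Set ℝ) (Ω : Set (Ed d))
    (v : ℝ → Ed d → ℝ) (Dv : ℝ → Ed d → Ed d) : Prop :=
  ∀ t₁ t₂ : ℝ, t₁ ≤ t₂ → Set.Icc t₁ t₂ ⊆ J →
    ∀ φ : ℝ → Ed d → ℝ, IsTestFunction Ω φ → mixedLHS A K Ω v Dv φ t₁ t₂ = 0

/-- Local weak subsolution of the homogeneous equation in `J × Ω`. -/
def IsLocalWeakSubsolutionHom (A : ℝ → Ed d → Ed d → Ed d) (K : ℝ → Ed d → Ed d → ℝ)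
    (J : Set ℝ) (Ω : Set (Ed d))
    (v : ℝ → Ed d → ℝ) (Dv : ℝ → Ed d → Ed d) : Prop :=
  ∀ t₁ t₂ : ℝ, t₁ ≤ t₂ → Set.Icc t₁ t₂ ⊆ J →
    ∀ φ : ℝ → Ed d → ℝ, IsTestFunction Ω φ → (∀ t x, 0 ≤ φ t x) →
      mixedLHS A K Ω v Dv φ t₁ t₂ ≤ 0

/-- Local weak supersolution of the homogeneous equation in `J × Ω`. -/
def IsLocalWeakSupersolutionHom (A : ℝ → Ed d → Ed d → Ed d) (K : ℝ → Ed d → Ed d → ℝ)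
    (J : Set ℝ) (Ω : Set (Ed d))
    (v : ℝ → Ed d → ℝ) (Dv : ℝ → Ed d → Ed d) : Prop :=
  ∀ t₁ t₂ : ℝ, t₁ ≤ t₂ → Set.Icc t₁ t₂ ⊆ J →
    ∀ φ : ℝ → Ed d → ℝ, IsTestFunction Ω φ → (∀ t x, φ t x ≤ 0) →
      mixedLHS A K Ω v Dv φ t₁ t₂ ≤ 0

/-- The global excess functional `E(u,t₀,x₀,R)`. -/
def Excess (s q : ℝ) (u : ℝ → Ed d → ℝ) (t₀ : ℝ) (x₀ : Ed d) (R : ℝ) : ℝ :=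
  (⨍ t in Iminus t₀ R, (⨍ x in Metric.ball x₀ R,
      |u t x - ⨍ p in pCyl t₀ x₀ R, u p.1 p.2|) ^ q) ^ (1 / q)
  + (⨍ t in Iminus t₀ R,
      (Tail s (fun y => u t y - ⨍ p in pCyl t₀ x₀ R, u p.1 p.2) x₀ R) ^ q) ^ (1 / q)

set_option linter.unusedSectionVars false

section Mollification

open scoped Convolution

variable {E : Type*} [NormedAddCommGroup E] [NormedSpace ℝ E] [FiniteDimensional ℝ E]
  [MeasureSpace E] [BorelSpace E] [(volume : Measure E).IsAddHaarMeasure]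

/-- A sequence of bump functions shrinking to the origin. -/
def bumpSeq (E : Type*) [NormedAddCommGroup E] [NormedSpace ℝ E] (n : ℕ) :
    ContDiffBump (0 : E) where
  rIn := 1 / (2 * ((n : ℝ) + 1))
  rOut := 1 / ((n : ℝ) + 1)
  rIn_pos := by positivity
  rIn_lt_rOut := by
    have : (0 : ℝ) < n + 1 := by positivity
    exact one_div_lt_one_div_of_lt this (by linarith)

/-- The standard mollifying kernel at scale `1 / (n + 1)`. -/
def mollKer (E : Type*) [NormedAddCommGroup E] [NormedSpace ℝ E] [FiniteDimensional ℝ E]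
    [MeasureSpace E] [BorelSpace E] (n : ℕ) : E → ℝ :=
  (bumpSeq E n).normed volume

/-- The mollification of `f` at scale `1 / (n + 1)`. -/
def moll (n : ℕ) (f : E → ℝ) : E → ℝ :=
  mollKer E n ⋆[ContinuousLinearMap.lsmul ℝ ℝ, volume] f

/-- `g` is the distributional derivative of `f` in the direction `e`. -/
def WeakDeriv (f g : E → ℝ) (e : E) : Prop :=
  ∀ Ψ : E → ℝ, ContDiff ℝ (⊤ : ℕ∞) Ψ → HasCompactSupport Ψ →
    ∫ p, f p * fderiv ℝ Ψ p e = -∫ p, g p * Ψ p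

lemma bumpSeq_rOut_tendsto : Tendsto (fun n => (bumpSeq E n).rOut) atTop (𝓝 0) :=
  tendsto_one_div_add_atTop_nhds_zero_nat

lemma mollKer_nonneg (n : ℕ) (p : E) : 0 ≤ mollKer E n p :=
  (bumpSeq E n).nonneg_normed p

lemma mollKer_contDiff (n : ℕ) : ContDiff ℝ (⊤ : ℕ∞) (mollKer E n) :=
  (bumpSeq E n).contDiff_normed

lemma mollKer_continuous (n : ℕ) : Continuous (mollKer E n) :=
  (bumpSeq E n).continuous_normed

lemma mollKer_hasCompactSupport (n : ℕ) : HasCompactSupport (mollKer E n) :=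
  (bumpSeq E n).hasCompactSupport_normed

lemma mollKer_neg (n : ℕ) (p : E) : mollKer E n (-p) = mollKer E n p :=
  (bumpSeq E n).normed_neg p

lemma mollKer_integral (n : ℕ) : ∫ p, mollKer E n p = 1 :=
  (bumpSeq E n).integral_normed

lemma mollKer_integrable (n : ℕ) : Integrable (mollKer E n) :=
  (bumpSeq E n).integrable_normed

lemma mollKer_eq_zero {n : ℕ} {p : E} (hp : 1 / ((n : ℝ) + 1) ≤ ‖p‖) : mollKer E n p = 0 := by
  have h : p ∉ Function.support (mollKer E n) := by
    rw [mollKer, (bumpSeq E n).support_normed_eq]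
    simpa [bumpSeq] using hp
  simpa using h

lemma mollKer_lintegral (n : ℕ) : ∫⁻ p, ENNReal.ofReal (mollKer E n p) = 1 := by
  rw [← ofReal_integral_eq_lintegral_ofReal (mollKer_integrable n)
    (ae_of_all _ (mollKer_nonneg n)), mollKer_integral, ENNReal.ofReal_one]

lemma moll_apply (n : ℕ) (f : E → ℝ) (p : E) :
    moll n f p = ∫ q, mollKer E n q * f (p - q) := rfl

lemma moll_apply_swap (n : ℕ) (f : E → ℝ) (p : E) :
    moll n f p = ∫ q, mollKer E n (p - q) * f q := by
  rw [moll, convolution_eq_swap]; rfl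

lemma moll_contDiff (n : ℕ) {f : E → ℝ} (hf : LocallyIntegrable f) :
    ContDiff ℝ (⊤ : ℕ∞) (moll n f) :=
  (mollKer_hasCompactSupport n).contDiff_convolution_left _ (mollKer_contDiff n) hf

lemma moll_integrand_integrable (n : ℕ) {f : E → ℝ} (hf : LocallyIntegrable f) (p : E) :
    Integrable fun q => mollKer E n q * f (p - q) :=
  ((mollKer_hasCompactSupport n).convolutionExists_left
    (ContinuousLinearMap.lsmul ℝ ℝ) (mollKer_continuous n) hf) p

lemma moll_integrand_integrable_swap (n : ℕ) {f : E → ℝ} (hf : LocallyIntegrable f) (p : E) :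
    Integrable fun q => mollKer E n (p - q) * f q := by
  simpa using (moll_integrand_integrable n hf p).comp_sub_left p

lemma fderiv_moll_eq_integral (n : ℕ) {f : E → ℝ} (e : E) (hf : LocallyIntegrable f) (p : E) :
    fderiv ℝ (moll n f) p e = ∫ q, fderiv ℝ (mollKer E n) q e * f (p - q) := by
  have h1 := (mollKer_hasCompactSupport (E := E) n).hasFDerivAt_convolution_left
    (ContinuousLinearMap.lsmul ℝ ℝ) ((mollKer_contDiff n).of_le (by simp)) hf p
  have hint := ((mollKer_hasCompactSupport (E := E) n).fderiv ℝ).convolutionExists_left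
      ((ContinuousLinearMap.lsmul ℝ ℝ : ℝ →L[ℝ] ℝ →L[ℝ] ℝ).precompL E)
      ((mollKer_contDiff (E := E) n).continuous_fderiv (by simp)) hf
  have hD : fderiv ℝ (moll n f) p = _ := h1.fderiv
  rw [hD, convolution_def]
  refine (ContinuousLinearMap.integral_apply (hint p) e).trans ?_
  refine integral_congr_ae (ae_of_all _ fun q => ?_)
  simp [ContinuousLinearMap.precompL_apply]

lemma fderiv_moll (n : ℕ) {f g : E → ℝ} {e : E} (hf : LocallyIntegrable f)
    (h : WeakDeriv f g e) (p : E) : fderiv ℝ (moll n f) p e = moll n g p := by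
  have hΨ : ContDiff ℝ (⊤ : ℕ∞) fun q => mollKer E n (p - q) :=
    (mollKer_contDiff n).comp (contDiff_const.sub contDiff_id)
  have hΨc : HasCompactSupport fun q => mollKer E n (p - q) :=
    (mollKer_hasCompactSupport n).comp_homeomorph (Homeomorph.subLeft p)
  have h3 : ∀ q, fderiv ℝ (fun q => mollKer E n (p - q)) q e
      = - fderiv ℝ (mollKer E n) (p - q) e := by
    intro q
    have hd : HasFDerivAt (fun q : E => p - q) (-(ContinuousLinearMap.id ℝ E)) q := by
      simpa using (hasFDerivAt_id q).const_sub p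
    have hk : HasFDerivAt (mollKer E n) (fderiv ℝ (mollKer E n) (p - q)) (p - q) :=
      ((mollKer_contDiff n).differentiable (by simp) _).hasFDerivAt
    have hc : HasFDerivAt (fun q => mollKer E n (p - q)) _ q := hk.comp q hd
    rw [hc.fderiv]; simp
  have h4 := h _ hΨ hΨc
  simp_rw [h3] at h4
  rw [fderiv_moll_eq_integral n e hf, moll_apply_swap, ← integral_sub_left_eq_self _ volume p]
  simp only [sub_sub_cancel]
  rw [show (∫ q, mollKer E n (p - q) * g q) = ∫ q, g q * mollKer E n (p - q) from
    integral_congr_ae (ae_of_all _ fun q => mul_comm _ _), ← neg_inj, ← h4, ← integral_neg]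
  exact integral_congr_ae (ae_of_all _ fun q => by simp [mul_comm])

lemma weakDeriv_of_contDiff {f : E → ℝ} (hf : ContDiff ℝ 1 f) (e : E) :
    WeakDeriv f (fun p => fderiv ℝ f p e) e := by
  intro Ψ hΨ hc
  have hΨ1 : ContDiff ℝ 1 Ψ := hΨ.of_le (by simp)
  have cf : Continuous fun p => fderiv ℝ f p e := (hf.continuous_fderiv one_ne_zero).clm_apply
    continuous_const
  have cΨ : Continuous fun p => fderiv ℝ Ψ p e := (hΨ1.continuous_fderiv one_ne_zero).clm_apply
    continuous_const
  refine integral_mul_fderiv_eq_neg_fderiv_mul_of_integrable ?_ ?_ ?_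
    (fun x _ => hf.differentiable one_ne_zero x) (fun x _ => hΨ1.differentiable one_ne_zero x)
  · exact (cf.mul hΨ1.continuous).integrable_of_hasCompactSupport hc.mul_left
  · exact (hf.continuous.mul cΨ).integrable_of_hasCompactSupport
      ((hc.fderiv_apply ℝ e).mul_left)
  · exact (hf.continuous.mul hΨ1.continuous).integrable_of_hasCompactSupport hc.mul_left

lemma moll_le (n : ℕ) {f : E → ℝ} (hf : LocallyIntegrable f) {M : ℝ} (h : ∀ᵐ p, f p ≤ M)
    (p : E) : moll n f p ≤ M := by
  have h1 : M = ∫ q, mollKer E n (p - q) * M := by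
    rw [integral_mul_const, integral_sub_left_eq_self (mollKer E n) volume p, mollKer_integral,
      one_mul]
  rw [h1, moll_apply_swap]
  refine integral_mono_ae (moll_integrand_integrable_swap n hf p)
    (((mollKer_integrable n).comp_sub_left p).mul_const M) ?_
  filter_upwards [h] with q hq
  exact mul_le_mul_of_nonneg_left hq (mollKer_nonneg n _)

lemma moll_nonneg (n : ℕ) {f : E → ℝ} (h : ∀ᵐ p, 0 ≤ f p) (p : E) : 0 ≤ moll n f p := by
  rw [moll_apply_swap]
  refine integral_nonneg_of_ae ?_
  filter_upwards [h] with q hq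
  exact mul_nonneg (mollKer_nonneg n _) hq

lemma moll_eq_zero (n : ℕ) {f : E → ℝ} {p : E}
    (h : ∀ q, dist p q < 1 / ((n : ℝ) + 1) → f q = 0) : moll n f p = 0 := by
  rw [moll_apply_swap]
  refine integral_eq_zero_of_ae (ae_of_all _ fun q => ?_)
  by_cases hq : dist p q < 1 / ((n : ℝ) + 1)
  · simp [h q hq]
  · simp [mollKer_eq_zero (p := p - q) (by rw [← dist_eq_norm]; exact not_lt.1 hq)]

lemma moll_sub (n : ℕ) {f g : E → ℝ} (hf : LocallyIntegrable f) (hg : LocallyIntegrable g) :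
    moll n (f - g) = moll n f - moll n g := by
  ext p
  simp only [moll_apply, Pi.sub_apply, mul_sub]
  exact integral_sub (moll_integrand_integrable n hf p) (moll_integrand_integrable n hg p)

lemma integral_mul_moll (n : ℕ) {f g : E → ℝ} (hf : LocallyIntegrable f) (hg : Continuous g)
    (hgc : HasCompactSupport g) : ∫ p, f p * moll n g p = ∫ p, moll n f p * g p := by
  have hint : Integrable (Function.uncurry fun p q => f p * (mollKer E n (p - q) * g q))
      (volume.prod volume) := by
    set S : Set E := tsupport g
    have hS : IsCompact S := hgc
    set S' : Set E := Metric.cthickening (1 / ((n : ℝ) + 1)) S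
    have hS' : IsCompact S' := hS.cthickening
    have h1 : Integrable (fun z : E × E => S'.indicator f z.1 * S.indicator g z.2)
        (volume.prod volume) := by
      refine Integrable.mul_prod ?_ ?_
      · exact (integrable_indicator_iff hS'.measurableSet).2 (hf.integrableOn_isCompact hS')
      · exact (integrable_indicator_iff hS.measurableSet).2
          (hg.integrable_of_hasCompactSupport hgc).integrableOn
    obtain ⟨C, hC⟩ := (mollKer_hasCompactSupport (E := E) n).exists_bound_of_continuous
      (mollKer_continuous n)
    have h2 : Integrable (fun z : E × E => mollKer E n (z.1 - z.2) *
        (S'.indicator f z.1 * S.indicator g z.2)) (volume.prod volume) := by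
      refine h1.bdd_mul (c := C) ?_ (ae_of_all _ fun z => hC _)
      exact ((mollKer_continuous n).comp (continuous_fst.sub continuous_snd)).aestronglyMeasurable
    refine h2.congr (ae_of_all _ fun z => ?_)
    obtain ⟨p, q⟩ := z
    simp only [Function.uncurry_apply_pair]
    by_cases hq : q ∈ S
    · by_cases hp : p ∈ S'
      · simp [hq, hp]; ring
      · have : mollKer E n (p - q) = 0 := by
          apply mollKer_eq_zero
          by_contra hlt
          apply hp
          rw [not_le, ← dist_eq_norm] at hlt
          exact Metric.mem_cthickening_of_dist_le p q _ S hq hlt.le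
        simp [this]
    · simp [hq, image_eq_zero_of_notMem_tsupport hq]
  calc ∫ p, f p * moll n g p = ∫ p, ∫ q, f p * (mollKer E n (p - q) * g q) := by
        simp_rw [moll_apply_swap, integral_const_mul]
    _ = ∫ q, ∫ p, f p * (mollKer E n (p - q) * g q) := integral_integral_swap hint
    _ = ∫ q, moll n f q * g q := by
        refine integral_congr_ae (ae_of_all _ fun q => ?_)
        simp only [moll_apply_swap, ← integral_mul_const]
        refine integral_congr_ae (ae_of_all _ fun p => ?_)
        simp only
        rw [← mollKer_neg n (p - q), neg_sub]; ring

lemma lintegral_sq_le_of_isProbabilityMeasure {α : Type*} [MeasurableSpace α] {ν : Measure α}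
    [IsProbabilityMeasure ν] {f : α → ℝ≥0∞} (hf : AEMeasurable f ν) :
    (∫⁻ x, f x ∂ν) ^ 2 ≤ ∫⁻ x, f x ^ 2 ∂ν := by
  have h := ENNReal.lintegral_mul_le_Lp_mul_Lq ν Real.HolderConjugate.two_two hf
    (aemeasurable_const (b := (1 : ℝ≥0∞)))
  simp only [Pi.mul_apply, mul_one, ENNReal.one_rpow, lintegral_const, measure_univ] at h
  calc (∫⁻ x, f x ∂ν) ^ 2 ≤ ((∫⁻ x, f x ^ (2 : ℝ) ∂ν) ^ (1 / 2 : ℝ)) ^ 2 := by gcongr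
    _ = ∫⁻ x, f x ^ 2 ∂ν := by
      rw [← ENNReal.rpow_natCast, ← ENNReal.rpow_mul]
      norm_num

lemma eLpNorm_two_eq {α : Type*} [MeasurableSpace α] (ν : Measure α) (f : α → ℝ) :
    eLpNorm f 2 ν = (∫⁻ x, ‖f x‖ₑ ^ 2 ∂ν) ^ (1 / 2 : ℝ) := by
  rw [eLpNorm_eq_lintegral_rpow_enorm_toReal (by norm_num) (by norm_num)]
  simp

lemma eLpNorm_two_sq {α : Type*} [MeasurableSpace α] (ν : Measure α) (f : α → ℝ) :
    eLpNorm f 2 ν ^ 2 = ∫⁻ x, ‖f x‖ₑ ^ 2 ∂ν := by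
  rw [eLpNorm_two_eq, ← ENNReal.rpow_natCast, ← ENNReal.rpow_mul]
  norm_num

lemma eLpNorm_moll_le (n : ℕ) {f : E → ℝ} (hf : AEStronglyMeasurable f) :
    eLpNorm (moll n f) 2 ≤ eLpNorm f 2 := by
  rw [eLpNorm_two_eq, eLpNorm_two_eq]
  refine ENNReal.rpow_le_rpow ?_ (by norm_num)
  set ν : Measure E := volume.withDensity fun q => ENNReal.ofReal (mollKer E n q)
  have hkm : Measurable fun q => ENNReal.ofReal (mollKer E n q) :=
    (mollKer_continuous n).measurable.ennreal_ofReal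
  have : IsProbabilityMeasure ν := ⟨by
    rw [withDensity_apply _ MeasurableSet.univ, Measure.restrict_univ, mollKer_lintegral]⟩
  have hsub : AEStronglyMeasurable (fun z : E × E => f (z.1 - z.2)) (volume.prod volume) :=
    hf.comp_quasiMeasurePreserving (quasiMeasurePreserving_sub_of_right_invariant _ _)
  calc ∫⁻ p, ‖moll n f p‖ₑ ^ 2
      ≤ ∫⁻ p, ∫⁻ q, ENNReal.ofReal (mollKer E n q) * ‖f (p - q)‖ₑ ^ 2 := by
        refine lintegral_mono fun p => ?_
        have hfp : AEMeasurable (fun q => ‖f (p - q)‖ₑ) volume :=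
          (hf.comp_quasiMeasurePreserving
            (quasiMeasurePreserving_sub_left_of_right_invariant _ p)).enorm
        calc ‖moll n f p‖ₑ ^ 2 ≤ (∫⁻ q, ENNReal.ofReal (mollKer E n q) * ‖f (p - q)‖ₑ) ^ 2 := by
              gcongr
              rw [moll_apply]
              refine (enorm_integral_le_lintegral_enorm _).trans (le_of_eq ?_)
              refine lintegral_congr fun q => ?_
              rw [enorm_mul, Real.enorm_eq_ofReal (mollKer_nonneg n q)]
          _ = (∫⁻ q, ‖f (p - q)‖ₑ ∂ν) ^ 2 := by
              rw [lintegral_withDensity_eq_lintegral_mul₀ hkm.aemeasurable hfp]; rfl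
          _ ≤ ∫⁻ q, ‖f (p - q)‖ₑ ^ 2 ∂ν := lintegral_sq_le_of_isProbabilityMeasure
              (hfp.mono_ac (withDensity_absolutelyContinuous _ _))
          _ = _ := by
              rw [lintegral_withDensity_eq_lintegral_mul₀ hkm.aemeasurable (hfp.pow_const 2)]; rfl
    _ = ∫⁻ q, ∫⁻ p, ENNReal.ofReal (mollKer E n q) * ‖f (p - q)‖ₑ ^ 2 := by
        refine lintegral_lintegral_swap ?_
        exact (hkm.comp measurable_snd).aemeasurable.mul (hsub.enorm.pow_const 2)
    _ = ∫⁻ q, ENNReal.ofReal (mollKer E n q) * ∫⁻ p, ‖f p‖ₑ ^ 2 := by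
        refine lintegral_congr fun q => ?_
        rw [lintegral_const_mul' _ _ ENNReal.ofReal_ne_top,
          lintegral_sub_right_eq_self (fun p => ‖f p‖ₑ ^ 2) q]
    _ = ∫⁻ p, ‖f p‖ₑ ^ 2 := by
        rw [lintegral_mul_const _ hkm, mollKer_lintegral, one_mul]

lemma moll_memLp (n : ℕ) {f : E → ℝ} (hf : MemLp f 2) : MemLp (moll n f) 2 :=
  ⟨(moll_contDiff n (hf.locallyIntegrable (by norm_num))).continuous.aestronglyMeasurable,
    (eLpNorm_moll_le n hf.1).trans_lt hf.2⟩

lemma moll_tendsto_ae {f : E → ℝ} (hf : LocallyIntegrable f) :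
    ∀ᵐ p, Tendsto (fun n => moll n f p) atTop (𝓝 (f p)) := by
  refine ContDiffBump.ae_convolution_tendsto_right_of_locallyIntegrable (φ := bumpSeq E) (K := 2)
    bumpSeq_rOut_tendsto (Eventually.of_forall fun n => le_of_eq ?_) hf
  have : (n : ℝ) + 1 ≠ 0 := by positivity
  simp only [bumpSeq]
  field_simp

end Mollification

section LTwoConvergence

variable {α : Type*} [MeasurableSpace α] {μ : Measure α}

lemma tendsto_eLpNorm_two_iff {ι : Type*} {l : Filter ι} {f : ι → α → ℝ} :
    Tendsto (fun n => eLpNorm (f n) 2 μ) l (𝓝 0) ↔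
      Tendsto (fun n => ∫⁻ x, ‖f n x‖ₑ ^ 2 ∂μ) l (𝓝 0) := by
  constructor
  · intro h
    simp_rw [← eLpNorm_two_sq]
    have := ENNReal.Tendsto.pow (n := 2) h
    simpa using this
  · intro h
    simp_rw [eLpNorm_two_eq]
    have := ((ENNReal.continuous_rpow_const (y := 1 / 2)).tendsto _).comp h
    rwa [ENNReal.zero_rpow_of_pos (by norm_num)] at this

lemma tendsto_eLpNorm_two_of_ae_of_le {f : ℕ → α → ℝ} {g : α → ℝ}
    (hf : ∀ n, AEStronglyMeasurable (f n) μ) (hg : MemLp g 2 μ)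
    (hle : ∀ n, eLpNorm (f n) 2 μ ≤ eLpNorm g 2 μ)
    (hlim : ∀ᵐ x ∂μ, Tendsto (fun n => f n x) atTop (𝓝 (g x))) :
    Tendsto (fun n => eLpNorm (f n - g) 2 μ) atTop (𝓝 0) := by
  rw [tendsto_eLpNorm_two_iff]
  set F := ∫⁻ x, ‖g x‖ₑ ^ 2 ∂μ with hF
  have hFtop : F ≠ ∞ := by
    rw [hF, ← eLpNorm_two_sq]; exact ENNReal.pow_ne_top hg.2.ne
  have hfF : ∀ n, ∫⁻ x, ‖f n x‖ₑ ^ 2 ∂μ ≤ F := fun n => by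
    rw [hF, ← eLpNorm_two_sq, ← eLpNorm_two_sq]; gcongr; exact hle n
  have hpt : ∀ a b : ℝ, ‖a - b‖ₑ ^ 2 ≤ 2 * ‖a‖ₑ ^ 2 + 2 * ‖b‖ₑ ^ 2 := by
    intro a b
    simp only [← ofReal_norm, Real.norm_eq_abs]
    rw [← ENNReal.ofReal_pow (abs_nonneg _), ← ENNReal.ofReal_pow (abs_nonneg _),
      ← ENNReal.ofReal_pow (abs_nonneg _), ← ENNReal.ofReal_ofNat 2, ← ENNReal.ofReal_mul (by simp),
      ← ENNReal.ofReal_mul (by simp), ← ENNReal.ofReal_add (by positivity) (by positivity)]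
    apply ENNReal.ofReal_le_ofReal
    simp only [sq_abs]
    nlinarith [sq_nonneg (a + b)]
  set h : ℕ → α → ℝ≥0∞ := fun n x =>
    (2 * ‖f n x‖ₑ ^ 2 + 2 * ‖g x‖ₑ ^ 2) - ‖f n x - g x‖ₑ ^ 2 with hh
  set D : ℕ → ℝ≥0∞ := fun n => ∫⁻ x, ‖(f n - g) x‖ₑ ^ 2 ∂μ with hD
  have hgm := hg.1
  have hDF : ∀ n, D n + ∫⁻ x, h n x ∂μ ≤ 4 * F := by
    intro n
    rw [hD, ← lintegral_add_left' (((hf n).sub hgm).enorm.pow_const 2)]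
    calc _ = ∫⁻ x, (2 * ‖f n x‖ₑ ^ 2 + 2 * ‖g x‖ₑ ^ 2) ∂μ := by
          refine lintegral_congr fun x => ?_
          exact add_tsub_cancel_of_le (hpt _ _)
      _ = 2 * ∫⁻ x, ‖f n x‖ₑ ^ 2 ∂μ + 2 * F := by
          rw [lintegral_add_left' (((hf n).enorm.pow_const 2).const_mul 2),
            lintegral_const_mul' _ _ (by norm_num), lintegral_const_mul' _ _ (by norm_num)]
      _ ≤ 2 * F + 2 * F := by gcongr; exact hfF n
      _ = 4 * F := by ring
  have hDtop : ∀ n, D n ≠ ∞ := fun n =>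
    ne_top_of_le_ne_top (ENNReal.mul_ne_top (by norm_num) hFtop) (le_self_add.trans (hDF n))
  have h1 : 4 * F ≤ liminf (fun n => ∫⁻ x, h n x ∂μ) atTop := by
    refine le_trans (le_of_eq ?_) (lintegral_liminf_le' (fun n => ?_))
    · rw [hF, ← lintegral_const_mul' _ _ (by norm_num)]
      refine lintegral_congr_ae ?_
      filter_upwards [hlim] with x hx
      have e1 : Tendsto (fun n => ‖f n x‖ₑ) atTop (𝓝 ‖g x‖ₑ) := hx.enorm
      have e2 : Tendsto (fun n => ‖f n x - g x‖ₑ ^ 2) atTop (𝓝 0) := by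
        have : Tendsto (fun n => ‖f n x - g x‖ₑ) atTop (𝓝 ‖g x - g x‖ₑ) :=
          (hx.sub_const (g x)).enorm
        simpa using ENNReal.Tendsto.pow (n := 2) this
      have e3 : Tendsto (fun n => h n x) atTop
          (𝓝 ((2 * ‖g x‖ₑ ^ 2 + 2 * ‖g x‖ₑ ^ 2) - 0)) := by
        refine ENNReal.Tendsto.sub (Tendsto.add (ENNReal.Tendsto.const_mul
          (ENNReal.Tendsto.pow e1) (Or.inr (by norm_num))) tendsto_const_nhds) e2 (Or.inr (by simp))
      rw [e3.liminf_eq, tsub_zero]; ring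
    · exact ((((hf n).enorm.pow_const 2).const_mul 2).add
        ((hgm.enorm.pow_const 2).const_mul 2)).sub (((hf n).sub hgm).enorm.pow_const 2)
  have h2 : 4 * F ≤ 4 * F - limsup D atTop := by
    rw [← ENNReal.liminf_const_sub]
    · refine h1.trans (liminf_le_liminf (Eventually.of_forall fun n => ?_))
      exact ENNReal.le_sub_of_add_le_left (hDtop n) (hDF n)
    · exact (ENNReal.mul_ne_top (by norm_num) hFtop : 4 * F ≠ ∞)
  have h3 : limsup D atTop ≤ 4 * F :=
    limsup_le_of_le (h := Eventually.of_forall fun n => le_self_add.trans (hDF n))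
  have h4 : limsup D atTop = 0 := by
    have h5 : 4 * F + limsup D atTop ≤ 4 * F := by
      calc 4 * F + limsup D atTop ≤ (4 * F - limsup D atTop) + limsup D atTop := by gcongr
        _ = 4 * F := tsub_add_cancel_of_le h3
    have h6 : limsup D atTop ≤ 0 := by
      refine (ENNReal.add_le_add_iff_left (ENNReal.mul_ne_top (by norm_num) hFtop :
        4 * F ≠ ∞)).1 ?_
      simpa using h5
    exact le_antisymm h6 bot_le
  exact tendsto_of_le_liminf_of_limsup_le bot_le h4.le

lemma tendsto_eLpNorm_two_bdd_mul {b : ℕ → α → ℝ} {b' : α → ℝ} {f : ℕ → α → ℝ} {g : α → ℝ}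
    {M : ℝ} (hbm : ∀ n, AEStronglyMeasurable (b n) μ) (hb'm : AEStronglyMeasurable b' μ)
    (hb : ∀ n, ∀ᵐ x ∂μ, |b n x| ≤ M)
    (hlim : ∀ᵐ x ∂μ, Tendsto (fun n => b n x) atTop (𝓝 (b' x)))
    (hf : ∀ n, AEStronglyMeasurable (f n) μ) (hg : MemLp g 2 μ)
    (hfg : Tendsto (fun n => eLpNorm (f n - g) 2 μ) atTop (𝓝 0)) :
    Tendsto (fun n => eLpNorm (b n * f n - b' * g) 2 μ) atTop (𝓝 0) := by
  have hb' : ∀ᵐ x ∂μ, |b' x| ≤ M := by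
    filter_upwards [hlim, ae_all_iff.2 hb] with x hx hx2
    exact le_of_tendsto hx.abs (Eventually.of_forall hx2)
  have h1 : Tendsto (fun n => ENNReal.ofReal M * eLpNorm (f n - g) 2 μ) atTop (𝓝 0) := by
    simpa using ENNReal.Tendsto.const_mul hfg (Or.inr ENNReal.ofReal_ne_top)
  have h2 : Tendsto (fun n => eLpNorm ((b n - b') * g) 2 μ) atTop (𝓝 0) := by
    rw [tendsto_eLpNorm_two_iff]
    have hfin : ∫⁻ x, (ENNReal.ofReal (2 * M)) ^ 2 * ‖g x‖ₑ ^ 2 ∂μ ≠ ∞ := by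
      rw [lintegral_const_mul' _ _ (ENNReal.pow_ne_top ENNReal.ofReal_ne_top), ← eLpNorm_two_sq]
      exact ENNReal.mul_ne_top (ENNReal.pow_ne_top ENNReal.ofReal_ne_top)
        (ENNReal.pow_ne_top hg.2.ne)
    have := tendsto_lintegral_of_dominated_convergence'
      (F := fun n x => ‖((b n - b') * g) x‖ₑ ^ 2) (f := fun _ => 0)
      (fun x => (ENNReal.ofReal (2 * M)) ^ 2 * ‖g x‖ₑ ^ 2)
      (fun n => ((((hbm n).sub hb'm).mul hg.1).enorm.pow_const 2)) ?_ hfin ?_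
    · simpa using this
    · intro n
      filter_upwards [hb n, hb'] with x hx hx'
      simp only [Pi.mul_apply, Pi.sub_apply, enorm_mul, mul_pow]
      gcongr
      rw [← ofReal_norm]
      apply ENNReal.ofReal_le_ofReal
      calc ‖b n x - b' x‖ ≤ ‖b n x‖ + ‖b' x‖ := norm_sub_le _ _
        _ ≤ 2 * M := by simp only [Real.norm_eq_abs]; linarith
    · filter_upwards [hlim] with x hx
      have : Tendsto (fun n => ‖(b n x - b' x) * g x‖ₑ) atTop (𝓝 ‖(b' x - b' x) * g x‖ₑ) :=
        ((hx.sub_const _).mul_const _).enorm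
      simpa using ENNReal.Tendsto.pow (n := 2) this
  have h3 : Tendsto (fun n => ENNReal.ofReal M * eLpNorm (f n - g) 2 μ
      + eLpNorm ((b n - b') * g) 2 μ) atTop (𝓝 0) := by simpa using h1.add h2
  refine tendsto_of_tendsto_of_tendsto_of_le_of_le tendsto_const_nhds h3 (fun _ => bot_le)
    fun n => ?_
  have e : b n * f n - b' * g = b n * (f n - g) + (b n - b') * g := by ring
  simp only
  rw [e]
  refine (eLpNorm_add_le ((hbm n).mul ((hf n).sub hg.1)) (((hbm n).sub hb'm).mul hg.1)
    (by norm_num)).trans ?_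
  gcongr
  refine eLpNorm_le_mul_eLpNorm_of_ae_le_mul ?_ 2
  filter_upwards [hb n] with x hx
  simp only [Pi.mul_apply, norm_mul, Real.norm_eq_abs]
  gcongr

lemma memLp_bdd_mul {b g : α → ℝ} {M : ℝ} (hbm : AEStronglyMeasurable b μ)
    (hb : ∀ᵐ x ∂μ, |b x| ≤ M) (hg : MemLp g 2 μ) : MemLp (b * g) 2 μ := by
  refine MemLp.of_le_mul (c := M) hg (hbm.mul hg.1) ?_
  filter_upwards [hb] with x hx
  simp only [Pi.mul_apply, norm_mul, Real.norm_eq_abs]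
  gcongr

lemma tendsto_integral_mul_of_eLpNorm {a : α → ℝ} {f : ℕ → α → ℝ} {g : α → ℝ}
    (ha : MemLp a 2 μ) (hf : ∀ n, MemLp (f n) 2 μ) (hg : MemLp g 2 μ)
    (hfg : Tendsto (fun n => eLpNorm (f n - g) 2 μ) atTop (𝓝 0)) :
    Tendsto (fun n => ∫ x, a x * f n x ∂μ) atTop (𝓝 (∫ x, a x * g x ∂μ)) := by
  refine tendsto_integral_of_L1' _ (ha.integrable_mul hg).aestronglyMeasurable
    (Eventually.of_forall fun n => ha.integrable_mul (hf n)) ?_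
  have h1 : Tendsto (fun n => eLpNorm a 2 μ * eLpNorm (f n - g) 2 μ) atTop (𝓝 0) := by
    simpa using ENNReal.Tendsto.const_mul hfg (Or.inr ha.2.ne)
  refine tendsto_of_tendsto_of_tendsto_of_le_of_le tendsto_const_nhds h1 (fun _ => bot_le)
    fun n => ?_
  have e : ((fun x => a x * f n x) - a * g) = a • (f n - g) := by
    ext x; simp [mul_sub]
  change eLpNorm ((fun x => a x * f n x) - a * g) 1 μ ≤ _
  rw [e]
  exact eLpNorm_smul_le_mul_eLpNorm ((hf n).1.sub hg.1) ha.1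

end LTwoConvergence

section MollLTwo

variable {E : Type*} [NormedAddCommGroup E] [NormedSpace ℝ E] [FiniteDimensional ℝ E]
  [MeasureSpace E] [BorelSpace E] [(volume : Measure E).IsAddHaarMeasure]

lemma moll_tendsto_eLpNorm {f : E → ℝ} (hf : MemLp f 2) :
    Tendsto (fun n => eLpNorm (moll n f - f) 2) atTop (𝓝 0) :=
  tendsto_eLpNorm_two_of_ae_of_le (fun n => (moll_memLp n hf).1) hf
    (fun n => eLpNorm_moll_le n hf.1) (moll_tendsto_ae (hf.locallyIntegrable (by norm_num)))

lemma moll_tendsto_eLpNorm_of_tendsto {f : ℕ → E → ℝ} {g : E → ℝ} (hf : ∀ n, MemLp (f n) 2)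
    (hg : MemLp g 2) (hfg : Tendsto (fun n => eLpNorm (f n - g) 2) atTop (𝓝 0)) :
    Tendsto (fun n => eLpNorm (moll n (f n) - g) 2) atTop (𝓝 0) := by
  have h3 : Tendsto (fun n => eLpNorm (f n - g) 2 + eLpNorm (moll n g - g) 2) atTop (𝓝 0) := by
    simpa using hfg.add (moll_tendsto_eLpNorm hg)
  refine tendsto_of_tendsto_of_tendsto_of_le_of_le tendsto_const_nhds h3 (fun _ => bot_le)
    fun n => ?_
  have hl : ∀ {h : E → ℝ}, MemLp h 2 → LocallyIntegrable h := fun h =>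
    h.locallyIntegrable (by norm_num)
  have e : moll n (f n) - g = moll n (f n - g) + (moll n g - g) := by
    rw [moll_sub n (hl (hf n)) (hl hg)]; ring
  simp only
  rw [e]
  refine (eLpNorm_add_le (moll_memLp n ((hf n).sub hg)).1 ((moll_memLp n hg).sub hg).1
    (by norm_num)).trans ?_
  gcongr
  exact eLpNorm_moll_le n ((hf n).sub hg).1

end MollLTwo

section Truncation

/-- The truncation power `x ↦ (k - x)₊ ^ m`. -/
def truncPow (k : ℝ) (m : ℕ) (x : ℝ) : ℝ := max (k - x) 0 ^ m

lemma truncPow_nonneg (k : ℝ) (m : ℕ) (x : ℝ) : 0 ≤ truncPow k m x :=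
  pow_nonneg (le_max_right _ _) _

lemma truncPow_le {k : ℝ} (hk : 0 ≤ k) (m : ℕ) {x : ℝ} (hx : 0 ≤ x) : truncPow k m x ≤ k ^ m :=
  pow_le_pow_left₀ (le_max_right _ _) (max_le (by linarith) hk) _

lemma abs_truncPow_le {k : ℝ} (hk : 0 ≤ k) (m : ℕ) {x : ℝ} (hx : 0 ≤ x) :
    |truncPow k m x| ≤ k ^ m := by
  rw [abs_of_nonneg (truncPow_nonneg _ _ _)]; exact truncPow_le hk m hx

lemma truncPow_eq_zero {k : ℝ} {m : ℕ} (hm : m ≠ 0) {x : ℝ} (hx : k ≤ x) :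
    truncPow k m x = 0 := by
  rw [truncPow, max_eq_right (by linarith), zero_pow hm]

lemma continuous_truncPow (k : ℝ) (m : ℕ) : Continuous (truncPow k m) := by
  unfold truncPow; fun_prop

lemma hasDerivAt_truncPow (k : ℝ) (m : ℕ) (x : ℝ) :
    HasDerivAt (truncPow k (m + 2)) (-((m + 2 : ℝ) * truncPow k (m + 1) x)) x := by
  rcases lt_trichotomy x k with h | h | h
  · have h1 : HasDerivAt (fun y : ℝ => (k - y) ^ (m + 2)) (-((m + 2 : ℝ) * truncPow k (m + 1) x))
        x := by
      have := ((hasDerivAt_id x).const_sub k).pow (m + 2)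
      refine this.congr_deriv ?_
      simp [truncPow, max_eq_left (sub_nonneg.2 h.le)]
    refine h1.congr_of_eventuallyEq ?_
    filter_upwards [Iio_mem_nhds h] with y hy
    simp [truncPow, max_eq_left (sub_nonneg.2 (le_of_lt (mem_Iio.1 hy)))]
  · subst h
    have e : truncPow x (m + 1) x = 0 := truncPow_eq_zero (by simp) le_rfl
    rw [e, mul_zero, neg_zero, hasDerivAt_iff_isLittleO]
    have : (fun y => truncPow x (m + 2) y - truncPow x (m + 2) x - (y - x) • (0 : ℝ)) =O[𝓝 x]
        fun y => (y - x) ^ 2 := by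
      refine Asymptotics.IsBigO.of_bound 1 ?_
      filter_upwards [Metric.ball_mem_nhds x one_pos] with y hy
      rw [truncPow_eq_zero (by simp) le_rfl, sub_zero, smul_zero, sub_zero, one_mul, truncPow,
        norm_pow, norm_pow, Real.norm_eq_abs, Real.norm_eq_abs, abs_of_nonneg (le_max_right _ _)]
      rw [mem_ball, Real.dist_eq] at hy
      have h0 : max (x - y) 0 ≤ |y - x| := max_le (by rw [abs_sub_comm]; exact le_abs_self _)
        (abs_nonneg _)
      calc max (x - y) 0 ^ (m + 2) ≤ |y - x| ^ (m + 2) := by gcongr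
        _ ≤ |y - x| ^ 2 := pow_le_pow_of_le_one (abs_nonneg _) hy.le (by omega)
    refine this.trans_isLittleO ?_
    have h2 : (fun y : ℝ => (y - x) ^ 2) = fun y => (y - x) * (y - x) := by ext; ring
    rw [h2]
    have h3 : (fun y : ℝ => y - x) =o[𝓝 x] fun _ => (1 : ℝ) := by
      rw [Asymptotics.isLittleO_one_iff]
      have : Tendsto (fun y : ℝ => y - x) (𝓝 x) (𝓝 (x - x)) :=
        (continuous_id.sub continuous_const).tendsto x
      simpa using this
    simpa using h3.mul_isBigO (Asymptotics.isBigO_refl (fun y : ℝ => y - x) (𝓝 x))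
  · rw [truncPow_eq_zero (by simp) h.le, mul_zero, neg_zero]
    refine (hasDerivAt_const x (0 : ℝ)).congr_of_eventuallyEq ?_
    filter_upwards [Ioi_mem_nhds h] with y hy
    exact truncPow_eq_zero (by simp) (le_of_lt hy)

lemma contDiff_truncPow (k : ℝ) (m : ℕ) : ContDiff ℝ 1 (truncPow k (m + 2)) := by
  rw [contDiff_one_iff_deriv]
  refine ⟨fun x => (hasDerivAt_truncPow k m x).differentiableAt, ?_⟩
  have : deriv (truncPow k (m + 2)) = fun x => -((m + 2 : ℝ) * truncPow k (m + 1) x) :=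
    funext fun x => (hasDerivAt_truncPow k m x).deriv
  rw [this]
  exact ((continuous_truncPow k (m + 1)).const_mul _).neg

lemma fderiv_truncPow_comp {E : Type*} [NormedAddCommGroup E] [NormedSpace ℝ E] (k : ℝ) (m : ℕ)
    {f : E → ℝ} {p : E} (hf : DifferentiableAt ℝ f p) (e : E) :
    fderiv ℝ (fun p => truncPow k (m + 2) (f p)) p e
      = -((m + 2 : ℝ) * truncPow k (m + 1) (f p)) * fderiv ℝ f p e := by
  have := (hasDerivAt_truncPow k m (f p)).comp_hasFDerivAt p hf.hasFDerivAt
  have h2 := this.fderiv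
  change fderiv ℝ (truncPow k (m + 2) ∘ f) p e = _
  rw [h2]; simp

end Truncation

section TruncationApprox

variable {E : Type*} [NormedAddCommGroup E] [NormedSpace ℝ E] [FiniteDimensional ℝ E]
  [MeasureSpace E] [BorelSpace E] [(volume : Measure E).IsAddHaarMeasure]

lemma exists_approx_truncPow_mul {ι : Type*} {u : E → ℝ} (hu : MemLp u 2) (hu0 : ∀ᵐ p, 0 ≤ u p)
    {k : ℝ} (hk : 0 ≤ k) {β : E → ℝ} (hβ : ContDiff ℝ (⊤ : ℕ∞) β) (hβc : HasCompactSupport β)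
    (hβ0 : ∀ p, 0 ≤ β p) {e : ι → E} {G : ι → E → ℝ} (hG : ∀ i, MemLp (G i) 2)
    (huG : ∀ i, WeakDeriv u (G i) (e i)) {ε : ℝ} (hε : 0 < ε) :
    ∃ ψ : ℕ → E → ℝ, (∀ n, ContDiff ℝ (⊤ : ℕ∞) (ψ n)) ∧ (∀ n p, 0 ≤ ψ n p) ∧
      (∃ M, ∀ n p, ψ n p ≤ M) ∧ (∀ n p, p ∉ cthickening ε (tsupport β) → ψ n p = 0) ∧
      (∀ᵐ p, Tendsto (fun n => ψ n p) atTop (𝓝 (truncPow k 2 (u p) * β p))) ∧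
      (∀ i, Tendsto (fun n => eLpNorm ((fun p => fderiv ℝ (ψ n) p (e i)) -
        fun p => -(2 * truncPow k 1 (u p)) * G i p * β p
          + truncPow k 2 (u p) * fderiv ℝ β p (e i)) 2) atTop (𝓝 0)) ∧
      ∀ a : E, Tendsto (fun n => ∫ p, u p * fderiv ℝ (ψ n) p a) atTop
        (𝓝 (-∫ p, (truncPow k 3 (u p) / 3) * fderiv ℝ β p a)) := by
  have hul : LocallyIntegrable u := hu.locallyIntegrable (by norm_num)
  have hβ1 : ContDiff ℝ 1 β := hβ.of_le (by simp)
  obtain ⟨B, hB⟩ : ∃ B, ∀ p, β p ≤ B := by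
    obtain ⟨B, hB⟩ := hβc.exists_bound_of_continuous hβ.continuous
    exact ⟨B, fun p => (le_abs_self _).trans (hB p)⟩
  have hB0 : 0 ≤ B := (hβ0 0).trans (hB 0)
  have hdβ : ∀ a : E, Continuous fun p => fderiv ℝ β p a := fun a =>
    (hβ1.continuous_fderiv one_ne_zero).clm_apply continuous_const
  have hdβc : ∀ a : E, HasCompactSupport fun p => fderiv ℝ β p a := fun a =>
    hβc.fderiv_apply (𝕜 := ℝ) a
  set U : ℕ → E → ℝ := fun n => moll n u with hU
  have hU1 : ∀ n, ContDiff ℝ 1 (U n) := fun n => (moll_contDiff n hul).of_le (by simp)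
  have hU0 : ∀ n p, 0 ≤ U n p := fun n p => moll_nonneg n hu0 p
  have hUlim : ∀ᵐ p, Tendsto (fun n => U n p) atTop (𝓝 (u p)) := moll_tendsto_ae hul
  have hTlim : ∀ m, ∀ᵐ p, Tendsto (fun n => truncPow k m (U n p)) atTop
      (𝓝 (truncPow k m (u p))) := fun m => by
    filter_upwards [hUlim] with p hp
    exact ((continuous_truncPow k m).tendsto _).comp hp
  have hTm : ∀ m n, AEStronglyMeasurable (fun p => truncPow k m (U n p)) := fun m n =>
    ((continuous_truncPow k m).comp (hU1 n).continuous).aestronglyMeasurable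
  have hTm' : ∀ m, AEStronglyMeasurable (fun p => truncPow k m (u p)) := fun m =>
    (continuous_truncPow k m).comp_aestronglyMeasurable hu.1
  have hTb : ∀ m n, ∀ᵐ p, |truncPow k m (U n p)| ≤ k ^ m := fun m n =>
    ae_of_all _ fun p => abs_truncPow_le hk m (hU0 n p)
  have hTb' : ∀ m, ∀ᵐ p, |truncPow k m (u p)| ≤ k ^ m := fun m => by
    filter_upwards [hu0] with p hp
    exact abs_truncPow_le hk m hp
  set Φ : ℕ → E → ℝ := fun n p => truncPow k 2 (U n p) * β p with hΦ
  have hT1 : ∀ n, ContDiff ℝ 1 fun p => truncPow k 2 (U n p) := fun n =>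
    (contDiff_truncPow k 0).comp (hU1 n)
  have hΦ1 : ∀ n, ContDiff ℝ 1 (Φ n) := fun n => (hT1 n).mul hβ1
  have hΦc : ∀ n, HasCompactSupport (Φ n) := fun n => hβc.mul_left
  have hΦl : ∀ n, LocallyIntegrable (Φ n) := fun n => (hΦ1 n).continuous.locallyIntegrable
  have hΦD : ∀ n p (a : E), fderiv ℝ (Φ n) p a
      = -(2 * truncPow k 1 (U n p)) * fderiv ℝ (U n) p a * β p
        + truncPow k 2 (U n p) * fderiv ℝ β p a := by
    intro n p a
    have h1 := fderiv_truncPow_comp k 0 (((hU1 n).differentiable one_ne_zero) p) a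
    have h2 := fderiv_mul (((hT1 n).differentiable one_ne_zero) p)
      ((hβ1.differentiable one_ne_zero) p)
    simp only [hΦ]
    change (fderiv ℝ ((fun p => truncPow k 2 (U n p)) * β) p) a = _
    rw [h2]
    simp only [add_apply, smul_apply, smul_eq_mul, zero_add] at h1 ⊢
    rw [h1]
    push_cast
    ring
  have hψD : ∀ n p (a : E), fderiv ℝ (moll n (Φ n)) p a = moll n (fun p => fderiv ℝ (Φ n) p a) p :=
    fun n p a => fderiv_moll n (hΦl n) (weakDeriv_of_contDiff (hΦ1 n) a) p
  have hΦb : ∀ n p, Φ n p ≤ k ^ 2 * B := fun n p =>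
    mul_le_mul (truncPow_le hk 2 (hU0 n p)) (hB p) (hβ0 p) (by positivity)
  have hβL : MemLp β 2 := hβ.continuous.memLp_of_hasCompactSupport hβc
  -- a.e. convergence along a subsequence
  have hΦL : ∀ n, MemLp (Φ n) 2 := fun n => (hΦ1 n).continuous.memLp_of_hasCompactSupport (hΦc n)
  have hL2 : Tendsto (fun n => eLpNorm (moll n (Φ n) - fun p => truncPow k 2 (u p) * β p) 2)
      atTop (𝓝 0) := by
    refine moll_tendsto_eLpNorm_of_tendsto hΦL (memLp_bdd_mul (hTm' 2) (hTb' 2) hβL) ?_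
    refine tendsto_eLpNorm_two_bdd_mul (f := fun _ => β) (hTm 2) (hTm' 2) (hTb 2) (hTlim 2)
      (fun _ => hβL.1) hβL ?_
    simp
  obtain ⟨ns, hns, hae⟩ := (tendstoInMeasure_of_tendsto_eLpNorm (by norm_num)
    (fun n => (moll_memLp n (hΦL n)).1)
    (memLp_bdd_mul (hTm' 2) (hTb' 2) hβL).1 hL2).exists_seq_tendsto_ae
  have hfdL : ∀ n (a : E), MemLp (fun p => fderiv ℝ (Φ n) p a) 2 := fun n a =>
    (((hΦ1 n).continuous_fderiv one_ne_zero).clm_apply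
      continuous_const).memLp_of_hasCompactSupport ((hΦc n).fderiv_apply (𝕜 := ℝ) a)
  have hD : ∀ i, Tendsto (fun n => eLpNorm ((fun p => fderiv ℝ (moll n (Φ n)) p (e i)) -
        fun p => -(2 * truncPow k 1 (u p)) * G i p * β p
          + truncPow k 2 (u p) * fderiv ℝ β p (e i)) 2) atTop (𝓝 0) := by
    intro i
    have hdL : MemLp (fun p => fderiv ℝ β p (e i)) 2 :=
      (hdβ (e i)).memLp_of_hasCompactSupport (hdβc (e i))
    set b : ℕ → E → ℝ := fun n p => -(2 * truncPow k 1 (U n p)) * β p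
    set b' : E → ℝ := fun p => -(2 * truncPow k 1 (u p)) * β p
    have hbm : ∀ n, AEStronglyMeasurable (b n) := fun n =>
      (((hTm 1 n).const_mul 2).neg).mul hβL.1
    have hbm' : AEStronglyMeasurable b' := (((hTm' 1).const_mul 2).neg).mul hβL.1
    have hbb : ∀ x : ℝ, |truncPow k 1 x| ≤ k ^ 1 → ∀ p, |-(2 * truncPow k 1 x) * β p|
        ≤ 2 * k * B := by
      intro x hx p
      rw [abs_mul, abs_neg, abs_mul, abs_two, abs_of_nonneg (hβ0 p)]
      rw [pow_one] at hx
      exact mul_le_mul (by linarith) (hB p) (hβ0 p) (by positivity)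
    have hb : ∀ n, ∀ᵐ p, |b n p| ≤ 2 * k * B := fun n => by
      filter_upwards [hTb 1 n] with p hp using hbb _ hp p
    have hb' : ∀ᵐ p, |b' p| ≤ 2 * k * B := by
      filter_upwards [hTb' 1] with p hp using hbb _ hp p
    have hblim : ∀ᵐ p, Tendsto (fun n => b n p) atTop (𝓝 (b' p)) := by
      filter_upwards [hTlim 1] with p hp
      exact ((hp.const_mul 2).neg).mul_const _
    have key1 := tendsto_eLpNorm_two_bdd_mul hbm hbm' hb hblim
      (fun n => (moll_memLp n (hG i)).1) (hG i) (moll_tendsto_eLpNorm (hG i))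
    have key2 := tendsto_eLpNorm_two_bdd_mul (f := fun _ => fun p => fderiv ℝ β p (e i))
      (hTm 2) (hTm' 2) (hTb 2) (hTlim 2) (fun _ => hdL.1) hdL (by simp)
    have hL1 := memLp_bdd_mul hbm' hb' (hG i)
    have hL2 := memLp_bdd_mul (hTm' 2) (hTb' 2) hdL
    have key : Tendsto (fun n => eLpNorm ((fun p => fderiv ℝ (Φ n) p (e i)) -
        fun p => -(2 * truncPow k 1 (u p)) * G i p * β p
          + truncPow k 2 (u p) * fderiv ℝ β p (e i)) 2) atTop (𝓝 0) := by
      have h3 := key1.add key2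
      rw [add_zero] at h3
      refine tendsto_of_tendsto_of_tendsto_of_le_of_le tendsto_const_nhds h3 (fun _ => bot_le)
        fun n => ?_
      refine le_trans (le_of_eq ?_) (eLpNorm_add_le
        (((hbm n).mul (moll_memLp n (hG i)).1).sub hL1.1)
        (((hTm 2 n).mul hdL.1).sub hL2.1) (by norm_num))
      congr 1
      ext p
      simp only [Pi.sub_apply, Pi.add_apply, Pi.mul_apply, hΦD, b, b']
      rw [fderiv_moll n hul (huG i)]
      ring
    have hgL : MemLp (fun p => -(2 * truncPow k 1 (u p)) * G i p * β p
          + truncPow k 2 (u p) * fderiv ℝ β p (e i)) 2 := by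
      refine (hL1.add hL2).ae_eq (ae_of_all _ fun p => ?_)
      simp only [Pi.add_apply, Pi.mul_apply, b']
      ring
    simp_rw [hψD]
    exact moll_tendsto_eLpNorm_of_tendsto (fun n => hfdL n (e i)) hgL key
  have hInt : ∀ a : E, Tendsto (fun n => ∫ p, u p * fderiv ℝ (moll n (Φ n)) p a) atTop
        (𝓝 (-∫ p, (truncPow k 3 (u p) / 3) * fderiv ℝ β p a)) := by
    intro a
    have hdL : MemLp (fun p => fderiv ℝ β p a) 2 :=
      (hdβ a).memLp_of_hasCompactSupport (hdβc a)
    have e1 : ∀ n, ∫ p, u p * fderiv ℝ (moll n (Φ n)) p a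
        = -∫ p, (truncPow k 3 (U n p) / 3) * fderiv ℝ β p a := by
      intro n
      simp_rw [hψD]
      have h1 : Continuous fun p => fderiv ℝ (Φ n) p a :=
        ((hΦ1 n).continuous_fderiv one_ne_zero).clm_apply continuous_const
      rw [integral_mul_moll n hul h1 ((hΦc n).fderiv_apply (𝕜 := ℝ) a)]
      have hUs : ContDiff ℝ 1 (U n) := hU1 n
      have hT3 : ContDiff ℝ 1 fun p => truncPow k 3 (U n p) / 3 :=
        ((contDiff_truncPow k 1).comp hUs).div_const 3
      have h2 := weakDeriv_of_contDiff hT3 a β hβ hβc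
      rw [h2, neg_neg]
      have hcU : Continuous fun p => fderiv ℝ (U n) p a :=
        (hUs.continuous_fderiv one_ne_zero).clm_apply continuous_const
      have h3 : ∫ p, U n p * fderiv ℝ (Φ n) p a = -∫ p, fderiv ℝ (U n) p a * Φ n p := by
        refine integral_mul_fderiv_eq_neg_fderiv_mul_of_integrable ?_ ?_ ?_
          (fun p _ => hUs.differentiable one_ne_zero p)
          (fun p _ => (hΦ1 n).differentiable one_ne_zero p)
        · exact (hcU.mul (hΦ1 n).continuous).integrable_of_hasCompactSupport (hΦc n).mul_left
        · exact (hUs.continuous.mul h1).integrable_of_hasCompactSupport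
            ((hΦc n).fderiv_apply (𝕜 := ℝ) a).mul_left
        · exact (hUs.continuous.mul (hΦ1 n).continuous).integrable_of_hasCompactSupport
            (hΦc n).mul_left
      change ∫ p, U n p * fderiv ℝ (Φ n) p a = _
      rw [h3, ← integral_neg]
      refine integral_congr_ae (ae_of_all _ fun p => ?_)
      have h4 := fderiv_truncPow_comp k 1 ((hUs.differentiable one_ne_zero) p) a
      have h5 : fderiv ℝ (fun p => truncPow k 3 (U n p) / 3) p a
          = (fderiv ℝ (fun p => truncPow k 3 (U n p)) p a) / 3 := by
        simp_rw [div_eq_mul_inv]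
        have h6 : DifferentiableAt ℝ (fun p => truncPow k 3 (U n p)) p :=
          ((contDiff_truncPow k 1).comp hUs).differentiable one_ne_zero p
        rw [fderiv_mul_const h6]
        simp [mul_comm]
      simp only [h5]
      norm_num at h4
      rw [h4]
      simp only [hΦ]
      ring
    simp_rw [e1]
    refine Tendsto.neg ?_
    simp_rw [div_mul_eq_mul_div, integral_div]
    refine Tendsto.div_const ?_ 3
    refine tendsto_integral_of_dominated_convergence (fun p => k ^ 3 * |fderiv ℝ β p a|)
      (fun n => (hTm 3 n).mul hdL.1) ?_ (fun n => ?_) ?_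
    · exact (((hdβ a).integrable_of_hasCompactSupport (hdβc a)).abs).const_mul _
    · filter_upwards [hTb 3 n] with p hp
      rw [norm_mul]
      exact mul_le_mul_of_nonneg_right hp (norm_nonneg _)
    · filter_upwards [hTlim 3] with p hp using hp.mul_const _
  obtain ⟨N, hN⟩ := exists_nat_one_div_lt hε
  have hsub : Tendsto (fun n => ns (n + N)) atTop atTop :=
    hns.tendsto_atTop.comp (tendsto_add_atTop_nat N)
  refine ⟨fun n => moll (ns (n + N)) (Φ (ns (n + N))), fun n => moll_contDiff _ (hΦl _),
    fun n p => moll_nonneg _ (ae_of_all _ fun q => mul_nonneg (truncPow_nonneg _ _ _) (hβ0 q)) p,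
    ⟨k ^ 2 * B, fun n p => moll_le _ (hΦl _) (ae_of_all _ (hΦb _)) p⟩, ?_, ?_,
    fun i => (hD i).comp hsub, fun a => (hInt a).comp hsub⟩
  · intro n p hp
    refine moll_eq_zero _ fun q hq => ?_
    have : q ∉ tsupport β := by
      intro hqs
      refine hp (mem_cthickening_of_dist_le p q ε _ hqs (hq.le.trans ?_))
      refine le_trans ?_ hN.le
      have h1 : N ≤ ns (n + N) := (Nat.le_add_left _ _).trans hns.le_apply
      have : (N : ℝ) ≤ ns (n + N) := by exact_mod_cast h1
      gcongr
    simp [hΦ, image_eq_zero_of_notMem_tsupport this]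
  · filter_upwards [hae] with p hp
    exact hp.comp (tendsto_add_atTop_nat N)

end TruncationApprox

section DifferenceQuotient

variable {E : Type*} [NormedAddCommGroup E] [NormedSpace ℝ E] [FiniteDimensional ℝ E]
  [MeasureSpace E] [BorelSpace E] [(volume : Measure E).IsAddHaarMeasure]

lemma eLpNorm_sub_shift_le_fderiv {f : E → ℝ} (hf : ContDiff ℝ 1 f) (e : E) :
    eLpNorm (fun p => f (p + e) - f p) 2 ≤ eLpNorm (fun p => fderiv ℝ f p e) 2 := by
  rw [eLpNorm_two_eq, eLpNorm_two_eq]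
  refine ENNReal.rpow_le_rpow ?_ (by norm_num)
  have hc : Continuous fun p => fderiv ℝ f p e :=
    (hf.continuous_fderiv one_ne_zero).clm_apply continuous_const
  set ν : Measure ℝ := volume.restrict (Ioc 0 1)
  have : IsProbabilityMeasure ν := ⟨by simp [ν]⟩
  have hc2 : Continuous fun z : E × ℝ => fderiv ℝ f (z.1 + z.2 • e) e :=
    hc.comp (by fun_prop)
  have h1 : ∀ p, ‖f (p + e) - f p‖ₑ ^ 2 ≤ ∫⁻ τ, ‖fderiv ℝ f (p + τ • e) e‖ₑ ^ 2 ∂ν := by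
    intro p
    have hd : ∀ τ ∈ uIcc (0 : ℝ) 1, HasDerivAt (fun τ : ℝ => f (p + τ • e))
        (fderiv ℝ f (p + τ • e) e) τ := by
      intro τ _
      have h2 : HasDerivAt (fun τ : ℝ => p + τ • e) e τ := by
        simpa using ((hasDerivAt_id τ).smul_const e).const_add p
      exact ((hf.differentiable one_ne_zero _).hasFDerivAt).comp_hasDerivAt τ h2
    have hcτ : Continuous fun τ : ℝ => fderiv ℝ f (p + τ • e) e := hc.comp (by fun_prop)
    have h3 := intervalIntegral.integral_eq_sub_of_hasDerivAt hd (hcτ.intervalIntegrable 0 1)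
    simp only [one_smul, zero_smul, add_zero] at h3
    rw [← h3, intervalIntegral.integral_of_le zero_le_one]
    calc _ ≤ (∫⁻ τ, ‖fderiv ℝ f (p + τ • e) e‖ₑ ∂ν) ^ 2 := by
          gcongr; exact enorm_integral_le_lintegral_enorm _
      _ ≤ _ := lintegral_sq_le_of_isProbabilityMeasure hcτ.enorm.measurable.aemeasurable
  calc ∫⁻ p, ‖f (p + e) - f p‖ₑ ^ 2 ≤ ∫⁻ p, (∫⁻ τ, ‖fderiv ℝ f (p + τ • e) e‖ₑ ^ 2 ∂ν) :=
        lintegral_mono h1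
    _ = ∫⁻ τ, (∫⁻ p, ‖fderiv ℝ f (p + τ • e) e‖ₑ ^ 2) ∂ν :=
        lintegral_lintegral_swap (hc2.enorm.measurable.pow_const 2).aemeasurable
    _ = ∫⁻ _, (∫⁻ p, ‖fderiv ℝ f p e‖ₑ ^ 2) ∂ν := by
        refine lintegral_congr fun τ => ?_
        exact lintegral_add_right_eq_self (fun p => ‖fderiv ℝ f p e‖ₑ ^ 2) (τ • e)
    _ = _ := by simp

lemma eLpNorm_sub_shift_le_of_tendsto {f : E → ℝ} {fn : ℕ → E → ℝ}
    (hfn : ∀ n, ContDiff ℝ 1 (fn n)) (hlim : ∀ᵐ p, Tendsto (fun n => fn n p) atTop (𝓝 (f p)))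
    {e : E} {S : ℕ → ℝ≥0∞} {S' : ℝ≥0∞} (hS : ∀ n, eLpNorm (fun p => fderiv ℝ (fn n) p e) 2 ≤ S n)
    (hS' : Tendsto S atTop (𝓝 S')) : eLpNorm (fun p => f (p + e) - f p) 2 ≤ S' := by
  have hlim2 : ∀ᵐ p, Tendsto (fun n => fn n (p + e)) atTop (𝓝 (f (p + e))) :=
    (measurePreserving_add_right (volume : Measure E) e).quasiMeasurePreserving.ae hlim
  have h := Lp.eLpNorm_lim_le_liminf_eLpNorm (p := 2) (f := fun n p => fn n (p + e) - fn n p)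
    (μ := (volume : Measure E))
    (fun n => (((hfn n).continuous.comp (continuous_add_const e)).sub
      (hfn n).continuous).aestronglyMeasurable) (fun p => f (p + e) - f p)
    (by filter_upwards [hlim, hlim2] with p h1 h2 using h2.sub h1)
  refine h.trans ?_
  rw [← hS'.liminf_eq]
  exact liminf_le_liminf (Eventually.of_forall fun n =>
    (eLpNorm_sub_shift_le_fderiv (hfn n) e).trans (hS n))

end DifferenceQuotient

instance isAddHaarMeasure_volume_real_prod_Ed :
    (volume : Measure (ℝ × Ed d)).IsAddHaarMeasure := by
  rw [Measure.volume_eq_prod]; infer_instance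

/-- The `i`-th spatial unit vector in space-time. -/
def spaceDir (d : ℕ) (i : Fin d) : ℝ × Ed d := (0, EuclideanSpace.single i 1)

lemma spaceDir_sum (h : Ed d) : ((0 : ℝ), h) = ∑ i, h i • spaceDir d i := by
  ext1
  · simp [spaceDir, Prod.fst_sum]
  · simp only [spaceDir, Prod.snd_sum, Prod.smul_mk]
    ext j
    simp [Finset.sum_apply, Pi.single_apply]

lemma eLpNorm_fderiv_space_le {f : ℝ × Ed d → ℝ} (hf : ContDiff ℝ 1 f) (h : Ed d) :
    eLpNorm (fun p => fderiv ℝ f p (0, h)) 2 ≤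
      ‖h‖ₑ * ∑ i, eLpNorm (fun p => fderiv ℝ f p (spaceDir d i)) 2 := by
  have e : (fun p => fderiv ℝ f p (0, h)) =
      ∑ i, (h i) • fun p => fderiv ℝ f p (spaceDir d i) := by
    ext p
    rw [spaceDir_sum, map_sum]
    simp
  rw [e, Finset.mul_sum]
  refine (eLpNorm_sum_le (fun i _ => ?_) (by norm_num)).trans (Finset.sum_le_sum fun i _ => ?_)
  · exact (((hf.continuous_fderiv one_ne_zero).clm_apply
      continuous_const).aestronglyMeasurable).const_smul _
  · rw [eLpNorm_const_smul]
    gcongr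
    exact enorm_le_iff_norm_le.2 (PiLp.norm_apply_le h i)

lemma eLpNorm_space_shift_le {f : ℝ × Ed d → ℝ} {fn : ℕ → ℝ × Ed d → ℝ}
    (hfn : ∀ n, ContDiff ℝ 1 (fn n)) (hlim : ∀ᵐ p, Tendsto (fun n => fn n p) atTop (𝓝 (f p)))
    {G : Fin d → ℝ × Ed d → ℝ} (hG : ∀ i, MemLp (G i) 2)
    (hD : ∀ i, Tendsto (fun n => eLpNorm ((fun p => fderiv ℝ (fn n) p (spaceDir d i)) - G i) 2)
      atTop (𝓝 0)) (h : Ed d) :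
    eLpNorm (fun p => f (p + (0, h)) - f p) 2 ≤ ‖h‖ₑ * ∑ i, eLpNorm (G i) 2 := by
  refine eLpNorm_sub_shift_le_of_tendsto hfn hlim (S := fun n => ‖h‖ₑ * ∑ i,
    (eLpNorm ((fun p => fderiv ℝ (fn n) p (spaceDir d i)) - G i) 2 + eLpNorm (G i) 2))
    (fun n => ?_) ?_
  · refine (eLpNorm_fderiv_space_le (hfn n) h).trans ?_
    gcongr with i
    have e : (fun p => fderiv ℝ (fn n) p (spaceDir d i))
        = ((fun p => fderiv ℝ (fn n) p (spaceDir d i)) - G i) + G i := by simp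
    nth_rewrite 1 [e]
    exact eLpNorm_add_le ((((hfn n).continuous_fderiv one_ne_zero).clm_apply
      continuous_const).aestronglyMeasurable.sub (hG i).1) (hG i).1 (by norm_num)
  · refine ENNReal.Tendsto.const_mul ?_ (Or.inr enorm_ne_top)
    refine tendsto_finsetSum _ fun i _ => ?_
    have h1 := (hD i).add (tendsto_const_nhds (x := eLpNorm (G i) 2 volume))
    rwa [zero_add] at h1

section JumpKernel

/-- The reference jump kernel `h ↦ |h|^{-d-2s}`. -/
def jumpKer (s : ℝ) (h : Ed d) : ℝ≥0∞ := ENNReal.ofReal (1 / ‖h‖ ^ ((d : ℝ) + 2 * s))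

/-- The Lévy constant `∫ min(1, |h|²) |h|^{-d-2s} dh`. -/
def levyConst (d : ℕ) (s : ℝ) : ℝ≥0∞ :=
  ∫⁻ h : Ed d, ENNReal.ofReal (min 1 (‖h‖ ^ 2)) * jumpKer s h

@[fun_prop]
lemma measurable_jumpKer (s : ℝ) : Measurable (jumpKer s : Ed d → ℝ≥0∞) := by
  unfold jumpKer
  exact ((measurable_norm.pow_const _).const_div _).ennreal_ofReal

lemma jumpKer_neg (s : ℝ) (h : Ed d) : jumpKer s (-h) = jumpKer s h := by simp [jumpKer]

lemma jumpKer_sub_comm (s : ℝ) (x y : Ed d) : jumpKer s (x - y) = jumpKer s (y - x) := by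
  rw [← jumpKer_neg, neg_sub]

lemma levyConst_ne_top (hd : 2 ≤ d) {s : ℝ} (hs : s ∈ Ioo (0 : ℝ) 1) : levyConst d s ≠ ∞ := by
  have : Nontrivial (Ed d) := by
    have : Nonempty (Fin d) := ⟨⟨0, by omega⟩⟩
    infer_instance
  set f : ℝ → ℝ := fun r => min 1 (r ^ 2) * (1 / r ^ ((d : ℝ) + 2 * s)) with hf
  have hf0 : ∀ r : ℝ, 0 ≤ r → 0 ≤ f r := fun r hr => by positivity
  have hint : Integrable (fun h : Ed d => f ‖h‖) := by
    rw [integrable_fun_norm_addHaar (volume : Measure (Ed d)) (f := f)]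
    rw [finrank_euclideanSpace_fin, ← Ioc_union_Ioi_eq_Ioi (zero_le_one (α := ℝ))]
    have hrp : ∀ r : ℝ, 0 < r → r ^ (d - 1) * (1 / r ^ ((d : ℝ) + 2 * s))
        = r ^ (-1 - 2 * s) := by
      intro r hr
      rw [← Real.rpow_natCast, one_div, ← Real.rpow_neg hr.le, ← Real.rpow_add hr]
      congr 1
      rw [Nat.cast_sub (by omega)]
      push_cast; ring
    refine IntegrableOn.union ?_ ?_
    · have h1 : IntegrableOn (fun r : ℝ => r ^ (1 - 2 * s)) (Ioc 0 1) := by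
        have := intervalIntegral.intervalIntegrable_rpow' (a := 0) (b := 1) (r := 1 - 2 * s)
          (by linarith [hs.2])
        rwa [intervalIntegrable_iff_integrableOn_Ioc_of_le zero_le_one] at this
      refine h1.congr_fun (fun r hr => ?_) measurableSet_Ioc
      have hr2 : r ^ 2 ≤ 1 := pow_le_one₀ hr.1.le hr.2
      simp only [smul_eq_mul, hf, min_eq_right hr2]
      rw [mul_left_comm, hrp r hr.1, ← Real.rpow_natCast, ← Real.rpow_add hr.1]
      congr 1; push_cast; ring
    · have h1 : IntegrableOn (fun r : ℝ => r ^ (-1 - 2 * s)) (Ioi 1) :=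
        integrableOn_Ioi_rpow_of_lt (by linarith [hs.1]) one_pos
      refine h1.congr_fun (fun r hr => ?_) measurableSet_Ioi
      have hr1 : (1 : ℝ) < r := hr
      have hr2 : 1 ≤ r ^ 2 := one_le_pow₀ hr1.le
      simp only [smul_eq_mul, hf, min_eq_left hr2]
      rw [one_mul, hrp r (by linarith)]
  have e : levyConst d s = ∫⁻ h : Ed d, ENNReal.ofReal (f ‖h‖) := by
    unfold levyConst jumpKer
    refine lintegral_congr fun h => ?_
    rw [← ENNReal.ofReal_mul (by positivity)]
  rw [e]
  exact hint.lintegral_lt_top.ne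

lemma lintegral_swap_space {F : ℝ → Ed d → Ed d → ℝ≥0∞}
    (hF : Measurable fun z : (ℝ × Ed d) × Ed d => F z.1.1 z.1.2 z.2) :
    ∫⁻ p : ℝ × Ed d, ∫⁻ y, F p.1 p.2 y = ∫⁻ p : ℝ × Ed d, ∫⁻ y, F p.1 y p.2 := by
  have hF2 : Measurable fun z : (ℝ × Ed d) × Ed d => F z.1.1 z.2 z.1.2 :=
    hF.comp (((measurable_fst.comp measurable_fst).prodMk measurable_snd).prodMk
      (measurable_snd.comp measurable_fst))
  rw [Measure.volume_eq_prod, lintegral_prod _ hF.lintegral_prod_right'.aemeasurable,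
    lintegral_prod _ hF2.lintegral_prod_right'.aemeasurable]
  refine lintegral_congr fun t => ?_
  refine lintegral_lintegral_swap (Measurable.aemeasurable ?_)
  exact hF.comp ((measurable_const.prodMk measurable_fst).prodMk measurable_snd)

variable {s : ℝ}

/-- The product of the increments of `f` and `g`, integrated against the jump kernel over the
pairs at distance smaller than `1`. -/
lemma lintegral_near_le {f g : ℝ × Ed d → ℝ} (hf : Measurable f) (hg : Measurable g)
    {a b : ℝ≥0∞} (ha : ∀ h : Ed d, eLpNorm (fun p => f (p + (0, h)) - f p) 2 ≤ ‖h‖ₑ * a)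
    (hb : ∀ h : Ed d, eLpNorm (fun p => g (p + (0, h)) - g p) 2 ≤ ‖h‖ₑ * b) {κ : ℝ} (hκ : κ ≤ 1) :
    ∫⁻ p : ℝ × Ed d, ∫⁻ y, (if ‖p.2 - y‖ < κ then
      ‖f p - f (p.1, y)‖ₑ * ‖g p - g (p.1, y)‖ₑ * jumpKer s (p.2 - y) else 0)
      ≤ levyConst d s * (a * b) := by
  have e1 : ∀ p : ℝ × Ed d, ∫⁻ y, (if ‖p.2 - y‖ < κ then
      ‖f p - f (p.1, y)‖ₑ * ‖g p - g (p.1, y)‖ₑ * jumpKer s (p.2 - y) else 0)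
      = ∫⁻ h, (if ‖h‖ < κ then
      ‖f (p + (0, h)) - f p‖ₑ * ‖g (p + (0, h)) - g p‖ₑ * jumpKer s h else 0) := by
    intro p
    rw [← lintegral_add_left_eq_self _ p.2]
    refine lintegral_congr fun h => ?_
    have e2 : (p.1, p.2 + h) = p + (0, h) := by ext1 <;> simp
    rw [e2, sub_add_cancel_left, norm_neg, jumpKer_neg, ← enorm_neg (f p - _), neg_sub,
      ← enorm_neg (g p - _), neg_sub]
  simp_rw [e1]
  have hsh : Measurable fun z : (ℝ × Ed d) × Ed d => z.1 + ((0 : ℝ), z.2) := by fun_prop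
  have hm : Measurable fun z : (ℝ × Ed d) × Ed d => (if ‖z.2‖ < κ then
      ‖f (z.1 + (0, z.2)) - f z.1‖ₑ * ‖g (z.1 + (0, z.2)) - g z.1‖ₑ * jumpKer s z.2 else 0) := by
    refine Measurable.ite (measurableSet_lt measurable_snd.norm measurable_const) ?_
      measurable_const
    exact ((((hf.comp hsh).sub (hf.comp measurable_fst)).enorm).mul
      (((hg.comp hsh).sub (hg.comp measurable_fst)).enorm)).mul
      ((measurable_jumpKer s).comp measurable_snd)
  rw [lintegral_lintegral_swap hm.aemeasurable, levyConst, ← lintegral_mul_const _ (by fun_prop)]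
  refine lintegral_mono fun h => ?_
  by_cases hh : ‖h‖ < κ
  · simp only [hh, if_true]
    have hmf : Measurable fun p => f (p + (0, h)) - f p := (hf.comp (by fun_prop)).sub hf
    have hmg : Measurable fun p => g (p + (0, h)) - g p := (hg.comp (by fun_prop)).sub hg
    have hmm : Measurable fun p => ‖f (p + (0, h)) - f p‖ₑ * ‖g (p + (0, h)) - g p‖ₑ :=
      hmf.enorm.mul hmg.enorm
    rw [lintegral_mul_const _ hmm, mul_right_comm]
    gcongr
    have h1 := ENNReal.lintegral_mul_le_Lp_mul_Lq volume Real.HolderConjugate.two_two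
      hmf.enorm.aemeasurable hmg.enorm.aemeasurable
    have h2 : ∀ u : ℝ × Ed d → ℝ, (∫⁻ p, ‖u p‖ₑ ^ (2 : ℝ)) ^ (1 / 2 : ℝ) = eLpNorm u 2 := by
      intro u; rw [eLpNorm_two_eq]; norm_num
    rw [h2, h2] at h1
    refine h1.trans ((mul_le_mul' (ha h) (hb h)).trans (le_of_eq ?_))
    have hle : ‖h‖ ^ 2 ≤ 1 := pow_le_one₀ (norm_nonneg _) (hh.le.trans hκ)
    rw [min_eq_right hle, ENNReal.ofReal_pow (norm_nonneg _), ofReal_norm]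
    ring
  · simp [hh]

lemma lintegral_add_swap_space {M : ℝ × Ed d → Ed d → ℝ≥0∞}
    (hM : Measurable fun z : (ℝ × Ed d) × Ed d => M z.1 z.2) :
    ∫⁻ p : ℝ × Ed d, ∫⁻ y, (M p y + M (p.1, y) p.2) = 2 * ∫⁻ p : ℝ × Ed d, ∫⁻ y, M p y := by
  have hsw : ∫⁻ p : ℝ × Ed d, ∫⁻ y, M p y = ∫⁻ p : ℝ × Ed d, ∫⁻ y, M (p.1, y) p.2 :=
    lintegral_swap_space (F := fun t x y => M (t, x) y) hM
  rw [two_mul]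
  nth_rewrite 2 [hsw]
  rw [← lintegral_add_left hM.lintegral_prod_right']
  refine lintegral_congr fun p => ?_
  exact lintegral_add_left (hM.comp measurable_prodMk_left) _

lemma lintegral_far_le {f g : ℝ × Ed d → ℝ} (hf : Measurable f) (hg : Measurable g) (κ : ℝ) :
    ∫⁻ p : ℝ × Ed d, ∫⁻ y, (if ‖p.2 - y‖ < κ then 0 else
      ‖f p - f (p.1, y)‖ₑ * ‖g p - g (p.1, y)‖ₑ * jumpKer s (p.2 - y))
      ≤ ∫⁻ p : ℝ × Ed d, ‖g p‖ₑ * (2 * ∫⁻ y, (if ‖p.2 - y‖ < κ then 0 else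
        (‖f p‖ₑ + ‖f (p.1, y)‖ₑ) * jumpKer s (p.2 - y))) := by
  set N : ℝ × Ed d → Ed d → ℝ≥0∞ := fun p y => if ‖p.2 - y‖ < κ then 0 else
    (‖f p‖ₑ + ‖f (p.1, y)‖ₑ) * jumpKer s (p.2 - y) with hN
  have hmN : Measurable fun z : (ℝ × Ed d) × Ed d => N z.1 z.2 := by
    refine Measurable.ite (measurableSet_lt (by fun_prop) measurable_const) measurable_const ?_
    have h1 : Measurable fun z : (ℝ × Ed d) × Ed d => ‖f z.1‖ₑ :=
      (hf.comp measurable_fst).enorm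
    have h2 : Measurable fun z : (ℝ × Ed d) × Ed d => ‖f (z.1.1, z.2)‖ₑ :=
      (hf.comp (by fun_prop)).enorm
    have h3 : Measurable fun z : (ℝ × Ed d) × Ed d => jumpKer s (z.1.2 - z.2) :=
      (measurable_jumpKer s).comp (by fun_prop)
    exact (h1.add h2).mul h3
  have hmM : Measurable fun z : (ℝ × Ed d) × Ed d => ‖g z.1‖ₑ * N z.1 z.2 :=
    (hg.comp measurable_fst).enorm.mul hmN
  have hsymm : ∀ (p : ℝ × Ed d) (y : Ed d), N (p.1, y) p.2 = N p y := by
    intro p y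
    simp only [hN, norm_sub_rev y p.2, jumpKer_sub_comm s y p.2, Prod.mk.eta]
    rw [add_comm]
  have key : ∀ (p : ℝ × Ed d) (y : Ed d), (if ‖p.2 - y‖ < κ then 0 else
      ‖f p - f (p.1, y)‖ₑ * ‖g p - g (p.1, y)‖ₑ * jumpKer s (p.2 - y))
      ≤ ‖g p‖ₑ * N p y + ‖g (p.1, y)‖ₑ * N (p.1, y) p.2 := by
    intro p y
    rw [hsymm, ← add_mul]
    simp only [hN]
    split_ifs
    · exact bot_le
    · have h1 : ‖f p - f (p.1, y)‖ₑ ≤ ‖f p‖ₑ + ‖f (p.1, y)‖ₑ := enorm_sub_le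
      have h2 : ‖g p - g (p.1, y)‖ₑ ≤ ‖g p‖ₑ + ‖g (p.1, y)‖ₑ := enorm_sub_le
      rw [← mul_assoc, mul_comm ‖f p - _‖ₑ]
      exact mul_le_mul' (mul_le_mul' h2 h1) le_rfl
  refine (lintegral_mono fun p => lintegral_mono fun y => key p y).trans ?_
  rw [lintegral_add_swap_space (M := fun p y => ‖g p‖ₑ * N p y) hmM,
    ← lintegral_const_mul' _ _ (by norm_num)]
  refine lintegral_mono fun p => le_of_eq ?_
  rw [lintegral_const_mul' _ _ enorm_ne_top]
  ring

end JumpKernel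

/-- The integrand of the nonlocal energy form. -/
def jumpForm (K : ℝ → Ed d → Ed d → ℝ) (v : ℝ → Ed d → ℝ) (ψ : ℝ × Ed d → ℝ)
    (z : (ℝ × Ed d) × Ed d) : ℝ :=
  (v z.1.1 z.1.2 - v z.1.1 z.2) * (ψ z.1 - ψ (z.1.1, z.2)) * K z.1.1 z.1.2 z.2

/-- A nonnegative supersolution on the cylinder `Q_{2R}(t₀,x₀)`, tested against nonnegative smooth
functions with compact support in the cylinder. -/
structure CylSuper (s Λ : ℝ) (A : ℝ → Ed d → Ed d → Ed d) (K : ℝ → Ed d → Ed d → ℝ)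
    (v : ℝ → Ed d → ℝ) (Dv : ℝ → Ed d → Ed d) (t₀ : ℝ) (x₀ : Ed d) (R : ℝ) : Prop where
  two_le : 2 ≤ d
  s_mem : s ∈ Ioo (0 : ℝ) 1
  one_le : 1 ≤ Λ
  R_mem : R ∈ Ioc (0 : ℝ) 1
  vf : VectorFieldHyp d Λ A
  ker : KernelHyp d s Λ K
  meas : Measurable (Function.uncurry v)
  measD : Measurable (Function.uncurry Dv)
  nonneg : ∀ᵐ p : ℝ × Ed d, p ∈ pCyl t₀ x₀ (2 * R) → 0 ≤ v p.1 p.2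
  memLp : MemLp (Function.uncurry v) 2 (volume.restrict (pCyl t₀ x₀ (2 * R)))
  memLpD : MemLp (Function.uncurry Dv) 2 (volume.restrict (pCyl t₀ x₀ (2 * R)))
  grad : ∀ t ∈ Iminus t₀ (2 * R), ∀ φ : Ed d → ℝ, ContDiff ℝ (⊤ : ℕ∞) φ → HasCompactSupport φ →
    tsupport φ ⊆ ball x₀ (2 * R) → ∀ e : Ed d,
      ∫ x, v t x * (fderiv ℝ φ x) e = - ∫ x, φ x * ⟪Dv t x, e⟫
  tail : ∫⁻ t in Iminus t₀ (2 * R),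
    (∫⁻ y, ENNReal.ofReal (|v t y| / (1 + ‖y‖ ^ ((d : ℝ) + 2 * s)))) ^ 2 ≠ ∞
  super : ∀ ψ : ℝ × Ed d → ℝ, ContDiff ℝ (⊤ : ℕ∞) ψ → (∀ p, 0 ≤ ψ p) → HasCompactSupport ψ →
    tsupport ψ ⊆ pCyl t₀ x₀ (2 * R) → Integrable (jumpForm K v ψ) →
    0 ≤ -(∫ p : ℝ × Ed d, v p.1 p.2 * fderiv ℝ ψ p (1, 0))
      + (∫ p : ℝ × Ed d, ∑ i, A p.1 p.2 (Dv p.1 p.2) i * fderiv ℝ ψ p (spaceDir d i))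
      + ∫ z, jumpForm K v ψ z

lemma measurableSet_pCyl (t₀ : ℝ) (x₀ : Ed d) (r : ℝ) : MeasurableSet (pCyl t₀ x₀ r) :=
  measurableSet_Ioo.prod measurableSet_ball

lemma VectorFieldHyp.measurable_comp {Λ : ℝ} {A : ℝ → Ed d → Ed d → Ed d}
    (hA : VectorFieldHyp d Λ A) {Dv : ℝ → Ed d → Ed d} (hD : Measurable (Function.uncurry Dv)) :
    Measurable fun p : ℝ × Ed d => A p.1 p.2 (Dv p.1 p.2) := by
  have h : Measurable (Function.uncurry fun (ξ : Ed d) (p : ℝ × Ed d) => A p.1 p.2 ξ) :=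
    measurable_uncurry_of_continuous_of_measurable (fun p => hA.cont p.1 p.2) hA.meas
  exact h.comp (hD.prodMk measurable_id)

lemma setIntegral_setIntegral_eq {f : ℝ × Ed d → ℝ} (hf : Integrable f) {S : Set ℝ}
    {Ω : Set (Ed d)} (h0 : ∀ p, p ∉ S ×ˢ Ω → f p = 0) :
    ∫ t in S, ∫ x in Ω, f (t, x) = ∫ p, f p := by
  have h1 := setIntegral_prod (μ := (volume : Measure ℝ)) (ν := (volume : Measure (Ed d)))
    (s := S) (t := Ω) f (by rw [← Measure.volume_eq_prod]; exact hf.integrableOn)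
  rw [← h1, ← Measure.volume_eq_prod]
  exact setIntegral_eq_integral_of_forall_compl_eq_zero fun p hp => h0 p hp

lemma integrable_mul_of_tsupport_subset {f g : ℝ × Ed d → ℝ} {S : Set (ℝ × Ed d)}
    (hf : MemLp f 2 (volume.restrict S)) (hg : Continuous g) (hgc : HasCompactSupport g)
    (hgS : tsupport g ⊆ S) : Integrable fun p => f p * g p := by
  have hg2 : MemLp g 2 (volume.restrict S) := (hg.memLp_of_hasCompactSupport hgc).restrict S
  have h1 : IntegrableOn (fun p => f p * g p) S := hf.integrable_mul hg2
  refine (integrableOn_iff_integrable_of_support_subset ?_).1 h1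
  intro p hp
  refine hgS (subset_tsupport _ ?_)
  intro h
  simp [h] at hp

lemma tsupport_fderiv_apply_subset' {f : ℝ × Ed d → ℝ} (e : ℝ × Ed d) :
    tsupport (fun p => fderiv ℝ f p e) ⊆ tsupport f :=
  tsupport_fderiv_apply_subset ℝ e

lemma fderiv_space_slice {ψ : ℝ × Ed d → ℝ} (hψ : ContDiff ℝ 1 ψ) (t : ℝ) (x e : Ed d) :
    fderiv ℝ (fun y => ψ (t, y)) x e = fderiv ℝ ψ (t, x) (0, e) := by
  have h1 : HasFDerivAt (fun y : Ed d => (t, y)) ((0 : Ed d →L[ℝ] ℝ).prod (.id ℝ (Ed d))) x :=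
    (hasFDerivAt_const t x).prodMk (hasFDerivAt_id x)
  have h2 := ((hψ.differentiable one_ne_zero (t, x)).hasFDerivAt).comp x h1
  have h3 := h2.fderiv
  change fderiv ℝ (ψ ∘ fun y => (t, y)) x e = _
  rw [h3]; simp

lemma deriv_time_slice {ψ : ℝ × Ed d → ℝ} (hψ : ContDiff ℝ 1 ψ) (t : ℝ) (x : Ed d) :
    deriv (fun τ => ψ (τ, x)) t = fderiv ℝ ψ (t, x) (1, 0) := by
  have h1 : HasDerivAt (fun τ : ℝ => (τ, x)) (1, 0) t :=
    (hasDerivAt_id t).prodMk (hasDerivAt_const t x)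
  exact (((hψ.differentiable one_ne_zero (t, x)).hasFDerivAt).comp_hasDerivAt t h1).deriv

lemma inner_gradient_slice {ψ : ℝ × Ed d → ℝ} (hψ : ContDiff ℝ 1 ψ) (t : ℝ) (x a : Ed d) :
    ⟪a, gradient (fun y => ψ (t, y)) x⟫
      = ∑ i, a i * fderiv ℝ ψ (t, x) (spaceDir d i) := by
  rw [real_inner_comm, gradient, InnerProductSpace.toDual_symm_apply, fderiv_space_slice hψ,
    spaceDir_sum, map_sum]
  simp

lemma LocalWeakReg.cylSuper {s Λ : ℝ} {A : ℝ → Ed d → Ed d → Ed d}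
    {K : ℝ → Ed d → Ed d → ℝ} {v : ℝ → Ed d → ℝ} {Dv : ℝ → Ed d → Ed d} {t₀ : ℝ} {x₀ : Ed d}
    {R : ℝ} (hd : 2 ≤ d) (hs : s ∈ Ioo (0 : ℝ) 1) (hΛ : 1 ≤ Λ) (hR : R ∈ Ioc (0 : ℝ) 1)
    (hA : VectorFieldHyp d Λ A) (hK : KernelHyp d s Λ K) {T : ℝ} {Ω : Set (Ed d)}
    (hreg : LocalWeakReg d s (Ioo 0 T) Ω v Dv)
    (hsup : IsLocalWeakSupersolutionHom A K (Ioo 0 T) Ω v Dv)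
    (hcl : closure (Iminus t₀ (2 * R) ×ˢ ball x₀ (2 * R)) ⊆ Ioo 0 T ×ˢ Ω)
    (hnn : ∀ᵐ p : ℝ × Ed d, p ∈ pCyl t₀ x₀ (2 * R) → 0 ≤ v p.1 p.2) :
    CylSuper s Λ A K v Dv t₀ x₀ R := by
  have hR0 : 0 < 2 * R := by linarith [hR.1]
  have hlt : t₀ - (2 * R) ^ 2 < t₀ := by nlinarith
  rw [closure_prod_eq, Iminus, closure_Ioo hlt.ne, closure_ball _ hR0.ne'] at hcl
  have hI : Icc (t₀ - (2 * R) ^ 2) t₀ ⊆ Ioo 0 T := fun t ht =>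
    (hcl (mk_mem_prod ht (mem_closedBall_self hR0.le))).1
  have hB : closedBall x₀ (2 * R) ⊆ Ω := fun x hx =>
    (hcl (mk_mem_prod (right_mem_Icc.2 hlt.le) hx)).2
  have hCs : pCyl t₀ x₀ (2 * R) ⊆
      Ioo (t₀ - (2 * R) ^ 2) t₀ ×ˢ closedBall x₀ (2 * R) :=
    prod_mono le_rfl ball_subset_closedBall
  have hint := (hreg.l2w12 _ _ hI _ (isCompact_closedBall x₀ (2 * R)) hB).mono_set hCs
  have hmeas := hreg.meas
  have hmeasD := hreg.measD
  have hL : MemLp (Function.uncurry v) 2 (volume.restrict (pCyl t₀ x₀ (2 * R))) := by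
    rw [memLp_two_iff_integrable_sq hmeas.aestronglyMeasurable]
    refine hint.mono' (hmeas.pow_const 2).aestronglyMeasurable (ae_of_all _ fun p => ?_)
    rw [Real.norm_of_nonneg (sq_nonneg _)]
    exact le_add_of_nonneg_right (sq_nonneg _)
  have hLD : MemLp (Function.uncurry Dv) 2 (volume.restrict (pCyl t₀ x₀ (2 * R))) := by
    rw [memLp_two_iff_integrable_sq_norm hmeasD.aestronglyMeasurable]
    refine hint.mono' (hmeasD.norm.pow_const 2).aestronglyMeasurable (ae_of_all _ fun p => ?_)
    rw [Real.norm_of_nonneg (sq_nonneg _)]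
    exact le_add_of_nonneg_left (sq_nonneg _)
  refine ⟨hd, hs, hΛ, hR, hA, hK, hmeas, hmeasD, hnn, hL, hLD, ?_, ?_, ?_⟩
  · intro t ht φ hφ hφc hφs e
    exact hreg.grad t (hI (Ioo_subset_Icc_self ht)) φ hφ hφc
      (hφs.trans (ball_subset_closedBall.trans hB)) e
  · have h2 := hreg.tail_l2 _ _ hI
    have h4 : ∫⁻ t in Iminus t₀ (2 * R),
        (∫⁻ y, ENNReal.ofReal (|v t y| / (1 + ‖y‖ ^ ((d : ℝ) + 2 * s)))) ^ 2
        = ∫⁻ t in Iminus t₀ (2 * R), ENNReal.ofReal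
          ((∫ y : Ed d, |v t y| / (1 + ‖y‖ ^ ((d : ℝ) + 2 * s))) ^ 2) := by
      refine setLIntegral_congr_fun_ae measurableSet_Ioo ?_
      filter_upwards [hreg.tail_ae] with t ht htI
      rw [ENNReal.ofReal_pow (integral_nonneg fun y => by positivity),
        ofReal_integral_eq_lintegral_ofReal (ht (hI (Ioo_subset_Icc_self htI)))
        (ae_of_all _ fun y => by positivity)]
    rw [h4]
    exact h2.lintegral_lt_top.ne
  · intro ψ hψ hψ0 hψc hψs hF
    have hψ1 : ContDiff ℝ 1 ψ := hψ.of_le (by simp)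
    set φ : ℝ → Ed d → ℝ := fun t x => -ψ (t, x) with hφ
    have hz : ∀ p, p ∉ pCyl t₀ x₀ (2 * R) → ψ p = 0 := fun p hp =>
      image_eq_zero_of_notMem_tsupport fun h => hp (hψs h)
    have hzD : ∀ p, p ∉ pCyl t₀ x₀ (2 * R) → ∀ e, fderiv ℝ ψ p e = 0 := fun p hp e =>
      image_eq_zero_of_notMem_tsupport (f := fun p => fderiv ℝ ψ p e) fun h =>
        hp (hψs (tsupport_fderiv_apply_subset' e h))
    have hΩ : ∀ p, p ∉ Ioc (t₀ - (2 * R) ^ 2) t₀ ×ˢ Ω → p ∉ pCyl t₀ x₀ (2 * R) :=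
      fun p hp h => hp ⟨Ioo_subset_Ioc_self h.1, hB (ball_subset_closedBall h.2)⟩
    have htest : IsTestFunction Ω φ := by
      refine ⟨hψ.neg, Prod.snd '' tsupport ψ, hψc.isCompact.image continuous_snd, ?_, fun t => ?_⟩
      · rintro _ ⟨p, hp, rfl⟩
        exact hB (ball_subset_closedBall (hψs hp).2)
      · refine closure_minimal ?_ (hψc.isCompact.image continuous_snd).isClosed
        intro x hx
        refine ⟨(t, x), subset_tsupport _ ?_, rfl⟩
        simpa [hφ] using hx
    have hneg : ∀ t x, φ t x ≤ 0 := fun t x => neg_nonpos.2 (hψ0 _)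
    have key := hsup _ _ hlt.le hI φ htest hneg
    have hDc : ∀ e, Continuous fun p => fderiv ℝ ψ p e := fun e =>
      (hψ1.continuous_fderiv one_ne_zero).clm_apply continuous_const
    have hI1 : Integrable fun p : ℝ × Ed d => v p.1 p.2 * fderiv ℝ ψ p (1, 0) :=
      integrable_mul_of_tsupport_subset (f := Function.uncurry v) hL (hDc _)
        (hψc.fderiv_apply (𝕜 := ℝ) _) ((tsupport_fderiv_apply_subset' _).trans hψs)
    have hAm := hA.measurable_comp hmeasD
    have hI2 : Integrable fun p : ℝ × Ed d =>
        ∑ i, A p.1 p.2 (Dv p.1 p.2) i * fderiv ℝ ψ p (spaceDir d i) := by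
      refine integrable_finsetSum _ fun i _ => ?_
      have hAi : Measurable fun p : ℝ × Ed d => A p.1 p.2 (Dv p.1 p.2) i :=
        (by fun_prop : Measurable fun a : Ed d => a i).comp hAm
      refine integrable_mul_of_tsupport_subset (S := pCyl t₀ x₀ (2 * R)) ?_ (hDc _)
        (hψc.fderiv_apply (𝕜 := ℝ) _) ((tsupport_fderiv_apply_subset' _).trans hψs)
      refine MemLp.of_le_mul (c := Λ) hLD hAi.aestronglyMeasurable (ae_of_all _ fun p => ?_)
      exact (PiLp.norm_apply_le _ i).trans (hA.growth _ _ _)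
    have e1 : ∫ t in Ioc (t₀ - (2 * R) ^ 2) t₀, ∫ x in Ω, v t x * deriv (fun τ => φ τ x) t
        = -∫ p : ℝ × Ed d, v p.1 p.2 * fderiv ℝ ψ p (1, 0) := by
      rw [← integral_neg, ← setIntegral_setIntegral_eq hI1.fun_neg
        (S := Ioc (t₀ - (2 * R) ^ 2) t₀) (Ω := Ω)
        (fun p hp => by simp [hzD p (hΩ p hp)])]
      have : ∀ t x, deriv (fun τ => φ τ x) t = -fderiv ℝ ψ (t, x) (1, 0) := fun t x => by
        rw [← deriv_time_slice hψ1]; exact deriv.neg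
      simp only [this, mul_neg]
    have e2 : ∫ t in Ioc (t₀ - (2 * R) ^ 2) t₀, ∫ x in Ω,
          ⟪A t x (Dv t x), gradient (φ t) x⟫
        = -∫ p : ℝ × Ed d, ∑ i, A p.1 p.2 (Dv p.1 p.2) i * fderiv ℝ ψ p (spaceDir d i) := by
      rw [← integral_neg, ← setIntegral_setIntegral_eq hI2.fun_neg
        (S := Ioc (t₀ - (2 * R) ^ 2) t₀) (Ω := Ω)
        (fun p hp => by simp [hzD p (hΩ p hp)])]
      have hφ1 : ∀ t x, ⟪A t x (Dv t x), gradient (φ t) x⟫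
          = -∑ i, A t x (Dv t x) i * fderiv ℝ ψ (t, x) (spaceDir d i) := fun t x => by
        rw [← inner_gradient_slice hψ1, ← inner_neg_right]
        congr 1
        simp only [gradient, hφ]
        rw [fderiv_fun_neg, map_neg]
      simp only [hφ1]
    have e3 : ∫ t in Ioc (t₀ - (2 * R) ^ 2) t₀, ∫ x : Ed d, ∫ y : Ed d,
        (v t x - v t y) * (φ t x - φ t y) * K t x y = -∫ z, jumpForm K v ψ z := by
      have hF' : Integrable (jumpForm K v ψ)
          ((volume : Measure (ℝ × Ed d)).prod (volume : Measure (Ed d))) := hF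
      have hg := hF'.integral_prod_left
      rw [← integral_neg]
      change _ = ∫ z, -jumpForm K v ψ z ∂((volume : Measure (ℝ × Ed d)).prod
        (volume : Measure (Ed d)))
      rw [integral_neg, integral_prod _ hF', ← integral_neg,
        ← setIntegral_setIntegral_eq hg.fun_neg (S := Ioc (t₀ - (2 * R) ^ 2) t₀) (Ω := univ)]
      · simp only [Measure.restrict_univ, ← integral_neg]
        congr 1; ext t; congr 1; ext x; congr 1; ext y
        simp only [jumpForm, hφ]; ring
      · intro p hp
        have hpt : p.1 ∉ Iminus t₀ (2 * R) := fun h =>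
          hp ⟨Ioo_subset_Ioc_self h, mem_univ _⟩
        have : ∀ y, jumpForm K v ψ (p, y) = 0 := fun y => by
          simp only [jumpForm]
          rw [hz p fun h => hpt h.1, hz (p.1, y) fun h => hpt h.1]; simp
        simp [this]
    have hb : ∀ t, t ∉ Iminus t₀ (2 * R) → ∫ x in Ω, v t x * φ t x = 0 := fun t ht => by
      have : ∀ x, φ t x = 0 := fun x => by simp [hφ, hz (t, x) fun h => ht h.1]
      simp [this]
    rw [mixedLHS, e1, e2, e3, hb _ (by simp [Iminus]), hb _ (by simp [Iminus])] at key
    linarith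

section Cutoff

variable {s Λ : ℝ} {A : ℝ → Ed d → Ed d → Ed d} {K : ℝ → Ed d → Ed d → ℝ} {v : ℝ → Ed d → ℝ}
  {Dv : ℝ → Ed d → Ed d} {t₀ : ℝ} {x₀ : Ed d} {R : ℝ}

lemma CylSuper.memLp_inner (hC : CylSuper s Λ A K v Dv t₀ x₀ R) (e : Ed d) :
    MemLp (fun p : ℝ × Ed d => ⟪Dv p.1 p.2, e⟫) 2 (volume.restrict (pCyl t₀ x₀ (2 * R))) := by
  have hm : Measurable fun p : ℝ × Ed d => ⟪Dv p.1 p.2, e⟫ :=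
    (by fun_prop : Measurable fun a : Ed d => ⟪a, e⟫).comp hC.measD
  refine MemLp.of_le_mul (c := ‖e‖) hC.memLpD hm.aestronglyMeasurable (ae_of_all _ fun p => ?_)
  rw [mul_comm]
  exact norm_inner_le_norm _ _

lemma CylSuper.integral_mul_fderiv_space (hC : CylSuper s Λ A K v Dv t₀ x₀ R)
    {φ : ℝ × Ed d → ℝ} (hφ : ContDiff ℝ (⊤ : ℕ∞) φ) (hφc : HasCompactSupport φ)
    (hφs : tsupport φ ⊆ pCyl t₀ x₀ (2 * R)) (e : Ed d) :
    ∫ p : ℝ × Ed d, v p.1 p.2 * fderiv ℝ φ p (0, e)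
      = -∫ p : ℝ × Ed d, φ p * ⟪Dv p.1 p.2, e⟫ := by
  have hφ1 : ContDiff ℝ 1 φ := hφ.of_le (by simp)
  have hI1 : Integrable fun p : ℝ × Ed d => v p.1 p.2 * fderiv ℝ φ p (0, e) :=
    integrable_mul_of_tsupport_subset (f := Function.uncurry v) hC.memLp
      ((hφ1.continuous_fderiv one_ne_zero).clm_apply continuous_const)
      (hφc.fderiv_apply (𝕜 := ℝ) _) ((tsupport_fderiv_apply_subset' _).trans hφs)
  have hI2 : Integrable fun p : ℝ × Ed d => φ p * ⟪Dv p.1 p.2, e⟫ := by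
    simp_rw [mul_comm (φ _)]
    exact integrable_mul_of_tsupport_subset (hC.memLp_inner e) hφ1.continuous hφc hφs
  rw [Measure.volume_eq_prod] at hI1 hI2 ⊢
  rw [integral_prod _ hI1, integral_prod _ hI2, ← integral_neg]
  refine integral_congr_ae (ae_of_all _ fun t => ?_)
  simp only
  by_cases ht : t ∈ Iminus t₀ (2 * R)
  · have h1 : ContDiff ℝ (⊤ : ℕ∞) fun x => φ (t, x) := hφ.comp (contDiff_prodMk_right t)
    have h2 : tsupport (fun x => φ (t, x)) ⊆ Prod.snd '' tsupport φ := by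
      refine closure_minimal (fun x hx => ⟨(t, x), subset_tsupport _ hx, rfl⟩) ?_
      exact (hφc.isCompact.image continuous_snd).isClosed
    have h3 : HasCompactSupport fun x => φ (t, x) :=
      HasCompactSupport.of_support_subset_isCompact (hφc.isCompact.image continuous_snd)
        ((subset_tsupport _).trans h2)
    have h4 : Prod.snd '' tsupport φ ⊆ ball x₀ (2 * R) := by
      rintro _ ⟨p, hp, rfl⟩
      exact (hφs hp).2
    rw [← hC.grad t ht _ h1 h3 (h2.trans h4) e]
    simp_rw [fderiv_space_slice hφ1]
  · have h0 : ∀ x, φ (t, x) = 0 := fun x =>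
      image_eq_zero_of_notMem_tsupport fun h => ht (hφs h).1
    have h1 : ∀ x, fderiv ℝ φ (t, x) (0, e) = 0 := fun x =>
      image_eq_zero_of_notMem_tsupport (f := fun p => fderiv ℝ φ p (0, e)) fun h =>
        ht (hφs (tsupport_fderiv_apply_subset' _ h)).1
    simp [h0, h1]

variable {ζ : ℝ × Ed d → ℝ}

lemma memLp_mul_of_tsupport_subset {E : Type*} [NormedAddCommGroup E] [NormedSpace ℝ E]
    [FiniteDimensional ℝ E] [MeasureSpace E] [BorelSpace E] {ζ f : E → ℝ} {S : Set E}
    (hS : MeasurableSet S) (hf : MemLp f 2 (volume.restrict S)) (hζ : Continuous ζ)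
    (hζc : HasCompactSupport ζ) (hζs : tsupport ζ ⊆ S) : MemLp (fun p => ζ p * f p) 2 := by
  obtain ⟨M, hM⟩ := hζc.exists_bound_of_continuous hζ
  have h1 : MemLp (ζ * f) 2 (volume.restrict S) :=
    memLp_bdd_mul hζ.aestronglyMeasurable (ae_of_all _ hM) hf
  have h2 : S.indicator (ζ * f) = fun p => ζ p * f p := by
    ext p
    by_cases hp : p ∈ S
    · simp [hp]
    · simp [hp, image_eq_zero_of_notMem_tsupport fun h => hp (hζs h)]
  rw [← h2]
  exact (memLp_indicator_iff_restrict hS).2 h1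

/-- The weak spatial derivative of `ζ v` in the `i`-th direction. -/
def cutGrad (ζ : ℝ × Ed d → ℝ) (v : ℝ → Ed d → ℝ) (Dv : ℝ → Ed d → Ed d) (i : Fin d)
    (p : ℝ × Ed d) : ℝ :=
  ζ p * Dv p.1 p.2 i + fderiv ℝ ζ p (spaceDir d i) * v p.1 p.2

lemma CylSuper.memLp_cutoff (hC : CylSuper s Λ A K v Dv t₀ x₀ R) (hζ : ContDiff ℝ (⊤ : ℕ∞) ζ)
    (hζc : HasCompactSupport ζ) (hζs : tsupport ζ ⊆ pCyl t₀ x₀ (2 * R)) :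
    MemLp (fun p => ζ p * v p.1 p.2) 2 :=
  memLp_mul_of_tsupport_subset (measurableSet_pCyl _ _ _) hC.memLp hζ.continuous hζc hζs

lemma inner_single_one (a : Ed d) (i : Fin d) :
    ⟪a, EuclideanSpace.single i (1 : ℝ)⟫ = a i := by
  simp [EuclideanSpace.inner_single_right]

lemma CylSuper.memLp_cutGrad (hC : CylSuper s Λ A K v Dv t₀ x₀ R) (hζ : ContDiff ℝ (⊤ : ℕ∞) ζ)
    (hζc : HasCompactSupport ζ) (hζs : tsupport ζ ⊆ pCyl t₀ x₀ (2 * R)) (i : Fin d) :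
    MemLp (cutGrad ζ v Dv i) 2 := by
  have hζ1 : ContDiff ℝ 1 ζ := hζ.of_le (by simp)
  have h := hC.memLp_inner (EuclideanSpace.single i (1 : ℝ))
  simp only [inner_single_one] at h
  exact (memLp_mul_of_tsupport_subset (measurableSet_pCyl _ _ _) h hζ.continuous hζc hζs).add
    (memLp_mul_of_tsupport_subset (measurableSet_pCyl _ _ _) hC.memLp
      ((hζ1.continuous_fderiv one_ne_zero).clm_apply continuous_const)
      (hζc.fderiv_apply (𝕜 := ℝ) _) ((tsupport_fderiv_apply_subset' _).trans hζs))

lemma CylSuper.weakDeriv_cutoff (hC : CylSuper s Λ A K v Dv t₀ x₀ R)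
    (hζ : ContDiff ℝ (⊤ : ℕ∞) ζ) (hζc : HasCompactSupport ζ)
    (hζs : tsupport ζ ⊆ pCyl t₀ x₀ (2 * R)) (i : Fin d) :
    WeakDeriv (fun p => ζ p * v p.1 p.2) (cutGrad ζ v Dv i) (spaceDir d i) := by
  intro Ψ hΨ hΨc
  have hζ1 : ContDiff ℝ 1 ζ := hζ.of_le (by simp)
  have hΨ1 : ContDiff ℝ 1 Ψ := hΨ.of_le (by simp)
  have hs1 : tsupport (fun p => ζ p * Ψ p) ⊆ tsupport ζ := tsupport_mul_subset_left
  have key := hC.integral_mul_fderiv_space (hζ.mul hΨ) hζc.mul_right (hs1.trans hζs)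
    (EuclideanSpace.single i 1)
  have hu := hC.memLp_cutoff hζ hζc hζs
  have hdΨ : MemLp (fun p => fderiv ℝ Ψ p (spaceDir d i)) 2 :=
    (((hΨ1.continuous_fderiv one_ne_zero).clm_apply continuous_const)
      : Continuous fun p => fderiv ℝ Ψ p (spaceDir d i)).memLp_of_hasCompactSupport
      (hΨc.fderiv_apply (𝕜 := ℝ) _)
  have hΨ2 : MemLp Ψ 2 := hΨ1.continuous.memLp_of_hasCompactSupport hΨc
  have hcdζ : Continuous fun p => fderiv ℝ ζ p (spaceDir d i) :=
    (hζ1.continuous_fderiv one_ne_zero).clm_apply continuous_const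
  have hv2 : MemLp (fun p => fderiv ℝ ζ p (spaceDir d i) * v p.1 p.2) 2 :=
    memLp_mul_of_tsupport_subset (measurableSet_pCyl _ _ _) hC.memLp hcdζ
      (hζc.fderiv_apply (𝕜 := ℝ) _) ((tsupport_fderiv_apply_subset' _).trans hζs)
  have hD2 : MemLp (fun p : ℝ × Ed d => ζ p * Dv p.1 p.2 i) 2 := by
    have h := hC.memLp_inner (EuclideanSpace.single i (1 : ℝ))
    simp only [inner_single_one] at h
    exact memLp_mul_of_tsupport_subset (measurableSet_pCyl _ _ _) h hζ.continuous hζc hζs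
  have i1 : Integrable fun p : ℝ × Ed d => ζ p * v p.1 p.2 * fderiv ℝ Ψ p (spaceDir d i) :=
    hu.integrable_mul hdΨ
  have i2 : Integrable fun p : ℝ × Ed d => fderiv ℝ ζ p (spaceDir d i) * v p.1 p.2 * Ψ p :=
    hv2.integrable_mul hΨ2
  have i3 : Integrable fun p : ℝ × Ed d => ζ p * Dv p.1 p.2 i * Ψ p := hD2.integrable_mul hΨ2
  have e1 : ∀ p : ℝ × Ed d, v p.1 p.2 * fderiv ℝ (fun p => ζ p * Ψ p) p
      (0, EuclideanSpace.single i 1) = ζ p * v p.1 p.2 * fderiv ℝ Ψ p (spaceDir d i)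
        + fderiv ℝ ζ p (spaceDir d i) * v p.1 p.2 * Ψ p := by
    intro p
    rw [fderiv_fun_mul (hζ1.differentiable one_ne_zero p) (hΨ1.differentiable one_ne_zero p)]
    simp only [spaceDir, add_apply, smul_apply,
      smul_eq_mul]
    ring
  have e2 : ∀ p : ℝ × Ed d, ζ p * Ψ p * ⟪Dv p.1 p.2, EuclideanSpace.single i (1 : ℝ)⟫
      = ζ p * Dv p.1 p.2 i * Ψ p := by
    intro p; rw [inner_single_one]; ring
  simp only [e1, e2] at key
  rw [integral_add i1 i2] at key
  have e3 : ∀ p : ℝ × Ed d, cutGrad ζ v Dv i p * Ψ p = ζ p * Dv p.1 p.2 i * Ψ p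
      + fderiv ℝ ζ p (spaceDir d i) * v p.1 p.2 * Ψ p := fun p => by
    simp only [cutGrad]; ring
  simp only [e3]
  rw [integral_add i3 i2]
  linarith

end Cutoff

section Nonlocal

variable {s Λ : ℝ} {A : ℝ → Ed d → Ed d → Ed d} {K : ℝ → Ed d → Ed d → ℝ} {v : ℝ → Ed d → ℝ}
  {Dv : ℝ → Ed d → Ed d} {t₀ : ℝ} {x₀ : Ed d} {R : ℝ}

/-- The weighted mass `∫ |v(t,y)| / (1 + |y|^{d+2s}) dy`. -/
def tailMass (s : ℝ) (v : ℝ → Ed d → ℝ) (t : ℝ) : ℝ≥0∞ :=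
  ∫⁻ y, ENNReal.ofReal (|v t y| / (1 + ‖y‖ ^ ((d : ℝ) + 2 * s)))

/-- The long range interaction of `p` with its time slice, at distance at least `κ`. -/
def farMass (s κ : ℝ) (v : ℝ → Ed d → ℝ) (p : ℝ × Ed d) : ℝ≥0∞ :=
  2 * ∫⁻ y, (if ‖p.2 - y‖ < κ then 0 else
    (‖v p.1 p.2‖ₑ + ‖v p.1 y‖ₑ) * jumpKer s (p.2 - y))

lemma KernelHyp.nonneg (hK : KernelHyp d s Λ K) (hΛ : 1 ≤ Λ) (t : ℝ) {x y : Ed d} (hxy : x ≠ y) :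
    0 ≤ K t x y := by
  refine le_trans ?_ (hK.lower t x y hxy)
  positivity

lemma KernelHyp.enorm_le (hK : KernelHyp d s Λ K) (hΛ : 1 ≤ Λ) (t : ℝ) {x y : Ed d}
    (hxy : x ≠ y) : ‖K t x y‖ₑ ≤ ENNReal.ofReal Λ * jumpKer s (x - y) := by
  rw [Real.enorm_of_nonneg (hK.nonneg hΛ t hxy), jumpKer, ← ENNReal.ofReal_mul (by linarith)]
  refine ENNReal.ofReal_le_ofReal ((hK.upper t x y hxy).trans_eq ?_)
  ring

lemma measurable_jumpForm (hK : KernelHyp d s Λ K) (hv : Measurable (Function.uncurry v))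
    {g : ℝ × Ed d → ℝ} (hg : Measurable g) : Measurable (jumpForm K v g) := by
  have h1 : Measurable fun z : (ℝ × Ed d) × Ed d => v z.1.1 z.1.2 := hv.comp measurable_fst
  have h2 : Measurable fun z : (ℝ × Ed d) × Ed d => v z.1.1 z.2 :=
    hv.comp (by fun_prop : Measurable fun z : (ℝ × Ed d) × Ed d => (z.1.1, z.2))
  have h3 : Measurable fun z : (ℝ × Ed d) × Ed d => g z.1 := hg.comp measurable_fst
  have h4 : Measurable fun z : (ℝ × Ed d) × Ed d => g (z.1.1, z.2) :=
    hg.comp (by fun_prop : Measurable fun z : (ℝ × Ed d) × Ed d => (z.1.1, z.2))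
  have h5 : Measurable fun z : (ℝ × Ed d) × Ed d => K z.1.1 z.1.2 z.2 :=
    hK.meas.comp (by fun_prop : Measurable fun z : (ℝ × Ed d) × Ed d => (z.1.1, z.1.2, z.2))
  exact ((h1.sub h2).mul (h3.sub h4)).mul h5

lemma measurable_tailMass (hv : Measurable (Function.uncurry v)) : Measurable (tailMass s v) := by
  have h1 : Measurable fun z : ℝ × Ed d =>
      ENNReal.ofReal (|v z.1 z.2| / (1 + ‖z.2‖ ^ ((d : ℝ) + 2 * s))) := by
    have hα : Measurable fun z : ℝ × Ed d => 1 + ‖z.2‖ ^ ((d : ℝ) + 2 * s) :=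
      measurable_const.add (measurable_snd.norm.pow_const _)
    have hv : Measurable fun z : ℝ × Ed d => |v z.1 z.2| := hv.abs
    exact (hv.div hα).ennreal_ofReal
  exact h1.lintegral_prod_right'

lemma measurable_farMass (hv : Measurable (Function.uncurry v)) (κ : ℝ) :
    Measurable (farMass s κ v) := by
  have h1 : Measurable fun z : (ℝ × Ed d) × Ed d => ‖v z.1.1 z.1.2‖ₑ :=
    (hv.comp measurable_fst).enorm
  have h2 : Measurable fun z : (ℝ × Ed d) × Ed d => ‖v z.1.1 z.2‖ₑ :=
    (hv.comp (by fun_prop : Measurable fun z : (ℝ × Ed d) × Ed d => (z.1.1, z.2))).enorm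
  have h3 : Measurable fun z : (ℝ × Ed d) × Ed d => jumpKer s (z.1.2 - z.2) :=
    (measurable_jumpKer s).comp (by fun_prop)
  have h : Measurable fun z : (ℝ × Ed d) × Ed d => (if ‖z.1.2 - z.2‖ < κ then 0 else
      (‖v z.1.1 z.1.2‖ₑ + ‖v z.1.1 z.2‖ₑ) * jumpKer s (z.1.2 - z.2)) :=
    Measurable.ite (measurableSet_lt (by fun_prop) measurable_const) measurable_const
      ((h1.add h2).mul h3)
  exact h.lintegral_prod_right'.const_mul 2

lemma lintegral_jumpForm_le (hK : KernelHyp d s Λ K) (hΛ : 1 ≤ Λ)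
    (hv : Measurable (Function.uncurry v)) {u g : ℝ × Ed d → ℝ} (hu : Measurable u)
    (hg : Measurable g) {a b : ℝ≥0∞}
    (ha : ∀ h : Ed d, eLpNorm (fun p => u (p + (0, h)) - u p) 2 ≤ ‖h‖ₑ * a)
    (hb : ∀ h : Ed d, eLpNorm (fun p => g (p + (0, h)) - g p) 2 ≤ ‖h‖ₑ * b) {κ : ℝ}
    (hκ0 : 0 < κ) (hκ : κ ≤ 1) {S V : Set (ℝ × Ed d)} (hgS : ∀ p, p ∉ S → g p = 0)
    (hSV : ∀ p ∈ S, ∀ y, ‖p.2 - y‖ < κ → (p.1, y) ∈ V) (huv : ∀ p ∈ V, u p = v p.1 p.2) :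
    ∫⁻ z, ‖jumpForm K v g z‖ₑ ≤ ENNReal.ofReal Λ *
      (levyConst d s * (a * b) + ∫⁻ p : ℝ × Ed d, ‖g p‖ₑ * farMass s κ v p) := by
  have hm := (measurable_jumpForm hK hv hg).enorm
  set N : ℝ × Ed d → Ed d → ℝ≥0∞ := fun p y => if ‖p.2 - y‖ < κ then
      ‖u p - u (p.1, y)‖ₑ * ‖g p - g (p.1, y)‖ₑ * jumpKer s (p.2 - y) else 0 with hN
  set F : ℝ × Ed d → Ed d → ℝ≥0∞ := fun p y => if ‖p.2 - y‖ < κ then 0 else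
      ‖v p.1 p.2 - v p.1 y‖ₑ * ‖g p - g (p.1, y)‖ₑ * jumpKer s (p.2 - y) with hF
  have hpt : ∀ (p : ℝ × Ed d) y, ‖jumpForm K v g (p, y)‖ₑ
      ≤ ENNReal.ofReal Λ * (N p y + F p y) := by
    intro p y
    by_cases hxy : p.2 = y
    · have : jumpForm K v g (p, y) = 0 := by simp [jumpForm, ← hxy]
      simp [this]
    have hK1 := hK.enorm_le hΛ p.1 hxy
    by_cases hn : ‖p.2 - y‖ < κ
    · simp only [hN, hF, hn, if_true, add_zero]
      by_cases hS : p ∈ S ∨ (p.1, y) ∈ S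
      · have hV : p ∈ V ∧ (p.1, y) ∈ V := by
          rcases hS with h | h
          · exact ⟨hSV p h p.2 (by simpa using hκ0), hSV p h y hn⟩
          · refine ⟨hSV _ h p.2 (by rwa [norm_sub_rev]), hSV _ h y (by simpa using hκ0)⟩
        rw [huv _ hV.1, huv _ hV.2, jumpForm, enorm_mul, enorm_mul, mul_left_comm]
        gcongr
      · rw [not_or] at hS
        simp [jumpForm, hgS _ hS.1, hgS _ hS.2]
    · simp only [hN, hF, hn, if_false, zero_add]
      rw [jumpForm, enorm_mul, enorm_mul, mul_left_comm]
      gcongr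
  have hN0 : Measurable fun z : (ℝ × Ed d) × Ed d => N z.1 z.2 := by
    refine Measurable.ite (measurableSet_lt (by fun_prop) measurable_const) ?_ measurable_const
    have h0 : Measurable fun z : (ℝ × Ed d) × Ed d => (z.1.1, z.2) := by fun_prop
    have h3 : Measurable fun z : (ℝ × Ed d) × Ed d => jumpKer s (z.1.2 - z.2) :=
      (measurable_jumpKer s).comp (by fun_prop)
    exact (((hu.comp measurable_fst).sub (hu.comp h0)).enorm.mul
      ((hg.comp measurable_fst).sub (hg.comp h0)).enorm).mul h3
  have hNle : ∫⁻ p, (∫⁻ y, N p y) ≤ levyConst d s * (a * b) := lintegral_near_le hu hg ha hb hκ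
  have hFle : ∫⁻ p, (∫⁻ y, F p y) ≤ ∫⁻ p : ℝ × Ed d, ‖g p‖ₑ * farMass s κ v p :=
    lintegral_far_le (f := Function.uncurry v) hv hg κ
  clear_value N F
  calc ∫⁻ z, ‖jumpForm K v g z‖ₑ
      = ∫⁻ p, (∫⁻ y, ‖jumpForm K v g (p, y)‖ₑ) := by
        rw [Measure.volume_eq_prod, lintegral_prod _ hm.aemeasurable]
    _ ≤ ∫⁻ p, (∫⁻ y, ENNReal.ofReal Λ * (N p y + F p y)) :=
        lintegral_mono fun p => lintegral_mono fun y => hpt p y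
    _ = ENNReal.ofReal Λ * ((∫⁻ p, (∫⁻ y, N p y)) + ∫⁻ p, (∫⁻ y, F p y)) := by
        rw [← lintegral_add_left hN0.lintegral_prod_right', ← lintegral_const_mul' _ _
          ENNReal.ofReal_ne_top]
        refine lintegral_congr fun p => ?_
        rw [lintegral_const_mul' _ _ ENNReal.ofReal_ne_top,
          lintegral_add_left (f := fun y => N p y) (hN0.comp measurable_prodMk_left)]
    _ ≤ _ := by
        exact mul_le_mul_right (add_le_add hNle hFle) _

lemma jumpKer_far_le (hs : 0 < s) {κ M : ℝ} (hκ0 : 0 < κ) (hM : 0 ≤ M) :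
    ∃ C : ℝ, 0 ≤ C ∧ ∀ x y : Ed d, ‖x‖ ≤ M → κ ≤ ‖x - y‖ →
      1 / ‖x - y‖ ^ ((d : ℝ) + 2 * s) ≤ C * (1 / (1 + ‖y‖ ^ ((d : ℝ) + 2 * s))) := by
  have hα : 0 < (d : ℝ) + 2 * s := by positivity
  refine ⟨(1 / κ) ^ ((d : ℝ) + 2 * s) + (1 + M / κ) ^ ((d : ℝ) + 2 * s), by positivity, ?_⟩
  intro x y hx hxy
  have hpos : 0 < ‖x - y‖ := hκ0.trans_le hxy
  rw [mul_one_div, div_le_div_iff₀ (by positivity) (by positivity), one_mul, add_mul]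
  refine add_le_add ?_ ?_
  · rw [← Real.mul_rpow (by positivity) hpos.le]
    refine Real.one_le_rpow ?_ hα.le
    rw [one_div, inv_mul_eq_div, one_le_div hκ0]; exact hxy
  · rw [← Real.mul_rpow (by positivity) hpos.le]
    refine Real.rpow_le_rpow (norm_nonneg _) ?_ hα.le
    have h1 : ‖y‖ ≤ ‖x‖ + ‖x - y‖ := by
      have := norm_sub_norm_le y x
      rw [norm_sub_rev] at this; linarith
    have h2 : M ≤ M / κ * ‖x - y‖ := by
      rw [div_mul_eq_mul_div, le_div_iff₀ hκ0]; gcongr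
    linarith

lemma CylSuper.lintegral_tailMass_ne_top (hC : CylSuper s Λ A K v Dv t₀ x₀ R) :
    ∫⁻ t in Iminus t₀ (2 * R), tailMass s v t ≠ ∞ := by
  have h1 : ∀ a : ℝ≥0∞, a ≤ 1 + a ^ 2 := fun a => by
    rcases le_total a 1 with h | h
    · exact h.trans le_self_add
    · calc a = a * 1 := (mul_one a).symm
        _ ≤ a ^ 2 := by rw [sq]; gcongr
        _ ≤ _ := le_add_self
  refine ne_top_of_le_ne_top ?_ (lintegral_mono fun t => h1 (tailMass s v t))
  rw [lintegral_add_left measurable_const]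
  refine ENNReal.add_ne_top.2 ⟨?_, hC.tail⟩
  simp [Iminus]

lemma CylSuper.lintegral_farMass_ne_top (hC : CylSuper s Λ A K v Dv t₀ x₀ R) {κ : ℝ}
    (hκ0 : 0 < κ) (hκ1 : κ ≤ 1) : ∫⁻ p in pCyl t₀ x₀ (2 * R), farMass s κ v p ≠ ∞ := by
  have hR := hC.R_mem.1
  obtain ⟨C, hC0, hCb⟩ := jumpKer_far_le (d := d) hC.s_mem.1 hκ0
    (M := ‖x₀‖ + 2 * R) (by positivity)
  have hlev := levyConst_ne_top hC.two_le hC.s_mem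
  have hpt : ∀ p ∈ pCyl t₀ x₀ (2 * R), farMass s κ v p ≤
      2 * (ENNReal.ofReal (κ⁻¹ ^ 2) * levyConst d s * ‖v p.1 p.2‖ₑ
        + ENNReal.ofReal C * tailMass s v p.1) := by
    intro p hp
    have hx : ‖p.2‖ ≤ ‖x₀‖ + 2 * R := by
      have h1 := mem_ball_iff_norm.1 hp.2
      have h2 := norm_sub_norm_le p.2 x₀
      linarith
    rw [farMass]
    gcongr
    have hle : ∀ y, (if ‖p.2 - y‖ < κ then 0 else
        (‖v p.1 p.2‖ₑ + ‖v p.1 y‖ₑ) * jumpKer s (p.2 - y)) ≤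
        ‖v p.1 p.2‖ₑ * (ENNReal.ofReal (κ⁻¹ ^ 2) *
          (ENNReal.ofReal (min 1 (‖p.2 - y‖ ^ 2)) * jumpKer s (p.2 - y)))
        + ENNReal.ofReal C *
          ENNReal.ofReal (|v p.1 y| / (1 + ‖y‖ ^ ((d : ℝ) + 2 * s))) := by
      intro y
      split_ifs with hy
      · exact bot_le
      · rw [not_lt] at hy
        rw [add_mul]
        refine add_le_add ?_ ?_
        · gcongr
          rw [← mul_assoc, ← ENNReal.ofReal_mul (by positivity)]
          refine le_mul_of_one_le_left' (ENNReal.one_le_ofReal.2 ?_)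
          rw [inv_pow, inv_mul_eq_div, one_le_div (by positivity)]
          exact le_min (by nlinarith) (by gcongr)
        · rw [Real.enorm_eq_ofReal_abs, jumpKer, ← ENNReal.ofReal_mul (abs_nonneg _),
            ← ENNReal.ofReal_mul hC0]
          refine ENNReal.ofReal_le_ofReal ?_
          calc |v p.1 y| * (1 / ‖p.2 - y‖ ^ ((d : ℝ) + 2 * s))
              ≤ |v p.1 y| * (C * (1 / (1 + ‖y‖ ^ ((d : ℝ) + 2 * s)))) := by
                gcongr; exact hCb _ _ hx hy
            _ = _ := by ring
    refine (lintegral_mono hle).trans ?_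
    have hmk : Measurable fun y : Ed d => ENNReal.ofReal (min 1 (‖p.2 - y‖ ^ 2)) *
        jumpKer s (p.2 - y) := by fun_prop
    rw [lintegral_add_left ((hmk.const_mul _).const_mul _),
      lintegral_const_mul _ (hmk.const_mul _), lintegral_const_mul _ hmk,
      lintegral_const_mul' _ _ ENNReal.ofReal_ne_top]
    have hsub : ∫⁻ y, ENNReal.ofReal (min 1 (‖p.2 - y‖ ^ 2)) * jumpKer s (p.2 - y)
        = levyConst d s :=
      lintegral_sub_left_eq_self (fun h : Ed d => ENNReal.ofReal (min 1 (‖h‖ ^ 2)) *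
        jumpKer s h) p.2
    rw [hsub, mul_comm ‖v p.1 p.2‖ₑ]
    rfl
  refine ne_top_of_le_ne_top ?_
    (setLIntegral_mono' (measurableSet_pCyl _ _ _) fun p hp => hpt p hp)
  have hmv : Measurable fun p : ℝ × Ed d => ‖v p.1 p.2‖ₑ := hC.meas.enorm
  have hmt : Measurable fun p : ℝ × Ed d => tailMass s v p.1 :=
    (measurable_tailMass hC.meas).comp measurable_fst
  rw [lintegral_const_mul' _ _ (by simp), lintegral_add_left (hmv.const_mul _),
    lintegral_const_mul _ hmv, lintegral_const_mul' _ _ ENNReal.ofReal_ne_top]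
  have hfin : IsFiniteMeasure (volume.restrict (pCyl t₀ x₀ (2 * R))) := by
    refine ⟨?_⟩
    rw [Measure.restrict_apply_univ, pCyl, Measure.volume_eq_prod, Measure.prod_prod]
    exact ENNReal.mul_lt_top (by simp [Iminus]) measure_ball_lt_top
  have h1 : ∫⁻ p in pCyl t₀ x₀ (2 * R), ‖v p.1 p.2‖ₑ ≠ ∞ :=
    (hC.memLp.integrable (by norm_num)).2.ne
  have h2 : ∫⁻ p in pCyl t₀ x₀ (2 * R), tailMass s v p.1 ≠ ∞ := by
    rw [pCyl, Measure.volume_eq_prod, ← Measure.prod_restrict,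
      lintegral_prod _ hmt.aemeasurable]
    simp only [lintegral_const]
    rw [lintegral_mul_const _ (measurable_tailMass hC.meas)]
    refine ENNReal.mul_ne_top hC.lintegral_tailMass_ne_top ?_
    rw [Measure.restrict_apply_univ]; exact measure_ball_lt_top.ne
  refine ENNReal.mul_ne_top (by simp) (ENNReal.add_ne_top.2 ⟨ENNReal.mul_ne_top
    (ENNReal.mul_ne_top ENNReal.ofReal_ne_top hlev) h1,
    ENNReal.mul_ne_top ENNReal.ofReal_ne_top h2⟩)

end Nonlocal

lemma exists_contDiff_cutoff {E : Type*} [NormedAddCommGroup E] [NormedSpace ℝ E]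
    [FiniteDimensional ℝ E] {k U : Set E} (hk : IsCompact k) (hU : IsOpen U) (hkU : k ⊆ U) :
    ∃ ε : ℝ, 0 < ε ∧ ε ≤ 1 ∧ cthickening (2 * ε) k ⊆ U ∧ ∃ ζ : E → ℝ, ContDiff ℝ (⊤ : ℕ∞) ζ ∧
      HasCompactSupport ζ ∧ tsupport ζ ⊆ U ∧ (∀ x, ζ x ∈ Icc (0 : ℝ) 1) ∧
      ∀ x ∈ cthickening (2 * ε) k, ζ x = 1 := by
  obtain ⟨δ, hδ, hδU⟩ := hk.exists_cthickening_subset_open hU hkU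
  set ε := min (δ / 3) 1 with hε
  have hε0 : 0 < ε := by positivity
  have h3 : 3 * ε ≤ δ := by have := min_le_left (δ / 3) 1; linarith
  have hLc : IsCompact (cthickening (3 * ε) k) := hk.cthickening
  have hLU : cthickening (3 * ε) k ⊆ U := (cthickening_mono h3 k).trans hδU
  refine ⟨ε, hε0, min_le_right _ _, (cthickening_mono (by linarith) k).trans hLU, ?_⟩
  obtain ⟨f, hf0, hf1, hf⟩ := exists_contMDiffMap_zero_one_of_isClosed (n := (⊤ : ℕ∞))
    (modelWithCornersSelf ℝ E) (s := (interior (cthickening (3 * ε) k))ᶜ)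
    (t := cthickening (2 * ε) k)
    isOpen_interior.isClosed_compl isClosed_cthickening (by
      rw [disjoint_compl_left_iff_subset]
      refine (cthickening_subset_thickening' (δ₂ := 3 * ε) (by linarith) (by linarith) k).trans ?_
      exact interior_maximal (thickening_subset_cthickening _ _) isOpen_thickening)
  have hs : Function.support f ⊆ cthickening (3 * ε) k := by
    intro x hx
    by_contra h
    exact hx (hf0 fun h' => h (interior_subset h'))
  have hts : tsupport f ⊆ cthickening (3 * ε) k := closure_minimal hs isClosed_cthickening
  exact ⟨f, f.contMDiff.contDiff, HasCompactSupport.of_support_subset_isCompact hLc hs,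
    hts.trans hLU, hf, fun x hx => hf1 hx⟩

section Limit

variable {s Λ : ℝ} {A : ℝ → Ed d → Ed d → Ed d} {K : ℝ → Ed d → Ed d → ℝ} {v : ℝ → Ed d → ℝ}
  {Dv : ℝ → Ed d → Ed d} {t₀ : ℝ} {x₀ : Ed d} {R : ℝ}

lemma jumpForm_sub (K : ℝ → Ed d → Ed d → ℝ) (v : ℝ → Ed d → ℝ) (f g : ℝ × Ed d → ℝ) :
    jumpForm K v (f - g) = jumpForm K v f - jumpForm K v g := by
  ext z; simp only [jumpForm, Pi.sub_apply]; ring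

lemma CylSuper.tendsto_integral_jumpForm (hC : CylSuper s Λ A K v Dv t₀ x₀ R)
    {u : ℝ × Ed d → ℝ} (hu : Measurable u) {a : ℝ≥0∞} (ha' : a ≠ ∞)
    (ha : ∀ h : Ed d, eLpNorm (fun p => u (p + (0, h)) - u p) 2 ≤ ‖h‖ₑ * a) {κ : ℝ}
    (hκ0 : 0 < κ) (hκ : κ ≤ 1) {S V : Set (ℝ × Ed d)} (hSm : IsCompact S)
    (hSC : S ⊆ pCyl t₀ x₀ (2 * R))
    (hSV : ∀ p ∈ S, ∀ y, ‖p.2 - y‖ < κ → (p.1, y) ∈ V) (huv : ∀ p ∈ V, u p = v p.1 p.2)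
    {ψ : ℕ → ℝ × Ed d → ℝ} {Φ : ℝ × Ed d → ℝ} (hψ : ∀ n, ContDiff ℝ (⊤ : ℕ∞) (ψ n))
    (hΦm : Measurable Φ) (hψS : ∀ n, ∀ p, p ∉ S → ψ n p = 0) (hΦS : ∀ p, p ∉ S → Φ p = 0)
    {M : ℝ} (hM : ∀ n p, |ψ n p| ≤ M) (hlim : ∀ᵐ p, Tendsto (fun n => ψ n p) atTop (𝓝 (Φ p)))
    {G : Fin d → ℝ × Ed d → ℝ} (hG : ∀ i, MemLp (G i) 2)
    (hD : ∀ i, Tendsto (fun n => eLpNorm ((fun p => fderiv ℝ (ψ n) p (spaceDir d i)) - G i) 2)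
      atTop (𝓝 0)) :
    (∀ n, Integrable (jumpForm K v (ψ n))) ∧ Integrable (jumpForm K v Φ) ∧
      Tendsto (fun n => ∫ z, jumpForm K v (ψ n) z) atTop (𝓝 (∫ z, jumpForm K v Φ z)) := by
  have hψ1 : ∀ n, ContDiff ℝ 1 (ψ n) := fun n => (hψ n).of_le (by simp)
  have hψc : ∀ n, HasCompactSupport (ψ n) := fun n =>
    HasCompactSupport.intro hSm fun p hp => hψS n p hp
  have hDL : ∀ n i, MemLp (fun p => fderiv ℝ (ψ n) p (spaceDir d i)) 2 := fun n i =>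
    (((hψ1 n).continuous_fderiv one_ne_zero).clm_apply continuous_const).memLp_of_hasCompactSupport
      ((hψc n).fderiv_apply (𝕜 := ℝ) _)
  have hfar : ∫⁻ p in S, farMass s κ v p ≠ ∞ :=
    ne_top_of_le_ne_top (hC.lintegral_farMass_ne_top hκ0 hκ) (lintegral_mono_set hSC)
  have hlev := levyConst_ne_top hC.two_le hC.s_mem
  have hM0 : 0 ≤ M := (abs_nonneg _).trans (hM 0 0)
  have hset : ∀ g : ℝ × Ed d → ℝ, (∀ p, p ∉ S → g p = 0) →
      ∫⁻ p : ℝ × Ed d, ‖g p‖ₑ * farMass s κ v p = ∫⁻ p in S, ‖g p‖ₑ * farMass s κ v p := by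
    intro g hg
    refine (setLIntegral_eq_of_support_subset ?_).symm
    intro p hp
    by_contra h
    exact hp (by simp [hg p h])
  have hgen : ∀ g : ℝ × Ed d → ℝ, Measurable g → (∀ p, p ∉ S → g p = 0) → ∀ b,
      (∀ h : Ed d, eLpNorm (fun p => g (p + (0, h)) - g p) 2 ≤ ‖h‖ₑ * b) →
      ∫⁻ z, ‖jumpForm K v g z‖ₑ ≤ ENNReal.ofReal Λ *
        (levyConst d s * (a * b) + ∫⁻ p in S, ‖g p‖ₑ * farMass s κ v p) := by
    intro g hgm hg b hb
    rw [← hset g hg]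
    exact lintegral_jumpForm_le hC.ker hC.one_le hC.meas hu hgm ha hb hκ0 hκ hg hSV huv
  have hshψ : ∀ n (h : Ed d), eLpNorm (fun p => ψ n (p + (0, h)) - ψ n p) 2
      ≤ ‖h‖ₑ * ∑ i, eLpNorm (fun p => fderiv ℝ (ψ n) p (spaceDir d i)) 2 := by
    intro n h
    refine eLpNorm_space_shift_le (f := ψ n) (fn := fun _ => ψ n)
      (G := fun i p => fderiv ℝ (ψ n) p (spaceDir d i)) (fun _ => hψ1 n)
      (ae_of_all _ fun p => tendsto_const_nhds) (hDL n) (fun i => ?_) h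
    simp only [sub_self, eLpNorm_zero]
    exact tendsto_const_nhds
  have hint : ∀ n, Integrable (jumpForm K v (ψ n)) := by
    intro n
    have hle := hgen (ψ n) (hψ n).continuous.measurable (hψS n) _ (hshψ n)
    refine ⟨(measurable_jumpForm hC.ker hC.meas (hψ n).continuous.measurable).aestronglyMeasurable,
      lt_of_le_of_lt hle ?_⟩
    refine ENNReal.mul_lt_top ENNReal.ofReal_lt_top (ENNReal.add_lt_top.2 ⟨?_, ?_⟩)
    · refine ENNReal.mul_lt_top hlev.lt_top (ENNReal.mul_lt_top ha'.lt_top ?_)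
      exact ENNReal.sum_lt_top.2 fun i _ => (hDL n i).2
    · refine lt_of_le_of_lt (lintegral_mono (g := fun p => ENNReal.ofReal M * farMass s κ v p)
        fun p => ?_) ?_
      · simp only
        gcongr
        rw [Real.enorm_eq_ofReal_abs]
        exact ENNReal.ofReal_le_ofReal (hM n p)
      · rw [lintegral_const_mul' _ _ ENNReal.ofReal_ne_top]
        exact ENNReal.mul_lt_top ENNReal.ofReal_lt_top hfar.lt_top
  set b : ℕ → ℝ≥0∞ := fun n =>
    ∑ i, eLpNorm ((fun p => fderiv ℝ (ψ n) p (spaceDir d i)) - G i) 2 with hb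
  have hb0 : Tendsto b atTop (𝓝 0) := by
    have := tendsto_finsetSum (Finset.univ : Finset (Fin d)) fun i _ => hD i
    simpa using this
  have hshift : ∀ n (h : Ed d), eLpNorm (fun p => (ψ n - Φ) (p + (0, h)) - (ψ n - Φ) p) 2
      ≤ ‖h‖ₑ * b n := by
    intro n h
    refine eLpNorm_space_shift_le (fn := fun m => ψ n - ψ m)
      (fun m => (hψ1 n).sub (hψ1 m)) ?_ (fun i => (hDL n i).sub (hG i)) (fun i => ?_) h
    · filter_upwards [hlim] with p hp
      exact tendsto_const_nhds.sub hp
    · refine (hD i).congr fun m => ?_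
      rw [← eLpNorm_neg]
      congr 1
      ext p
      simp only [Pi.neg_apply, Pi.sub_apply]
      rw [fderiv_sub ((hψ1 n).differentiable one_ne_zero p)
        ((hψ1 m).differentiable one_ne_zero p), sub_apply]
      ring
  have hdiff : Tendsto (fun n => ∫⁻ z, ‖jumpForm K v (ψ n - Φ) z‖ₑ) atTop (𝓝 0) := by
    have h1 : Tendsto (fun n => ∫⁻ p in S, ‖(ψ n - Φ) p‖ₑ * farMass s κ v p) atTop (𝓝 0) := by
      have h0 : ∫⁻ p in S, (0 : ℝ≥0∞) = 0 := by simp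
      rw [← h0]
      refine tendsto_lintegral_filter_of_dominated_convergence
        (fun p => ENNReal.ofReal (M + M) * farMass s κ v p) (Eventually.of_forall fun n => ?_)
        (Eventually.of_forall fun n => ?_) ?_ ?_
      · exact ((hψ n).continuous.measurable.sub hΦm).enorm.mul (measurable_farMass hC.meas κ)
      · filter_upwards [ae_restrict_of_ae hlim] with p hp
        gcongr
        rw [Real.enorm_eq_ofReal_abs]
        refine ENNReal.ofReal_le_ofReal ((abs_sub _ _).trans ?_)
        exact add_le_add (hM n p) (le_of_tendsto hp.abs (Eventually.of_forall fun n => hM n p))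
      · rw [lintegral_const_mul' _ _ ENNReal.ofReal_ne_top]
        exact ENNReal.mul_ne_top ENNReal.ofReal_ne_top hfar
      · have hft := ae_lt_top (measurable_farMass (s := s) hC.meas κ) hfar
        filter_upwards [ae_restrict_of_ae hlim, hft] with p hp hfp
        have h2 : Tendsto (fun n => ‖(ψ n - Φ) p‖ₑ) atTop (𝓝 0) := by
          have := (hp.sub_const (Φ p)).enorm
          simpa using this
        simpa using ENNReal.Tendsto.mul_const h2 (Or.inr hfp.ne)
    have h2 : Tendsto (fun n => ENNReal.ofReal Λ * (levyConst d s * (a * b n)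
        + ∫⁻ p in S, ‖(ψ n - Φ) p‖ₑ * farMass s κ v p)) atTop (𝓝 0) := by
      have h3 : Tendsto (fun n => levyConst d s * (a * b n)) atTop (𝓝 0) := by
        have := ENNReal.Tendsto.const_mul (ENNReal.Tendsto.const_mul hb0 (Or.inr ha'))
          (Or.inr hlev)
        simpa using this
      simpa using ENNReal.Tendsto.const_mul (h3.add h1) (Or.inr ENNReal.ofReal_ne_top)
    refine tendsto_of_tendsto_of_tendsto_of_le_of_le tendsto_const_nhds h2 (fun _ => bot_le)
      fun n => ?_
    refine hgen _ ((hψ n).continuous.measurable.sub hΦm) (fun p hp => ?_) _ (hshift n)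
    simp [hψS n p hp, hΦS p hp]
  have hΦint : Integrable (jumpForm K v Φ) := by
    obtain ⟨n, hn⟩ := (hdiff.eventually (gt_mem_nhds ENNReal.zero_lt_top)).exists
    have h1 : Integrable (jumpForm K v (ψ n - Φ)) :=
      ⟨(measurable_jumpForm hC.ker hC.meas
        ((hψ n).continuous.measurable.sub hΦm)).aestronglyMeasurable, hn⟩
    have h2 := (hint n).sub h1
    rw [jumpForm_sub, sub_sub_cancel] at h2
    exact h2
  refine ⟨hint, hΦint, ?_⟩
  refine tendsto_integral_of_L1 _ hΦint.1 (Eventually.of_forall hint) (hdiff.congr fun n => ?_)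
  rw [jumpForm_sub]
  rfl

end Limit

section Truncated

variable {s Λ : ℝ} {A : ℝ → Ed d → Ed d → Ed d} {K : ℝ → Ed d → Ed d → ℝ} {v : ℝ → Ed d → ℝ}
  {Dv : ℝ → Ed d → Ed d} {t₀ : ℝ} {x₀ : Ed d} {R : ℝ}

lemma CylSuper.memLp_vectorField (hC : CylSuper s Λ A K v Dv t₀ x₀ R) (i : Fin d) :
    MemLp ((pCyl t₀ x₀ (2 * R)).indicator fun p => A p.1 p.2 (Dv p.1 p.2) i) 2 := by
  rw [memLp_indicator_iff_restrict (measurableSet_pCyl _ _ _)]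
  have hm : Measurable fun p : ℝ × Ed d => A p.1 p.2 (Dv p.1 p.2) i :=
    (by fun_prop : Measurable fun a : Ed d => a i).comp (hC.vf.measurable_comp hC.measD)
  refine MemLp.of_le_mul (c := Λ) hC.memLpD hm.aestronglyMeasurable (ae_of_all _ fun p => ?_)
  exact (PiLp.norm_apply_le _ i).trans (hC.vf.growth _ _ _)

/-- The `i`-th spatial derivative of `(k - v)₊² β`. -/
def gradTest (k : ℝ) (v : ℝ → Ed d → ℝ) (Dv : ℝ → Ed d → Ed d) (β : ℝ × Ed d → ℝ) (i : Fin d)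
    (p : ℝ × Ed d) : ℝ :=
  -(2 * truncPow k 1 (v p.1 p.2)) * Dv p.1 p.2 i * β p
    + truncPow k 2 (v p.1 p.2) * fderiv ℝ β p (spaceDir d i)

theorem CylSuper.truncated (hC : CylSuper s Λ A K v Dv t₀ x₀ R) {k : ℝ} (hk : 0 ≤ k)
    {β : ℝ × Ed d → ℝ} (hβ : ContDiff ℝ (⊤ : ℕ∞) β) (hβ0 : ∀ p, 0 ≤ β p)
    (hβc : HasCompactSupport β) (hβs : tsupport β ⊆ pCyl t₀ x₀ (2 * R)) :
    Integrable (jumpForm K v fun p => truncPow k 2 (v p.1 p.2) * β p) ∧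
    Integrable (fun p : ℝ × Ed d => ∑ i, A p.1 p.2 (Dv p.1 p.2) i * gradTest k v Dv β i p) ∧
    0 ≤ (∫ p : ℝ × Ed d, (truncPow k 3 (v p.1 p.2) / 3) * fderiv ℝ β p (1, 0))
      + (∫ p : ℝ × Ed d, ∑ i, A p.1 p.2 (Dv p.1 p.2) i * gradTest k v Dv β i p)
      + ∫ z, jumpForm K v (fun p => truncPow k 2 (v p.1 p.2) * β p) z := by
  have hUo : IsOpen (pCyl t₀ x₀ (2 * R)) := isOpen_Ioo.prod isOpen_ball
  obtain ⟨ε, hε0, hε1, hεU, ζ, hζ, hζc, hζs, hζ01, hζ1⟩ :=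
    exists_contDiff_cutoff hβc.isCompact hUo hβs
  set u : ℝ × Ed d → ℝ := fun p => ζ p * v p.1 p.2 with hu
  have hum : Measurable u := hζ.continuous.measurable.mul hC.meas
  have huL : MemLp u 2 := hC.memLp_cutoff hζ hζc hζs
  have hul : LocallyIntegrable u := huL.locallyIntegrable (by norm_num)
  have hu0 : ∀ᵐ p, 0 ≤ u p := by
    filter_upwards [hC.nonneg] with p hp
    by_cases h : p ∈ pCyl t₀ x₀ (2 * R)
    · exact mul_nonneg (hζ01 p).1 (hp h)
    · simp [hu, image_eq_zero_of_notMem_tsupport fun h' => h (hζs h')]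
  have hGL : ∀ i, MemLp (cutGrad ζ v Dv i) 2 := hC.memLp_cutGrad hζ hζc hζs
  have hGw : ∀ i, WeakDeriv u (cutGrad ζ v Dv i) (spaceDir d i) := hC.weakDeriv_cutoff hζ hζc hζs
  obtain ⟨ψ, hψ, hψ0, ⟨M, hM⟩, hψS, hlim, hD, hT⟩ :=
    exists_approx_truncPow_mul huL hu0 hk hβ hβc hβ0 hGL hGw hε0
  have hsub : cthickening ε (tsupport β) ⊆ cthickening (2 * ε) (tsupport β) :=
    cthickening_mono (by linarith) _
  have hSc : IsCompact (cthickening ε (tsupport β)) := hβc.isCompact.cthickening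
  have hSC : cthickening ε (tsupport β) ⊆ pCyl t₀ x₀ (2 * R) := hsub.trans hεU
  have huv : ∀ p ∈ cthickening (2 * ε) (tsupport β), u p = v p.1 p.2 := fun p hp => by
    simp [hu, hζ1 p hp]
  have hβS : ∀ p, p ∉ cthickening ε (tsupport β) → β p = 0 := fun p hp =>
    image_eq_zero_of_notMem_tsupport fun h => hp (self_subset_cthickening _ h)
  have huvβ : ∀ p ∈ tsupport β, u p = v p.1 p.2 := fun p hp =>
    huv p (self_subset_cthickening _ hp)
  have hζd : ∀ p ∈ tsupport β, ∀ a, fderiv ℝ ζ p a = 0 := by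
    intro p hp a
    have h1 : ζ =ᶠ[𝓝 p] fun _ => 1 := by
      filter_upwards [isOpen_thickening.mem_nhds
        (self_subset_thickening (show 0 < 2 * ε by linarith) _ hp)] with x hx
      exact hζ1 x (thickening_subset_cthickening _ _ hx)
    rw [h1.fderiv_eq]
    simp
  have hfβ : ∀ p, p ∉ tsupport β → ∀ a, fderiv ℝ β p a = 0 := fun p hp a =>
    image_eq_zero_of_notMem_tsupport (f := fun p => fderiv ℝ β p a) fun h =>
      hp (tsupport_fderiv_apply_subset' _ h)
  have hGt : ∀ i, (fun p => -(2 * truncPow k 1 (u p)) * cutGrad ζ v Dv i p * β p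
          + truncPow k 2 (u p) * fderiv ℝ β p (spaceDir d i)) = gradTest k v Dv β i := by
    intro i
    ext p
    by_cases hp : p ∈ tsupport β
    · rw [gradTest, huvβ p hp, cutGrad, hζd p hp, hζ1 p (self_subset_cthickening _ hp)]
      ring
    · rw [gradTest, hfβ p hp, image_eq_zero_of_notMem_tsupport hp]
      simp
  have hΦ : (fun p => truncPow k 2 (u p) * β p) = fun p => truncPow k 2 (v p.1 p.2) * β p := by
    ext p
    by_cases hp : p ∈ tsupport β
    · rw [huvβ p hp]
    · simp [image_eq_zero_of_notMem_tsupport hp]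
  have hTt : ∀ a, ∫ p, (truncPow k 3 (u p) / 3) * fderiv ℝ β p a
      = ∫ p : ℝ × Ed d, (truncPow k 3 (v p.1 p.2) / 3) * fderiv ℝ β p a := by
    intro a
    congr 1
    ext p
    by_cases hp : p ∈ tsupport β
    · rw [huvβ p hp]
    · simp [hfβ p hp]
  have hβ1 : ContDiff ℝ 1 β := hβ.of_le (by simp)
  have hgL : ∀ i, MemLp (gradTest k v Dv β i) 2 := by
    intro i
    have hdβ : MemLp (fun p => fderiv ℝ β p (spaceDir d i)) 2 :=
      ((hβ1.continuous_fderiv one_ne_zero).clm_apply continuous_const).memLp_of_hasCompactSupport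
        (hβc.fderiv_apply (𝕜 := ℝ) _)
    have htm : ∀ m, AEStronglyMeasurable (fun p => truncPow k m (u p)) volume := fun m =>
      ((continuous_truncPow k m).measurable.comp hum).aestronglyMeasurable
    have htb : ∀ m, ∀ᵐ p, |truncPow k m (u p)| ≤ k ^ m := fun m => by
      filter_upwards [hu0] with p hp using abs_truncPow_le hk m hp
    obtain ⟨B, hB⟩ := hβc.exists_bound_of_continuous hβ.continuous
    have h1 := memLp_bdd_mul (htm 1) (htb 1)
      (memLp_bdd_mul hβ.continuous.aestronglyMeasurable (ae_of_all _ hB) (hGL i))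
    have h2 := memLp_bdd_mul (htm 2) (htb 2) hdβ
    rw [← hGt i]
    refine ((h1.const_mul (-2)).add h2).congr_norm ?_ ?_
    · rw [hGt i]
      unfold gradTest
      have e1 : Measurable fun p : ℝ × Ed d => Dv p.1 p.2 i :=
        (by fun_prop : Measurable fun a : Ed d => a i).comp hC.measD
      have e2 : ∀ m, Measurable fun p : ℝ × Ed d => truncPow k m (v p.1 p.2) := fun m =>
        (continuous_truncPow k m).measurable.comp hC.meas
      have e3 : Measurable fun p => fderiv ℝ β p (spaceDir d i) :=
        ((hβ1.continuous_fderiv one_ne_zero).clm_apply continuous_const).measurable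
      exact (((((e2 1).const_mul 2).neg.mul e1).mul hβ.continuous.measurable).add
        ((e2 2).mul e3)).aestronglyMeasurable
    · refine ae_of_all _ fun p => ?_
      simp only [Pi.add_apply, Pi.mul_apply]
      congr 1
      ring
  simp only [hGt] at hD
  have hlim' : ∀ᵐ p : ℝ × Ed d,
      Tendsto (fun n => ψ n p) atTop (𝓝 (truncPow k 2 (v p.1 p.2) * β p)) := by
    filter_upwards [hlim] with p hp
    rwa [congrFun hΦ p] at hp
  have hΦm : Measurable fun p : ℝ × Ed d => truncPow k 2 (v p.1 p.2) * β p :=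
    ((continuous_truncPow k 2).measurable.comp hC.meas).mul hβ.continuous.measurable
  have hψ1 : ∀ n, ContDiff ℝ 1 (ψ n) := fun n => (hψ n).of_le (by simp)
  have hψc : ∀ n, HasCompactSupport (ψ n) := fun n =>
    HasCompactSupport.intro hSc fun p hp => hψS n p hp
  have hψt : ∀ n, tsupport (ψ n) ⊆ cthickening ε (tsupport β) := fun n =>
    closure_minimal (fun p hp => by_contra fun h => hp (hψS n p h)) isClosed_cthickening
  have hfψ : ∀ n p, p ∉ cthickening ε (tsupport β) → ∀ a, fderiv ℝ (ψ n) p a = 0 := fun n p hp a =>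
    image_eq_zero_of_notMem_tsupport (f := fun p => fderiv ℝ (ψ n) p a) fun h =>
      hp (hψt n (tsupport_fderiv_apply_subset' _ h))
  have hdψ : ∀ n i, MemLp (fun p => fderiv ℝ (ψ n) p (spaceDir d i)) 2 := fun n i =>
    (((hψ1 n).continuous_fderiv one_ne_zero).clm_apply continuous_const).memLp_of_hasCompactSupport
      ((hψc n).fderiv_apply (𝕜 := ℝ) _)
  have hshift : ∀ h : Ed d, eLpNorm (fun p => u (p + (0, h)) - u p) 2 ≤
      ‖h‖ₑ * ∑ i, eLpNorm (cutGrad ζ v Dv i) 2 := by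
    intro h
    refine eLpNorm_space_shift_le (f := u) (fn := fun n => moll n u)
      (G := fun i => cutGrad ζ v Dv i)
      (fun n => (moll_contDiff n hul).of_le (by simp)) (moll_tendsto_ae hul) hGL (fun i => ?_) h
    have e : ∀ n, (fun p => fderiv ℝ (moll n u) p (spaceDir d i)) = moll n (cutGrad ζ v Dv i) :=
      fun n => funext fun p => fderiv_moll n hul (hGw i) p
    simp only [e]
    exact moll_tendsto_eLpNorm (hGL i)
  obtain ⟨hJ1, hJ2, hJ3⟩ := hC.tendsto_integral_jumpForm hum
    (ENNReal.sum_ne_top.2 fun i _ => (hGL i).2.ne) hshift hε0 hε1 hSc hSC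
    (V := cthickening (2 * ε) (tsupport β)) (fun p hp y hy => by
      rw [mem_cthickening_iff] at hp ⊢
      have h1 := infEDist_le_infEDist_add_edist (s := tsupport β) (x := (p.1, y)) (y := p)
      have h2 : edist (p.1, y) p ≤ ENNReal.ofReal ε := by
        rw [edist_dist]
        refine ENNReal.ofReal_le_ofReal ?_
        rw [Prod.dist_eq, dist_self, dist_comm, dist_eq_norm]
        exact max_le hε0.le hy.le
      refine h1.trans ((add_le_add hp h2).trans ?_)
      rw [← ENNReal.ofReal_add hε0.le hε0.le, two_mul]) huv hψ hΦm hψS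
    (fun p hp => by simp [hβS p hp]) (M := M) (fun n p => by rw [abs_of_nonneg (hψ0 n p)]; exact hM n p)
    hlim' hgL hD
  have hAL := hC.memLp_vectorField
  have hAe : ∀ (g : Fin d → ℝ × Ed d → ℝ), (∀ i p, p ∉ cthickening ε (tsupport β) → g i p = 0) →
      ∀ p : ℝ × Ed d, ∑ i, A p.1 p.2 (Dv p.1 p.2) i * g i p =
        ∑ i, (pCyl t₀ x₀ (2 * R)).indicator (fun p => A p.1 p.2 (Dv p.1 p.2) i) p * g i p := by
    intro g hg p
    refine Finset.sum_congr rfl fun i _ => ?_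
    by_cases hp : p ∈ cthickening ε (tsupport β)
    · rw [indicator_of_mem (hSC hp)]
    · simp [hg i p hp]
  have hgS : ∀ i p, p ∉ cthickening ε (tsupport β) → gradTest k v Dv β i p = 0 := by
    intro i p hp
    have h : p ∉ tsupport β := fun h => hp (self_subset_cthickening _ h)
    simp [gradTest, hfβ p h, image_eq_zero_of_notMem_tsupport h]
  refine ⟨hJ2, ?_, ?_⟩
  · simp only [hAe _ hgS]
    exact integrable_finsetSum _ fun i _ => (hAL i).integrable_mul (hgL i)
  have hA3 : Tendsto (fun n => ∫ p : ℝ × Ed d, ∑ i, A p.1 p.2 (Dv p.1 p.2) i *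
      fderiv ℝ (ψ n) p (spaceDir d i)) atTop
      (𝓝 (∫ p : ℝ × Ed d, ∑ i, A p.1 p.2 (Dv p.1 p.2) i * gradTest k v Dv β i p)) := by
    have e1 : ∀ g : Fin d → ℝ × Ed d → ℝ, (∀ i p, p ∉ cthickening ε (tsupport β) → g i p = 0) →
        (∀ i, MemLp (g i) 2) → ∫ p : ℝ × Ed d, ∑ i, A p.1 p.2 (Dv p.1 p.2) i * g i p =
          ∑ i, ∫ p, (pCyl t₀ x₀ (2 * R)).indicator (fun p => A p.1 p.2 (Dv p.1 p.2) i) p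
            * g i p := by
      intro g hg hgL
      rw [integral_congr_ae (ae_of_all _ (hAe g hg))]
      exact integral_finsetSum _ fun i _ => (hAL i).integrable_mul (hgL i)
    rw [e1 _ hgS hgL]
    refine (tendsto_finsetSum _ fun i _ =>
      tendsto_integral_mul_of_eLpNorm (hAL i) (fun n => hdψ n i) (hgL i) (hD i)).congr fun n => ?_
    exact (e1 (fun i p => fderiv ℝ (ψ n) p (spaceDir d i)) (fun i p hp => hfψ n p hp _)
      (hdψ n)).symm
  have hTn : Tendsto (fun n => -∫ p : ℝ × Ed d, v p.1 p.2 * fderiv ℝ (ψ n) p (1, 0)) atTop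
      (𝓝 (∫ p : ℝ × Ed d, (truncPow k 3 (v p.1 p.2) / 3) * fderiv ℝ β p (1, 0))) := by
    have h := (hT (1, 0)).neg
    rw [neg_neg, hTt] at h
    refine h.congr fun n => ?_
    congr 2
    ext p
    by_cases hp : p ∈ cthickening ε (tsupport β)
    · rw [huv p (hsub hp)]
    · simp [hfψ n p hp]
  exact ge_of_tendsto ((hTn.add hA3).add hJ3) (Eventually.of_forall fun n =>
    hC.super (ψ n) (hψ n) (hψ0 n) (hψc n) ((hψt n).trans hSC) (hJ1 n))

end Truncated

lemma sub_mul_sub_le_min {a b p q : ℝ} (ha : 0 ≤ a) (hb : 0 ≤ b) (hp : 0 ≤ p) (hq : 0 ≤ q)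
    (hab : b ≤ a) :
    (a - b) * (b ^ 2 * q ^ 2 - a ^ 2 * p ^ 2) ≤ 4 * (a * b * b) * (q - p) ^ 2 := by
  obtain ⟨X, rfl⟩ : ∃ X, a = b + X := ⟨a - b, by ring⟩
  have hX0 : 0 ≤ X := by linarith
  have hbX : 0 ≤ b * b * X := by positivity
  rw [add_sub_cancel_left]
  rcases le_total (2 * p) q with h | h
  · have h1 : q ^ 2 ≤ 4 * (q - p) ^ 2 := by nlinarith
    have h2 : (b * b * X) * q ^ 2 ≤ (b * b * X) * (4 * (q - p) ^ 2) :=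
      mul_le_mul_of_nonneg_left h1 hbX
    have h3 : 0 ≤ X * ((b + X) ^ 2 * p ^ 2) := by positivity
    have h4 : 0 ≤ b * b * b * (q - p) ^ 2 := by positivity
    nlinarith
  · by_cases hqp : q ≤ p
    · have h1 : b ^ 2 * q ^ 2 ≤ (b + X) ^ 2 * p ^ 2 := by
        gcongr
      have h2 : X * (b ^ 2 * q ^ 2 - (b + X) ^ 2 * p ^ 2) ≤ 0 :=
        mul_nonpos_of_nonneg_of_nonpos hX0 (by linarith)
      have h3 : 0 ≤ 4 * ((b + X) * b * b) * (q - p) ^ 2 := by positivity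
      linarith
    · push Not at hqp
      have h1 : q ^ 2 - p ^ 2 ≤ 3 * (q - p) * p := by nlinarith
      have h2 : (b * b * X) * (q ^ 2 - p ^ 2) ≤ (b * b * X) * (3 * (q - p) * p) :=
        mul_le_mul_of_nonneg_left h1 hbX
      have h3 : 0 ≤ X ^ 3 * p ^ 2 := by positivity
      have h4 : 0 ≤ b * b * X * (q - p) ^ 2 := by positivity
      have h5 : 0 ≤ b * (2 * (X * p) - (3 / 2) * (b * (q - p))) ^ 2 := by positivity
      have h6 : 0 ≤ b * b * b * (q - p) ^ 2 := by positivity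
      nlinarith

lemma sub_mul_sub_le {a b p q : ℝ} (ha : 0 ≤ a) (hb : 0 ≤ b) (hp : 0 ≤ p) (hq : 0 ≤ q) :
    (a - b) * (b ^ 2 * q ^ 2 - a ^ 2 * p ^ 2) ≤ 4 * (a * b * min a b) * (q - p) ^ 2 := by
  rcases le_total b a with h | h
  · rw [min_eq_right h]
    exact sub_mul_sub_le_min ha hb hp hq h
  · rw [min_eq_left h]
    have := sub_mul_sub_le_min hb ha hq hp h
    nlinarith

/-- One half of the pointwise majorant of the jump form tested with `(k - v)₊² η²`. -/
def jumpMaj (k x y p q : ℝ) : ℝ :=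
  if x < k ∧ p ≠ 0 then 4 * k ^ 2 * (k + max (-y) 0) * (p - q) ^ 2 else 0

lemma jumpMaj_nonneg {k : ℝ} (hk : 0 ≤ k) (x y p q : ℝ) : 0 ≤ jumpMaj k x y p q := by
  unfold jumpMaj
  split_ifs
  · have := le_max_right (-y) 0
    positivity
  · exact le_rfl

lemma max_sub_zero_le (k y : ℝ) : max (k - y) 0 ≤ |k| + max (-y) 0 := by
  have h1 := le_max_left (-y) 0
  have h2 := le_max_right (-y) 0
  have h3 := le_abs_self k
  have h4 := abs_nonneg k
  exact max_le (by linarith) (by linarith)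

lemma min_mul_le_jumpMaj {k x y p q : ℝ} (hk : 0 ≤ k) (hx : p ≠ 0 → 0 ≤ x) (hp : p ≠ 0) :
    4 * (max (k - x) 0 * max (k - y) 0 * min (max (k - x) 0) (max (k - y) 0)) * (q - p) ^ 2
      ≤ jumpMaj k x y p q := by
  have h0 := hx hp
  by_cases h : x < k
  · rw [jumpMaj, if_pos ⟨h, hp⟩]
    have ha : max (k - x) 0 ≤ k := max_le (by linarith) hk
    have hb : max (k - y) 0 ≤ k + max (-y) 0 := by simpa [abs_of_nonneg hk] using max_sub_zero_le k y
    have h1 := le_max_right (k - x) 0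
    have h2 := le_max_right (k - y) 0
    have hm : min (max (k - x) 0) (max (k - y) 0) ≤ k := (min_le_left _ _).trans ha
    have hm0 : 0 ≤ min (max (k - x) 0) (max (k - y) 0) := le_min h1 h2
    calc _ ≤ 4 * (k * (k + max (-y) 0) * k) * (q - p) ^ 2 := by gcongr
      _ = _ := by ring
  · have : max (k - x) 0 = 0 := max_eq_right (by linarith [not_lt.1 h])
    rw [this]
    simpa using jumpMaj_nonneg hk x y p q

lemma sub_mul_truncPow_sub_le {k x y p q : ℝ} (hk : 0 ≤ k) (hp : 0 ≤ p) (hq : 0 ≤ q)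
    (hx : p ≠ 0 → 0 ≤ x) (hy : q ≠ 0 → 0 ≤ y) :
    (x - y) * (truncPow k 2 x * p ^ 2 - truncPow k 2 y * q ^ 2)
      ≤ jumpMaj k x y p q + jumpMaj k y x q p := by
  unfold truncPow
  have hxe : x = k - max (k - x) 0 + max (x - k) 0 := by
    rcases le_total x k with h | h
    · rw [max_eq_left (by linarith), max_eq_right (a := x - k) (by linarith)]; ring
    · rw [max_eq_right (by linarith), max_eq_left (a := x - k) (by linarith)]; ring
  have hye : y = k - max (k - y) 0 + max (y - k) 0 := by
    rcases le_total y k with h | h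
    · rw [max_eq_left (by linarith), max_eq_right (a := y - k) (by linarith)]; ring
    · rw [max_eq_right (by linarith), max_eq_left (a := y - k) (by linarith)]; ring
  have hx0 : max (k - x) 0 * max (x - k) 0 = 0 := by
    rcases le_total x k with h | h
    · rw [max_eq_right (a := x - k) (by linarith)]; ring
    · rw [max_eq_right (a := k - x) (by linarith)]; ring
  have hy0 : max (k - y) 0 * max (y - k) 0 = 0 := by
    rcases le_total y k with h | h
    · rw [max_eq_right (a := y - k) (by linarith)]; ring
    · rw [max_eq_right (a := k - y) (by linarith)]; ring
  have key : 4 * (max (k - x) 0 * max (k - y) 0 * min (max (k - x) 0) (max (k - y) 0))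
      * (q - p) ^ 2 ≤ jumpMaj k x y p q + jumpMaj k y x q p := by
    by_cases h : p = 0
    · by_cases h' : q = 0
      · subst h h'
        simpa using add_nonneg (jumpMaj_nonneg hk x y 0 0) (jumpMaj_nonneg hk y x 0 0)
      · have h1 := min_mul_le_jumpMaj (x := y) (y := x) (p := q) (q := p) hk hy h'
        rw [min_comm, mul_comm (max (k - x) 0)]
        have h2 := jumpMaj_nonneg hk x y p q
        nlinarith
    · exact (min_mul_le_jumpMaj hk hx h).trans (le_add_of_nonneg_right (jumpMaj_nonneg hk _ _ _ _))
  refine le_trans ?_ key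
  have hm := sub_mul_sub_le (le_max_right (k - x) 0) (le_max_right (k - y) 0) hp hq
  refine le_trans ?_ hm
  have hPx := le_max_right (x - k) 0
  have hPy := le_max_right (y - k) 0
  set a := max (k - x) 0
  set b := max (k - y) 0
  set P := max (x - k) 0
  set Q := max (y - k) 0
  have e : (x - y) * (a ^ 2 * p ^ 2 - b ^ 2 * q ^ 2) = (a - b) * (b ^ 2 * q ^ 2 - a ^ 2 * p ^ 2)
      - P * (b ^ 2 * q ^ 2) - Q * (a ^ 2 * p ^ 2) + (a * P) * (a * p ^ 2)
      + (b * Q) * (b * q ^ 2) := by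
    rw [hxe, hye]; ring
  rw [e, hx0, hy0]
  have h1 : 0 ≤ P * (b ^ 2 * q ^ 2) := by positivity
  have h2 : 0 ≤ Q * (a ^ 2 * p ^ 2) := by positivity
  linarith

/-- The tail mass of the negative part of `v(t)` outside the ball of radius `2R`. -/
def negTail (s : ℝ) (v : ℝ → Ed d → ℝ) (x₀ : Ed d) (R t : ℝ) : ℝ≥0∞ :=
  ∫⁻ y in (ball x₀ (2 * R))ᶜ, ENNReal.ofReal (max (-v t y) 0) * jumpKer s (x₀ - y)

/-- The measure of the sublevel set `{v(t) < k}` in the ball of radius `r`. -/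
def subVol (v : ℝ → Ed d → ℝ) (x₀ : Ed d) (k r t : ℝ) : ℝ≥0∞ :=
  volume {x | x ∈ ball x₀ r ∧ v t x < k}

section Energy

variable {s Λ : ℝ} {A : ℝ → Ed d → Ed d → Ed d} {K : ℝ → Ed d → Ed d → ℝ} {v : ℝ → Ed d → ℝ}
  {Dv : ℝ → Ed d → Ed d} {t₀ : ℝ} {x₀ : Ed d} {R : ℝ}

lemma measurable_negTail (hv : Measurable (Function.uncurry v)) :
    Measurable (negTail s v x₀ R) := by
  have h1 : Measurable fun z : ℝ × Ed d => ENNReal.ofReal (max (-v z.1 z.2) 0)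
      * jumpKer s (x₀ - z.2) := by
    have : Measurable fun z : ℝ × Ed d => v z.1 z.2 := hv
    have h2 : Measurable fun z : ℝ × Ed d => jumpKer s (x₀ - z.2) :=
      (measurable_jumpKer s).comp (by fun_prop)
    exact (this.neg.max measurable_const).ennreal_ofReal.mul h2
  exact h1.lintegral_prod_right'

lemma measurable_subVol (hv : Measurable (Function.uncurry v)) (k r : ℝ) :
    Measurable (subVol v x₀ k r) := by
  have h : MeasurableSet {p : ℝ × Ed d | p.2 ∈ ball x₀ r ∧ v p.1 p.2 < k} :=
    (measurable_snd measurableSet_ball).inter (measurableSet_lt hv measurable_const)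
  exact measurable_measure_prodMk_left h

lemma subVol_le (k r t : ℝ) : subVol v x₀ k r t ≤ volume (ball x₀ r) :=
  measure_mono fun _ h => h.1

lemma subVol_mono {k k' r r' : ℝ} (hk : k ≤ k') (hr : r ≤ r') (t : ℝ) :
    subVol v x₀ k r t ≤ subVol v x₀ k' r' t :=
  measure_mono fun _ h => ⟨ball_subset_ball hr h.1, h.2.trans_le hk⟩

lemma jumpKer_le_of_mem {s : ℝ} (hs : 0 < s) (hR : 0 < R) {x y : Ed d} (hx : x ∈ ball x₀ R)
    (hy : y ∉ ball x₀ (2 * R)) :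
    jumpKer s (x - y) ≤ ENNReal.ofReal (2 ^ ((d : ℝ) + 2 * s)) * jumpKer s (x₀ - y) := by
  have hx' : ‖x - x₀‖ < R := mem_ball_iff_norm.1 hx
  have hy' : 2 * R ≤ ‖x₀ - y‖ := by
    rw [norm_sub_rev]
    exact not_lt.1 fun h => hy (mem_ball_iff_norm.2 h)
  have h1 : ‖x₀ - y‖ ≤ ‖x - y‖ + ‖x - x₀‖ := by
    have := norm_sub_le (x - y) (x - x₀)
    rwa [sub_sub_sub_cancel_left] at this
  have h2 : ‖x₀ - y‖ ≤ 2 * ‖x - y‖ := by linarith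
  have h3 : 0 < ‖x₀ - y‖ := by linarith
  have hα : 0 ≤ (d : ℝ) + 2 * s := by positivity
  unfold jumpKer
  rw [← ENNReal.ofReal_mul (by positivity)]
  refine ENNReal.ofReal_le_ofReal ?_
  rw [mul_one_div, le_div_iff₀ (by positivity), one_div, inv_mul_le_iff₀ (by
    have : 0 < ‖x - y‖ := by linarith
    positivity), mul_comm (_ ^ _), ← Real.mul_rpow (by norm_num) (norm_nonneg _)]
  exact Real.rpow_le_rpow h3.le h2 hα

lemma lintegral_jumpMaj_le (hK : KernelHyp d s Λ K) (hΛ : 1 ≤ Λ) (hd : 2 ≤ d)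
    (hs : s ∈ Ioo (0 : ℝ) 1) (hR : 0 < R) {t k L : ℝ} (hk : 0 ≤ k) (hL : 1 ≤ L)
    (hLR : 1 ≤ L * R) {η : Ed d → ℝ} (hη01 : ∀ x, η x ∈ Icc (0 : ℝ) 1)
    (hηL : ∀ x y, |η x - η y| ≤ L * ‖x - y‖) {r : ℝ} (hr : r ≤ R)
    (hηs : ∀ x, x ∉ ball x₀ r → η x = 0)
    (hnn : ∀ᵐ y, y ∈ ball x₀ (2 * R) → 0 ≤ v t y) (x : Ed d) :
    ∫⁻ y, ENNReal.ofReal (jumpMaj k (v t x) (v t y) (η x) (η y) * K t x y) ≤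
      ({x | x ∈ ball x₀ r ∧ v t x < k}.indicator (fun _ => ENNReal.ofReal (4 * k ^ 2 * Λ * L ^ 2) *
        (levyConst d s * ENNReal.ofReal k
          + ENNReal.ofReal (2 ^ ((d : ℝ) + 2 * s) * R ^ 2) * negTail s v x₀ R t)) x) := by
  by_cases hx : v t x < k ∧ η x ≠ 0
  swap
  · simp only [jumpMaj, if_neg hx, zero_mul, ENNReal.ofReal_zero, lintegral_zero]
    exact bot_le
  have hxr : x ∈ ball x₀ r := by_contra fun h => hx.2 (hηs x h)
  rw [indicator_of_mem (show x ∈ {x | x ∈ ball x₀ r ∧ v t x < k} from ⟨hxr, hx.1⟩)]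
  simp only [jumpMaj, if_pos hx]
  have hd1 : ∀ y, (η x - η y) ^ 2 ≤ 1 := fun y => by
    obtain ⟨h1, h2⟩ := hη01 x
    obtain ⟨h3, h4⟩ := hη01 y
    nlinarith
  have hd2 : ∀ y, (η x - η y) ^ 2 ≤ L ^ 2 * min 1 (‖x - y‖ ^ 2) := fun y => by
    rw [mul_min_of_nonneg _ _ (by positivity), mul_one]
    refine le_min ((hd1 y).trans (one_le_pow₀ hL)) ?_
    rw [← mul_pow, ← sq_abs]
    exact pow_le_pow_left₀ (abs_nonneg _) (hηL x y) 2
  have hd3 : ∀ y, (η x - η y) ^ 2 ≤ L ^ 2 * R ^ 2 := fun y => by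
    rw [← mul_pow]
    exact (hd1 y).trans (one_le_pow₀ hLR)
  have hae : ∀ᵐ y : Ed d, y ≠ x := by
    have : Nontrivial (Ed d) := by
      have : Nonempty (Fin d) := ⟨⟨0, by omega⟩⟩
      infer_instance
    exact Measure.ae_ne volume x
  have hpt : ∀ᵐ y, ENNReal.ofReal (4 * k ^ 2 * (k + max (-v t y) 0) * (η x - η y) ^ 2 * K t x y)
      ≤ ENNReal.ofReal (4 * k ^ 2 * Λ * L ^ 2) * (ENNReal.ofReal k *
          (ENNReal.ofReal (min 1 (‖x - y‖ ^ 2)) * jumpKer s (x - y))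
        + ENNReal.ofReal (2 ^ ((d : ℝ) + 2 * s) * R ^ 2) *
          (ball x₀ (2 * R))ᶜ.indicator
            (fun y => ENNReal.ofReal (max (-v t y) 0) * jumpKer s (x₀ - y)) y) := by
    filter_upwards [hae, hnn] with y hy hy0
    have hm := le_max_right (-v t y) 0
    have hKe : ENNReal.ofReal (K t x y) ≤ ENNReal.ofReal Λ * jumpKer s (x - y) := by
      rw [← Real.enorm_of_nonneg (hK.nonneg hΛ t hy.symm)]
      exact hK.enorm_le hΛ t hy.symm
    have e1 : 4 * k ^ 2 * (k + max (-v t y) 0) * (η x - η y) ^ 2 * K t x y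
        = 4 * k ^ 2 * ((k * (η x - η y) ^ 2 + max (-v t y) 0 * (η x - η y) ^ 2) * K t x y) := by
      ring
    have hL0 : 0 ≤ L := by linarith
    have hΛ0 : 0 ≤ Λ := by linarith
    rw [e1, ENNReal.ofReal_mul (p := 4 * k ^ 2) (by positivity),
      ENNReal.ofReal_mul (p := k * (η x - η y) ^ 2 + _) (by positivity),
      ENNReal.ofReal_add (by positivity) (by positivity)]
    have h1 : ENNReal.ofReal (k * (η x - η y) ^ 2) ≤
        ENNReal.ofReal (L ^ 2) * (ENNReal.ofReal k * ENNReal.ofReal (min 1 (‖x - y‖ ^ 2))) := by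
      rw [← ENNReal.ofReal_mul hk, ← ENNReal.ofReal_mul (by positivity)]
      refine ENNReal.ofReal_le_ofReal ?_
      nlinarith [mul_le_mul_of_nonneg_left (hd2 y) hk]
    have h2 : ENNReal.ofReal (max (-v t y) 0 * (η x - η y) ^ 2) * jumpKer s (x - y) ≤
        ENNReal.ofReal (L ^ 2) * (ENNReal.ofReal (2 ^ ((d : ℝ) + 2 * s) * R ^ 2) *
          (ball x₀ (2 * R))ᶜ.indicator
            (fun y => ENNReal.ofReal (max (-v t y) 0) * jumpKer s (x₀ - y)) y) := by
      by_cases hyb : y ∈ ball x₀ (2 * R)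
      · have : max (-v t y) 0 = 0 := max_eq_right (by linarith [hy0 hyb])
        simp [this]
      · rw [indicator_of_mem (show y ∈ (ball x₀ (2 * R))ᶜ from hyb)]
        have h3 := jumpKer_le_of_mem (s := s) hs.1 hR (ball_subset_ball hr hxr) hyb
        calc ENNReal.ofReal (max (-v t y) 0 * (η x - η y) ^ 2) * jumpKer s (x - y)
            ≤ ENNReal.ofReal (max (-v t y) 0 * (L ^ 2 * R ^ 2)) *
              (ENNReal.ofReal (2 ^ ((d : ℝ) + 2 * s)) * jumpKer s (x₀ - y)) := by
              gcongr
              exact hd3 y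
          _ = _ := by
              rw [ENNReal.ofReal_mul hm, ENNReal.ofReal_mul (by positivity),
                ENNReal.ofReal_mul (p := 2 ^ ((d : ℝ) + 2 * s)) (by positivity)]
              ring
    calc _ ≤ ENNReal.ofReal (4 * k ^ 2) * ((ENNReal.ofReal (k * (η x - η y) ^ 2)
          + ENNReal.ofReal (max (-v t y) 0 * (η x - η y) ^ 2))
            * (ENNReal.ofReal Λ * jumpKer s (x - y))) := by gcongr
      _ = ENNReal.ofReal (4 * k ^ 2) * (ENNReal.ofReal Λ * (ENNReal.ofReal (k * (η x - η y) ^ 2)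
            * jumpKer s (x - y) + ENNReal.ofReal (max (-v t y) 0 * (η x - η y) ^ 2)
            * jumpKer s (x - y))) := by ring
      _ ≤ ENNReal.ofReal (4 * k ^ 2) * (ENNReal.ofReal Λ * (ENNReal.ofReal (L ^ 2) *
            (ENNReal.ofReal k * ENNReal.ofReal (min 1 (‖x - y‖ ^ 2)))
            * jumpKer s (x - y) + ENNReal.ofReal (L ^ 2) *
            (ENNReal.ofReal (2 ^ ((d : ℝ) + 2 * s) * R ^ 2) * (ball x₀ (2 * R))ᶜ.indicator
            (fun y => ENNReal.ofReal (max (-v t y) 0) * jumpKer s (x₀ - y)) y))) := by gcongr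
      _ = _ := by
        rw [ENNReal.ofReal_mul (p := 4 * k ^ 2 * Λ) (by positivity),
          ENNReal.ofReal_mul (p := 4 * k ^ 2) (by positivity)]
        ring
  refine (lintegral_mono_ae hpt).trans (le_of_eq ?_)
  have hm1 : Measurable fun y : Ed d =>
      ENNReal.ofReal (min 1 (‖x - y‖ ^ 2)) * jumpKer s (x - y) :=
    (by fun_prop : Measurable fun y : Ed d => min 1 (‖x - y‖ ^ 2)).ennreal_ofReal.mul
      ((measurable_jumpKer s).comp (by fun_prop))
  rw [lintegral_const_mul' _ _ ENNReal.ofReal_ne_top, lintegral_add_left (hm1.const_mul _),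
    lintegral_const_mul' _ _ ENNReal.ofReal_ne_top, lintegral_const_mul' _ _ ENNReal.ofReal_ne_top,
    lintegral_indicator measurableSet_ball.compl]
  congr 2
  rw [mul_comm, levyConst]
  congr 1
  exact lintegral_sub_left_eq_self (μ := (volume : Measure (Ed d)))
    (fun h => ENNReal.ofReal (min 1 (‖h‖ ^ 2)) * jumpKer s h) x

end Energy

section EnergyJump

variable {s Λ : ℝ} {A : ℝ → Ed d → Ed d → Ed d} {K : ℝ → Ed d → Ed d → ℝ} {v : ℝ → Ed d → ℝ}
  {Dv : ℝ → Ed d → Ed d} {t₀ : ℝ} {x₀ : Ed d} {R : ℝ}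

/-- The density in time of the right-hand side of the energy estimate at level `k`. -/
def jumpDensity (s Λ : ℝ) (v : ℝ → Ed d → ℝ) (x₀ : Ed d) (R k r L t : ℝ) : ℝ≥0∞ :=
  ENNReal.ofReal (8 * k ^ 2 * Λ * L ^ 2) * subVol v x₀ k r t * (levyConst d s * ENNReal.ofReal k
    + ENNReal.ofReal (2 ^ ((d : ℝ) + 2 * s) * R ^ 2) * negTail s v x₀ R t)

lemma CylSuper.ae_nonneg_slice (hC : CylSuper s Λ A K v Dv t₀ x₀ R) :
    ∀ᵐ t : ℝ, t ∈ Iminus t₀ (2 * R) → ∀ᵐ y : Ed d, y ∈ ball x₀ (2 * R) → 0 ≤ v t y := by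
  have h := hC.nonneg
  rw [Measure.volume_eq_prod] at h
  filter_upwards [Measure.ae_ae_of_ae_prod h] with t ht ht'
  filter_upwards [ht] with y hy hy'
  exact hy ⟨ht', hy'⟩

lemma measurable_jumpMaj (k : ℝ) : Measurable fun z : (ℝ × ℝ) × ℝ × ℝ =>
    jumpMaj k z.1.1 z.1.2 z.2.1 z.2.2 := by
  unfold jumpMaj
  refine Measurable.ite ?_ (by fun_prop) measurable_const
  have h1 : Measurable fun z : (ℝ × ℝ) × ℝ × ℝ => z.1.1 := by fun_prop
  exact (measurableSet_lt h1 measurable_const).inter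
    ((by fun_prop : Measurable fun z : (ℝ × ℝ) × ℝ × ℝ => z.2.1) (measurableSet_singleton 0)).compl

lemma CylSuper.lintegral_jumpForm_truncPow_le (hC : CylSuper s Λ A K v Dv t₀ x₀ R) {k L r : ℝ}
    (hk : 0 ≤ k) (hL : 1 ≤ L) (hLR : 1 ≤ L * R) (hr : r ≤ R) {η : Ed d → ℝ} (hηm : Measurable η)
    (hη01 : ∀ x, η x ∈ Icc (0 : ℝ) 1) (hηL : ∀ x y, |η x - η y| ≤ L * ‖x - y‖)
    (hηs : ∀ x, x ∉ ball x₀ r → η x = 0) {χ : ℝ → ℝ} (hχm : Measurable χ) (hχ0 : ∀ t, 0 ≤ χ t)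
    (hχs : ∀ t, t ∉ Iminus t₀ (2 * R) → χ t = 0) :
    ∫⁻ z, ENNReal.ofReal (jumpForm K v
      (fun p => truncPow k 2 (v p.1 p.2) * (χ p.1 * η p.2 ^ 2)) z) ≤
      ∫⁻ t, ENNReal.ofReal (χ t) * jumpDensity s Λ v x₀ R k r L t := by
  have hd := hC.two_le
  have hR0 : 0 < R := hC.R_mem.1
  have hvm := hC.meas
  have hv' : Measurable fun p : ℝ × Ed d => v p.1 p.2 := hvm
  set M : ℝ × Ed d → Ed d → ℝ≥0∞ := fun p y => ENNReal.ofReal (χ p.1) *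
    ENNReal.ofReal (jumpMaj k (v p.1 p.2) (v p.1 y) (η p.2) (η y) * K p.1 p.2 y) with hM
  have hMm : Measurable fun z : (ℝ × Ed d) × Ed d => M z.1 z.2 := by
    have h1 : Measurable fun z : (ℝ × Ed d) × Ed d => v z.1.1 z.1.2 := hvm.comp measurable_fst
    have h2 : Measurable fun z : (ℝ × Ed d) × Ed d => v z.1.1 z.2 :=
      hvm.comp (by fun_prop : Measurable fun z : (ℝ × Ed d) × Ed d => (z.1.1, z.2))
    have h3 : Measurable fun z : (ℝ × Ed d) × Ed d => η z.1.2 := hηm.comp (by fun_prop)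
    have h4 : Measurable fun z : (ℝ × Ed d) × Ed d => η z.2 := hηm.comp (by fun_prop)
    have h5 : Measurable fun z : (ℝ × Ed d) × Ed d => K z.1.1 z.1.2 z.2 :=
      hC.ker.meas.comp (by fun_prop : Measurable fun z : (ℝ × Ed d) × Ed d => (z.1.1, z.1.2, z.2))
    have h6 : Measurable fun z : (ℝ × Ed d) × Ed d => χ z.1.1 := hχm.comp (by fun_prop)
    exact h6.ennreal_ofReal.mul
      (((measurable_jumpMaj k).comp ((h1.prodMk h2).prodMk (h3.prodMk h4))).mul h5).ennreal_ofReal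
  have hae : ∀ x : Ed d, ∀ᵐ y : Ed d, y ≠ x := by
    have : Nontrivial (Ed d) := by
      have : Nonempty (Fin d) := ⟨⟨0, by omega⟩⟩
      infer_instance
    exact fun x => Measure.ae_ne volume x
  have hsl := hC.ae_nonneg_slice
  have hsl2 : ∀ᵐ p : ℝ × Ed d, p.1 ∈ Iminus t₀ (2 * R) →
      ∀ᵐ y : Ed d, y ∈ ball x₀ (2 * R) → 0 ≤ v p.1 y := by
    rw [Measure.volume_eq_prod]
    exact Measure.quasiMeasurePreserving_fst.ae hsl
  have hball : ∀ x, η x ≠ 0 → x ∈ ball x₀ (2 * R) := fun x hx =>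
    ball_subset_ball (by linarith) (by_contra fun h => hx (hηs x h))
  have step1 : ∫⁻ z, ENNReal.ofReal (jumpForm K v
      (fun p => truncPow k 2 (v p.1 p.2) * (χ p.1 * η p.2 ^ 2)) z) ≤
      ∫⁻ p : ℝ × Ed d, ∫⁻ y, (M p y + M (p.1, y) p.2) := by
    have hJm : Measurable (jumpForm K v
      (fun p => truncPow k 2 (v p.1 p.2) * (χ p.1 * η p.2 ^ 2))) := by
      refine measurable_jumpForm hC.ker hvm ?_
      exact ((continuous_truncPow k 2).measurable.comp hv').mul
        ((hχm.comp measurable_fst).mul ((hηm.comp measurable_snd).pow_const 2))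
    rw [Measure.volume_eq_prod, lintegral_prod _ hJm.ennreal_ofReal.aemeasurable]
    refine lintegral_mono_ae ?_
    filter_upwards [hC.nonneg, hsl2] with p hp1 hp2
    by_cases hpt : p.1 ∈ Iminus t₀ (2 * R)
    swap
    · simp [jumpForm, hχs _ hpt]
    refine lintegral_mono_ae ?_
    filter_upwards [hp2 hpt, hae p.2] with y hy hxy
    have hK0 : 0 ≤ K p.1 p.2 y := hC.ker.nonneg hC.one_le _ hxy.symm
    have hkey := sub_mul_truncPow_sub_le (k := k) hk (hη01 p.2).1 (hη01 y).1
      (fun h => hp1 ⟨hpt, hball _ h⟩) (fun h => hy (hball _ h))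
    simp only [hM]
    rw [← mul_add, hC.ker.symm p.1 y p.2,
      ← ENNReal.ofReal_add (mul_nonneg (jumpMaj_nonneg hk _ _ _ _) hK0)
        (mul_nonneg (jumpMaj_nonneg hk _ _ _ _) hK0), ← ENNReal.ofReal_mul (hχ0 _), ← add_mul]
    refine ENNReal.ofReal_le_ofReal ?_
    simp only [jumpForm]
    have h1 := mul_le_mul_of_nonneg_left hkey (mul_nonneg (hχ0 p.1) hK0)
    nlinarith
  refine step1.trans ?_
  rw [lintegral_add_swap_space hMm]
  set B : ℝ → Set (Ed d) := fun t => {x | x ∈ ball x₀ r ∧ v t x < k} with hB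
  set c : ℝ → ℝ≥0∞ := fun t => ENNReal.ofReal (4 * k ^ 2 * Λ * L ^ 2) *
        (levyConst d s * ENNReal.ofReal k
          + ENNReal.ofReal (2 ^ ((d : ℝ) + 2 * s) * R ^ 2) * negTail s v x₀ R t) with hc
  have step2 : ∫⁻ p : ℝ × Ed d, ∫⁻ y, M p y ≤
      ∫⁻ t, ENNReal.ofReal (χ t) * (c t * subVol v x₀ k r t) := by
    rw [Measure.volume_eq_prod, lintegral_prod _ hMm.lintegral_prod_right'.aemeasurable]
    refine lintegral_mono_ae ?_
    filter_upwards [hsl] with t ht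
    by_cases htI : t ∈ Iminus t₀ (2 * R)
    swap
    · simp [hM, hχs _ htI]
    have hBm : MeasurableSet (B t) := by
      have h1 : Measurable (v t) := hvm.comp measurable_prodMk_left
      exact measurableSet_ball.inter (measurableSet_lt h1 measurable_const)
    have h1 : ∀ x, ∫⁻ y, M (t, x) y ≤ ENNReal.ofReal (χ t) * (B t).indicator (fun _ => c t) x := by
      intro x
      simp only [hM]
      rw [lintegral_const_mul' _ _ ENNReal.ofReal_ne_top]
      gcongr
      exact lintegral_jumpMaj_le hC.ker hC.one_le hd hC.s_mem hR0 hk hL hLR hη01 hηL hr hηs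
        (ht htI) x
    refine (lintegral_mono h1).trans (le_of_eq ?_)
    rw [lintegral_const_mul' _ _ ENNReal.ofReal_ne_top, lintegral_indicator hBm,
      lintegral_const, Measure.restrict_apply_univ]
    rfl
  refine (mul_le_mul_right step2 2).trans (le_of_eq ?_)
  rw [← lintegral_const_mul' _ _ (by norm_num)]
  refine lintegral_congr fun t => ?_
  have h8 : ENNReal.ofReal (8 * k ^ 2 * Λ * L ^ 2) = 2 * ENNReal.ofReal (4 * k ^ 2 * Λ * L ^ 2) := by
    rw [show (2 : ℝ≥0∞) = ENNReal.ofReal 2 by simp, ← ENNReal.ofReal_mul (by norm_num)]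
    congr 1
    ring
  simp only [jumpDensity, hc, h8]
  ring

end EnergyJump

section EnergyLocal

variable {s Λ : ℝ} {A : ℝ → Ed d → Ed d → Ed d} {K : ℝ → Ed d → Ed d → ℝ} {v : ℝ → Ed d → ℝ}
  {Dv : ℝ → Ed d → Ed d} {t₀ : ℝ} {x₀ : Ed d} {R : ℝ}

lemma sum_mul_fderiv_space (a : Ed d) (f : ℝ × Ed d → ℝ) (p : ℝ × Ed d) :
    ∑ i, a i * fderiv ℝ f p (spaceDir d i) = fderiv ℝ f p (0, a) := by
  rw [spaceDir_sum, map_sum]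
  simp

lemma VectorFieldHyp.le_inner (hA : VectorFieldHyp d Λ A) (t : ℝ) (x ξ : Ed d) :
    Λ⁻¹ * ‖ξ‖ ^ 2 ≤ ⟪A t x ξ, ξ⟫ := by
  have h0 : A t x 0 = 0 := by
    have := hA.growth t x 0
    rw [norm_zero, mul_zero] at this
    exact norm_le_zero_iff.1 this
  simpa [h0] using hA.monotone t x 0 ξ

/-- Coercivity and Young's inequality for the local part of the energy estimate. -/
lemma VectorFieldHyp.sum_mul_gradTest_le (hA : VectorFieldHyp d Λ A) (hΛ : 1 ≤ Λ) {χ : ℝ → ℝ}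
    (hχ : ContDiff ℝ (⊤ : ℕ∞) χ) (hχ0 : ∀ t, 0 ≤ χ t) {η : Ed d → ℝ}
    (hη : ContDiff ℝ (⊤ : ℕ∞) η) {L : ℝ} (hL : 0 ≤ L)
    (hηL : ∀ x y, |η x - η y| ≤ L * ‖x - y‖) (k : ℝ) (p : ℝ × Ed d) :
    ∑ i, A p.1 p.2 (Dv p.1 p.2) i * gradTest k v Dv (fun p => χ p.1 * η p.2 ^ 2) i p ≤
      -(χ p.1 * (Λ⁻¹ * truncPow k 1 (v p.1 p.2) * η p.2 ^ 2 * ‖Dv p.1 p.2‖ ^ 2))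
        + χ p.1 * (Λ ^ 3 * L ^ 2 * truncPow k 3 (v p.1 p.2)) := by
  obtain ⟨t, x⟩ := p
  simp only
  set ξ := Dv t x with hξ
  set a := A t x ξ with ha
  have hβ : ContDiff ℝ 1 fun p : ℝ × Ed d => χ p.1 * η p.2 ^ 2 :=
    ((hχ.comp contDiff_fst).mul ((hη.comp contDiff_snd).pow 2)).of_le (by simp)
  have hη1 : Differentiable ℝ η := hη.differentiable (by simp)
  have e1 : fderiv ℝ (fun p : ℝ × Ed d => χ p.1 * η p.2 ^ 2) (t, x) (0, a)
      = χ t * (2 * η x * fderiv ℝ η x a) := by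
    rw [← fderiv_space_slice hβ]
    simp only
    have h : HasFDerivAt (fun y : Ed d => χ t * (η y * η y))
        (χ t • (η x • fderiv ℝ η x + η x • fderiv ℝ η x)) x :=
      ((hη1 x).hasFDerivAt.mul (hη1 x).hasFDerivAt).const_mul (χ t)
    simp only [sq, h.fderiv, smul_apply, add_apply, smul_eq_mul]
    ring
  have e2 : ∑ i, a i * gradTest k v Dv (fun p => χ p.1 * η p.2 ^ 2) i (t, x) =
      -(2 * truncPow k 1 (v t x)) * (χ t * η x ^ 2) * ⟪a, ξ⟫
        + truncPow k 2 (v t x) * (χ t * (2 * η x * fderiv ℝ η x a)) := by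
    rw [← e1, ← sum_mul_fderiv_space, PiLp.inner_apply, Finset.mul_sum, Finset.mul_sum,
      ← Finset.sum_add_distrib]
    refine Finset.sum_congr rfl fun i _ => ?_
    simp only [gradTest, RCLike.inner_apply, conj_trivial, ← hξ]
    ring
  rw [e2]
  have h1 : Λ⁻¹ * ‖ξ‖ ^ 2 ≤ ⟪a, ξ⟫ := hA.le_inner t x ξ
  have h2 : ‖a‖ ≤ Λ * ‖ξ‖ := hA.growth t x ξ
  have h3 : ‖fderiv ℝ η x‖ ≤ L := by
    refine norm_fderiv_le_of_lip' ℝ hL (Eventually.of_forall fun y => ?_)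
    exact hηL y x
  have h4 : |fderiv ℝ η x a| ≤ L * (Λ * ‖ξ‖) := by
    refine ((fderiv ℝ η x).le_opNorm a).trans ?_
    gcongr
  have hχt := hχ0 t
  have hw : truncPow k 2 (v t x) = truncPow k 1 (v t x) ^ 2 := by simp [truncPow]
  have hw3 : truncPow k 3 (v t x) = truncPow k 1 (v t x) ^ 3 := by simp [truncPow]
  have hw0 := truncPow_nonneg k 1 (v t x)
  rw [hw, hw3]
  set w := truncPow k 1 (v t x)
  set n := ‖ξ‖
  set f := fderiv ℝ η x a
  set e := η x
  have h5 : 2 * (w * e * f) ≤ Λ⁻¹ * e ^ 2 * n ^ 2 + Λ ^ 3 * L ^ 2 * w ^ 2 := by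
    have h6 : w * e * f ≤ w * |e| * (L * (Λ * n)) := by
      calc w * e * f ≤ |w * e * f| := le_abs_self _
        _ = w * |e| * |f| := by rw [abs_mul, abs_mul, abs_of_nonneg hw0]
        _ ≤ _ := by gcongr
    have hΛ0 : 0 < Λ := by linarith
    have h7 : 0 ≤ Λ⁻¹ * (|e| * n - Λ ^ 2 * L * w) ^ 2 := by positivity
    have h8 : Λ⁻¹ * (|e| * n - Λ ^ 2 * L * w) ^ 2 =
        Λ⁻¹ * |e| ^ 2 * n ^ 2 + Λ ^ 3 * L ^ 2 * w ^ 2 - 2 * (w * |e| * (L * (Λ * n))) := by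
      field_simp
      ring
    rw [sq_abs] at h8
    linarith
  have h9 : χ t * w * (2 * (w * e * f)) ≤
      χ t * w * (Λ⁻¹ * e ^ 2 * n ^ 2 + Λ ^ 3 * L ^ 2 * w ^ 2) :=
    mul_le_mul_of_nonneg_left h5 (by positivity)
  have h10 : (2 * w * χ t * e ^ 2) * (Λ⁻¹ * n ^ 2) ≤ (2 * w * χ t * e ^ 2) * ⟪a, ξ⟫ :=
    mul_le_mul_of_nonneg_left h1 (by positivity)
  nlinarith

lemma CylSuper.exists_negTail_le (hC : CylSuper s Λ A K v Dv t₀ x₀ R) :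
    ∃ C : ℝ, ∀ t, negTail s v x₀ R t ≤ ENNReal.ofReal C * tailMass s v t := by
  obtain ⟨C, hC0, hCle⟩ := jumpKer_far_le (d := d) (κ := 2 * R) (M := ‖x₀‖) hC.s_mem.1
    (by have := hC.R_mem.1; linarith) (norm_nonneg _)
  refine ⟨C, fun t => ?_⟩
  unfold negTail tailMass
  rw [← lintegral_const_mul' _ _ ENNReal.ofReal_ne_top]
  refine (setLIntegral_mono' measurableSet_ball.compl fun y hy => ?_).trans
    (setLIntegral_le_lintegral _ _)
  have h1 : 2 * R ≤ ‖x₀ - y‖ := by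
    rw [norm_sub_rev]
    exact not_lt.1 fun h => hy (mem_ball_iff_norm.2 h)
  have h2 := hCle x₀ y le_rfl h1
  rw [jumpKer, ← ENNReal.ofReal_mul (le_max_right _ _), ← ENNReal.ofReal_mul hC0]
  refine ENNReal.ofReal_le_ofReal ?_
  have h3 : max (-v t y) 0 ≤ |v t y| := max_le (neg_le_abs _) (abs_nonneg _)
  calc max (-v t y) 0 * (1 / ‖x₀ - y‖ ^ ((d : ℝ) + 2 * s))
      ≤ |v t y| * (C * (1 / (1 + ‖y‖ ^ ((d : ℝ) + 2 * s)))) := by gcongr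
    _ = _ := by ring

lemma CylSuper.lintegral_negTail_sq_ne_top (hC : CylSuper s Λ A K v Dv t₀ x₀ R) :
    ∫⁻ t in Iminus t₀ (2 * R), negTail s v x₀ R t ^ 2 ≠ ∞ := by
  obtain ⟨C, h⟩ := hC.exists_negTail_le
  refine ne_top_of_le_ne_top (b := ENNReal.ofReal C ^ 2 *
    ∫⁻ t in Iminus t₀ (2 * R), tailMass s v t ^ 2) (ENNReal.mul_ne_top (by simp) hC.tail) ?_
  rw [← lintegral_const_mul' _ _ (by simp)]
  refine lintegral_mono fun t => ?_
  rw [← mul_pow]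
  exact pow_le_pow_left' (h t) 2

lemma CylSuper.lintegral_negTail_ne_top (hC : CylSuper s Λ A K v Dv t₀ x₀ R) :
    ∫⁻ t in Iminus t₀ (2 * R), negTail s v x₀ R t ≠ ∞ := by
  have h1 : ∫⁻ t in Iminus t₀ (2 * R), (1 + negTail s v x₀ R t ^ 2) ≠ ∞ := by
    rw [lintegral_add_left measurable_const, lintegral_const, Measure.restrict_apply_univ]
    exact ENNReal.add_ne_top.2 ⟨by simp [Iminus], hC.lintegral_negTail_sq_ne_top⟩
  refine ne_top_of_le_ne_top h1 (lintegral_mono fun t => ?_)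
  rcases le_total (negTail s v x₀ R t) 1 with h | h
  · exact h.trans le_self_add
  · refine le_trans ?_ le_add_self
    rw [sq]
    exact le_mul_of_one_le_left' h

end EnergyLocal

section Energy

variable {s Λ : ℝ} {A : ℝ → Ed d → Ed d → Ed d} {K : ℝ → Ed d → Ed d → ℝ} {v : ℝ → Ed d → ℝ}
  {Dv : ℝ → Ed d → Ed d} {t₀ : ℝ} {x₀ : Ed d} {R : ℝ}

lemma integral_fst_mul_eq {J : Set ℝ} {B : Set (Ed d)} {G : ℝ × Ed d → ℝ} (hG : IntegrableOn G (J ×ˢ B))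
    (hGB : ∀ p : ℝ × Ed d, p.2 ∉ B → G p = 0) :
    IntegrableOn (fun t => ∫ x, G (t, x)) J ∧
      ∀ c : ℝ → ℝ, Continuous c → (∃ M, ∀ t, |c t| ≤ M) → (∀ t, t ∉ J → c t = 0) →
        Integrable (fun p : ℝ × Ed d => c p.1 * G p) ∧
        ∫ p : ℝ × Ed d, c p.1 * G p = ∫ t in J, c t * ∫ x, G (t, x) := by
  have hprod : (volume : Measure (ℝ × Ed d)).restrict (J ×ˢ B) =
      (volume.restrict J).prod (volume.restrict B) := by
    rw [Measure.volume_eq_prod, Measure.prod_restrict]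
  have hsl : ∀ t, ∫ x in B, G (t, x) = ∫ x, G (t, x) := fun t =>
    setIntegral_eq_integral_of_forall_compl_eq_zero fun x hx => hGB (t, x) hx
  have hG' : Integrable G ((volume.restrict J).prod (volume.restrict B)) := hprod ▸ hG
  refine ⟨?_, fun c hc hcb hcJ => ?_⟩
  · have := hG'.integral_prod_left
    simp only [hsl] at this
    exact this
  · obtain ⟨M, hM⟩ := hcb
    have h0 : ∀ p, p ∉ J ×ˢ B → c p.1 * G p = 0 := by
      intro p hp
      by_cases h : p.1 ∈ J
      · rw [hGB p fun h' => hp ⟨h, h'⟩, mul_zero]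
      · rw [hcJ _ h, zero_mul]
    have h1 : IntegrableOn (fun p : ℝ × Ed d => c p.1 * G p) (J ×ˢ B) :=
      Integrable.bdd_mul (c := M) hG (hc.comp continuous_fst).aestronglyMeasurable
        (Eventually.of_forall fun p => hM p.1)
    refine ⟨(integrableOn_iff_integrable_of_support_subset fun p hp => by_contra fun h =>
      hp (h0 p h)).1 h1, ?_⟩
    rw [← setIntegral_eq_integral_of_forall_compl_eq_zero h0, hprod, integral_prod _ (hprod ▸ h1)]
    refine integral_congr_ae (Eventually.of_forall fun t => ?_)
    simp only
    rw [integral_const_mul, hsl]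

/-- The mass of the truncated function on a time slice. -/
def levelMass (v : ℝ → Ed d → ℝ) (k : ℝ) (η : Ed d → ℝ) (t : ℝ) : ℝ :=
  ∫ x, truncPow k 3 (v t x) / 3 * η x ^ 2

/-- The energy of the truncated function on a time slice. -/
def levelEnergy (Λ : ℝ) (v : ℝ → Ed d → ℝ) (Dv : ℝ → Ed d → Ed d) (k : ℝ) (η : Ed d → ℝ)
    (t : ℝ) : ℝ :=
  ∫ x, Λ⁻¹ * truncPow k 1 (v t x) * η x ^ 2 * ‖Dv t x‖ ^ 2

/-- The source term in the energy estimate on a time slice. -/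
def energySource (s Λ : ℝ) (v : ℝ → Ed d → ℝ) (x₀ : Ed d) (R k r L t : ℝ) : ℝ≥0∞ :=
  ENNReal.ofReal (Λ ^ 3 * L ^ 2 * k ^ 3) * subVol v x₀ k r t + jumpDensity s Λ v x₀ R k r L t

lemma measurable_jumpDensity (hv : Measurable (Function.uncurry v)) (k r L : ℝ) :
    Measurable (jumpDensity s Λ v x₀ R k r L) := by
  have h1 := measurable_negTail (s := s) (x₀ := x₀) (R := R) hv
  have h2 := measurable_subVol (x₀ := x₀) hv k r
  unfold jumpDensity
  fun_prop

lemma measurable_energySource (hv : Measurable (Function.uncurry v)) (k r L : ℝ) :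
    Measurable (energySource s Λ v x₀ R k r L) := by
  have h1 := measurable_jumpDensity (s := s) (Λ := Λ) (x₀ := x₀) (R := R) hv k r L
  have h2 := measurable_subVol (x₀ := x₀) hv k r
  unfold energySource
  fun_prop

lemma CylSuper.lintegral_energySource_ne_top (hC : CylSuper s Λ A K v Dv t₀ x₀ R) (k r L : ℝ) :
    ∫⁻ t in Iminus t₀ (2 * R), energySource s Λ v x₀ R k r L t ≠ ∞ := by
  obtain ⟨B, hB⟩ : ∃ B, B = volume (ball x₀ r) := ⟨_, rfl⟩
  have hBt : B ≠ ∞ := by rw [hB]; exact measure_ball_lt_top.ne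
  have hlev : levyConst d s ≠ ∞ := levyConst_ne_top hC.two_le hC.s_mem
  have hJ : volume (Iminus t₀ (2 * R)) ≠ ∞ := by simp [Iminus]
  obtain ⟨c1, hc1⟩ : ∃ c, c = ENNReal.ofReal (Λ ^ 3 * L ^ 2 * k ^ 3) * B +
    ENNReal.ofReal (8 * k ^ 2 * Λ * L ^ 2) * B * (levyConst d s * ENNReal.ofReal k) := ⟨_, rfl⟩
  obtain ⟨c2, hc2⟩ : ∃ c, c = ENNReal.ofReal (8 * k ^ 2 * Λ * L ^ 2) * B *
    ENNReal.ofReal (2 ^ ((d : ℝ) + 2 * s) * R ^ 2) := ⟨_, rfl⟩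
  have h1 : ∀ t, energySource s Λ v x₀ R k r L t ≤ c1 + c2 * negTail s v x₀ R t := by
    intro t
    have h := subVol_le (v := v) (x₀ := x₀) k r t
    rw [← hB] at h
    calc energySource s Λ v x₀ R k r L t
        ≤ ENNReal.ofReal (Λ ^ 3 * L ^ 2 * k ^ 3) * B + ENNReal.ofReal (8 * k ^ 2 * Λ * L ^ 2) * B *
          (levyConst d s * ENNReal.ofReal k + ENNReal.ofReal (2 ^ ((d : ℝ) + 2 * s) * R ^ 2) *
            negTail s v x₀ R t) := by
          unfold energySource jumpDensity
          gcongr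
      _ = _ := by rw [hc1, hc2]; ring
  refine ne_top_of_le_ne_top ?_ (lintegral_mono h1)
  have hc1t : c1 ≠ ∞ := by
    rw [hc1]
    refine ENNReal.add_ne_top.2 ⟨ENNReal.mul_ne_top (by simp) hBt, ?_⟩
    exact ENNReal.mul_ne_top (ENNReal.mul_ne_top (by simp) hBt) (ENNReal.mul_ne_top hlev (by simp))
  have hc2t : c2 ≠ ∞ := by
    rw [hc2]
    exact ENNReal.mul_ne_top (ENNReal.mul_ne_top (by simp) hBt) (by simp)
  rw [lintegral_add_left measurable_const, lintegral_const, Measure.restrict_apply_univ,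
    lintegral_const_mul' _ _ hc2t]
  exact ENNReal.add_ne_top.2 ⟨ENNReal.mul_ne_top hc1t hJ,
    ENNReal.mul_ne_top hc2t hC.lintegral_negTail_ne_top⟩

/-- The energy estimate, with an arbitrary cutoff in time. -/
theorem CylSuper.energy (hC : CylSuper s Λ A K v Dv t₀ x₀ R) {k L r : ℝ}
    (hk : 0 ≤ k) (hL : 1 ≤ L) (hLR : 1 ≤ L * R) (hr : r ≤ R) {η : Ed d → ℝ}
    (hη : ContDiff ℝ (⊤ : ℕ∞) η) (hηc : HasCompactSupport η)
    (hηt : tsupport η ⊆ ball x₀ (2 * R)) (hη01 : ∀ x, η x ∈ Icc (0 : ℝ) 1)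
    (hηL : ∀ x y, |η x - η y| ≤ L * ‖x - y‖) (hηs : ∀ x, x ∉ ball x₀ r → η x = 0) :
    IntegrableOn (levelMass v k η) (Iminus t₀ (2 * R)) ∧
    IntegrableOn (levelEnergy Λ v Dv k η) (Iminus t₀ (2 * R)) ∧
    ∀ χ : ℝ → ℝ, ContDiff ℝ (⊤ : ℕ∞) χ → (∀ t, 0 ≤ χ t) → HasCompactSupport χ →
      tsupport χ ⊆ Iminus t₀ (2 * R) →
      ∫ t in Iminus t₀ (2 * R), χ t * levelEnergy Λ v Dv k η t ≤
        (∫ t in Iminus t₀ (2 * R), deriv χ t * levelMass v k η t) +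
        ∫ t in Iminus t₀ (2 * R), χ t * (energySource s Λ v x₀ R k r L t).toReal := by
  have hR := hC.R_mem.1
  have hΛ := hC.one_le
  have hv := hC.meas
  have hDv := hC.measD
  have hJ : MeasurableSet (Iminus t₀ (2 * R)) := measurableSet_Ioo
  have hrR : ball x₀ r ⊆ ball x₀ (2 * R) := ball_subset_ball (by linarith)
  have hηB : ∀ x, x ∉ ball x₀ (2 * R) → η x = 0 := fun x hx => hηs x fun h => hx (hrR h)
  have hvol : volume (Iminus t₀ (2 * R) ×ˢ ball x₀ (2 * R)) ≠ ∞ := by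
    rw [Measure.volume_eq_prod, Measure.prod_prod]
    exact ENNReal.mul_ne_top (by simp [Iminus]) measure_ball_lt_top.ne
  have hvp : Measurable fun p : ℝ × Ed d => v p.1 p.2 := hv
  have hDp : Measurable fun p : ℝ × Ed d => Dv p.1 p.2 := hDv
  have htr : ∀ m, Measurable fun p : ℝ × Ed d => truncPow k m (v p.1 p.2) := fun m =>
    (continuous_truncPow k m).measurable.comp hvp
  have hηm : Measurable fun p : ℝ × Ed d => η p.2 := hη.continuous.measurable.comp measurable_snd
  have hnn : ∀ᵐ p : ℝ × Ed d ∂volume.restrict (Iminus t₀ (2 * R) ×ˢ ball x₀ (2 * R)),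
      0 ≤ v p.1 p.2 := by
    rw [ae_restrict_iff' (hJ.prod measurableSet_ball)]
    exact hC.nonneg
  have hη2 : ∀ x, η x ^ 2 ≤ 1 := fun x => pow_le_one₀ (hη01 x).1 (hη01 x).2
  have iM : IntegrableOn (fun p : ℝ × Ed d => truncPow k 3 (v p.1 p.2) / 3 * η p.2 ^ 2)
      (Iminus t₀ (2 * R) ×ˢ ball x₀ (2 * R)) := by
    refine Measure.integrableOn_of_bounded (M := k ^ 3) hvol
      (((htr 3).div_const 3).mul (hηm.pow_const 2)).aestronglyMeasurable ?_
    filter_upwards [hnn] with p hp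
    have h1 := truncPow_le hk 3 hp
    have h2 := truncPow_nonneg k 3 (v p.1 p.2)
    rw [Real.norm_of_nonneg (by positivity)]
    nlinarith [hη2 p.2, sq_nonneg (η p.2)]
  have iE : IntegrableOn (fun p : ℝ × Ed d => Λ⁻¹ * truncPow k 1 (v p.1 p.2) * η p.2 ^ 2 *
      ‖Dv p.1 p.2‖ ^ 2) (Iminus t₀ (2 * R) ×ˢ ball x₀ (2 * R)) := by
    have h1 : IntegrableOn (fun p : ℝ × Ed d => ‖Dv p.1 p.2‖ ^ 2)
        (Iminus t₀ (2 * R) ×ˢ ball x₀ (2 * R)) := hC.memLpD.integrable_norm_pow (by simp)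
    refine Integrable.bdd_mul (c := Λ⁻¹ * k) h1
      (((htr 1).const_mul _).mul (hηm.pow_const 2)).aestronglyMeasurable ?_
    filter_upwards [hnn] with p hp
    have h2 := truncPow_le hk 1 hp
    have h3 := truncPow_nonneg k 1 (v p.1 p.2)
    rw [Real.norm_of_nonneg (by positivity)]
    have h4 := hη2 p.2
    rw [pow_one] at h2
    calc Λ⁻¹ * truncPow k 1 (v p.1 p.2) * η p.2 ^ 2 ≤ Λ⁻¹ * k * 1 := by gcongr
      _ = _ := mul_one _
  obtain ⟨I, hI⟩ : ∃ I : Ed d → ℝ, I = (ball x₀ r).indicator fun _ => 1 := ⟨_, rfl⟩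
  have hI01 : ∀ x, 0 ≤ I x ∧ I x ≤ 1 := by
    intro x
    rw [hI]
    by_cases h : x ∈ ball x₀ r <;> simp [h]
  have hIm : Measurable fun p : ℝ × Ed d => I p.2 := by
    rw [hI]
    exact (measurable_const.indicator measurableSet_ball).comp measurable_snd
  have iS : IntegrableOn (fun p : ℝ × Ed d => Λ ^ 3 * L ^ 2 * truncPow k 3 (v p.1 p.2) * I p.2)
      (Iminus t₀ (2 * R) ×ˢ ball x₀ (2 * R)) := by
    refine Measure.integrableOn_of_bounded (M := Λ ^ 3 * L ^ 2 * k ^ 3) hvol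
      (((htr 3).const_mul _).mul hIm).aestronglyMeasurable ?_
    filter_upwards [hnn] with p hp
    have h1 := truncPow_le hk 3 hp
    have h2 := truncPow_nonneg k 3 (v p.1 p.2)
    have h3 := hI01 p.2
    have h4 := h3.1
    rw [Real.norm_of_nonneg (by positivity)]
    calc Λ ^ 3 * L ^ 2 * truncPow k 3 (v p.1 p.2) * I p.2 ≤ Λ ^ 3 * L ^ 2 * k ^ 3 * 1 := by
          gcongr; exact h3.2
      _ = _ := mul_one _
  obtain ⟨jM, fM⟩ := integral_fst_mul_eq iM
    (fun p hp => by rw [hηB _ hp]; ring)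
  obtain ⟨jE, fE⟩ := integral_fst_mul_eq iE
    (fun p hp => by rw [hηB _ hp]; ring)
  obtain ⟨jS, fS⟩ := integral_fst_mul_eq iS
    (fun p hp => by rw [hI, indicator_of_notMem fun h => hp (hrR h)]; ring)
  refine ⟨jM, jE, fun χ hχ hχ0 hχc hχt => ?_⟩
  have hχs : ∀ t, t ∉ Iminus t₀ (2 * R) → χ t = 0 := fun t ht =>
    image_eq_zero_of_notMem_tsupport fun h => ht (hχt h)
  have hχ's : ∀ t, t ∉ Iminus t₀ (2 * R) → deriv χ t = 0 := fun t ht =>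
    image_eq_zero_of_notMem_tsupport fun h => ht (hχt (tsupport_deriv_subset h))
  have hχ'cont : Continuous (deriv χ) := hχ.continuous_deriv (by simp)
  have bd : ∀ c : ℝ → ℝ, Continuous c → HasCompactSupport c → ∃ M, ∀ t, |c t| ≤ M :=
    fun c hc hcc => hcc.exists_bound_of_continuous hc
  have hχb := bd χ hχ.continuous hχc
  have hχ'b := bd _ hχ'cont hχc.deriv
  obtain ⟨-, eM⟩ := fM _ hχ'cont hχ'b hχ's
  obtain ⟨iE', eE⟩ := fE _ hχ.continuous hχb hχs
  obtain ⟨iS', eS⟩ := fS _ hχ.continuous hχb hχs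
  obtain ⟨β, hβ⟩ : ∃ β : ℝ × Ed d → ℝ, β = fun p => χ p.1 * η p.2 ^ 2 := ⟨_, rfl⟩
  have hβC : ContDiff ℝ (⊤ : ℕ∞) β := by
    rw [hβ]
    exact (hχ.comp contDiff_fst).mul ((hη.comp contDiff_snd).pow 2)
  have hβ0 : ∀ p, 0 ≤ β p := fun p => by
    rw [hβ]; exact mul_nonneg (hχ0 _) (sq_nonneg _)
  have hβsub : tsupport β ⊆ tsupport χ ×ˢ tsupport η := by
    refine closure_minimal (fun p hp => ?_) ((isClosed_tsupport χ).prod (isClosed_tsupport η))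
    rw [hβ, Function.mem_support] at hp
    refine ⟨subset_tsupport _ fun h => hp ?_, subset_tsupport _ fun h => hp ?_⟩
    · simp [h]
    · simp [h]
  have hβc : HasCompactSupport β :=
    (hχc.isCompact.prod hηc.isCompact).of_isClosed_subset (isClosed_tsupport β) hβsub
  have hβs : tsupport β ⊆ pCyl t₀ x₀ (2 * R) := hβsub.trans (prod_mono hχt hηt)
  obtain ⟨iJ, iG, hmain⟩ := hC.truncated hk hβC hβ0 hβc hβs
  have eM' : ∫ p, (truncPow k 3 (v p.1 p.2) / 3) * fderiv ℝ β p (1, 0) =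
      ∫ t in Iminus t₀ (2 * R), deriv χ t * levelMass v k η t := by
    refine Eq.trans (integral_congr_ae (Eventually.of_forall fun p => ?_)) eM
    have h1 : fderiv ℝ β p (1, 0) = deriv χ p.1 * η p.2 ^ 2 := by
      rw [← deriv_time_slice (hβC.of_le (by simp)) p.1 p.2, hβ]
      simp only
      exact deriv_mul_const (hχ.differentiable (by simp) _) _
    simp only [h1]
    ring
  have eG : ∫ p, ∑ i, A p.1 p.2 (Dv p.1 p.2) i * gradTest k v Dv β i p ≤
      -(∫ t in Iminus t₀ (2 * R), χ t * levelEnergy Λ v Dv k η t) +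
      ∫ t in Iminus t₀ (2 * R), χ t *
        ∫ x, Λ ^ 3 * L ^ 2 * truncPow k 3 (v t x) * I x := by
    have h1 : ∀ p : ℝ × Ed d, ∑ i, A p.1 p.2 (Dv p.1 p.2) i * gradTest k v Dv β i p ≤
        -(χ p.1 * (Λ⁻¹ * truncPow k 1 (v p.1 p.2) * η p.2 ^ 2 * ‖Dv p.1 p.2‖ ^ 2)) +
        χ p.1 * (Λ ^ 3 * L ^ 2 * truncPow k 3 (v p.1 p.2) * I p.2) := by
      intro p
      by_cases hp : p.2 ∈ ball x₀ r
      · have := hC.vf.sum_mul_gradTest_le (v := v) (Dv := Dv) hΛ hχ hχ0 hη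
          (by linarith : 0 ≤ L) hηL k p
        rw [hI, indicator_of_mem hp, hβ]
        simpa using this
      · have h2 : β p = 0 := by rw [hβ]; simp [hηs _ hp]
        have h3 : fderiv ℝ β p = 0 := IsLocalMin.fderiv_eq_zero
          (Eventually.of_forall fun y => by rw [h2]; exact hβ0 y)
        have h4 : ∀ i, gradTest k v Dv β i p = 0 := fun i => by simp [gradTest, h2, h3]
        simp [h4, hηs _ hp, hI, indicator_of_notMem hp]
    refine (integral_mono iG (iE'.neg.add iS') h1).trans_eq ?_
    have h2 := integral_add iE'.neg iS'
    simp only [Pi.add_apply, Pi.neg_apply] at h2 ⊢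
    rw [h2, integral_neg, eE, eS]
    rfl
  have hbJ : ∀ t, subVol v x₀ k r t ≠ ∞ := fun t =>
    ne_top_of_le_ne_top measure_ball_lt_top.ne (subVol_le k r t)
  obtain ⟨M, hM⟩ := hχb
  have hsrcm := measurable_energySource (s := s) (Λ := Λ) (x₀ := x₀) (R := R) hv k r L
  have hjm := measurable_jumpDensity (s := s) (Λ := Λ) (x₀ := x₀) (R := R) hv k r L
  have hsv := measurable_subVol (x₀ := x₀) hv k r
  have hsrc := hC.lintegral_energySource_ne_top k r L
  have hjd : ∫⁻ t in Iminus t₀ (2 * R), jumpDensity s Λ v x₀ R k r L t ≠ ∞ :=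
    ne_top_of_le_ne_top hsrc (lintegral_mono fun t => le_add_self)
  have hsd : ∫⁻ t in Iminus t₀ (2 * R), ENNReal.ofReal (Λ ^ 3 * L ^ 2 * k ^ 3) *
      subVol v x₀ k r t ≠ ∞ := ne_top_of_le_ne_top hsrc (lintegral_mono fun t => le_self_add)
  have ijd := integrable_toReal_of_lintegral_ne_top hjm.aemeasurable hjd
  have isd := integrable_toReal_of_lintegral_ne_top (hsv.const_mul _).aemeasurable hsd
  have χmul : ∀ {f : ℝ → ℝ}, IntegrableOn f (Iminus t₀ (2 * R)) →
      IntegrableOn (fun t => χ t * f t) (Iminus t₀ (2 * R)) := fun hf =>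
    Integrable.bdd_mul (c := M) hf hχ.continuous.aestronglyMeasurable (Eventually.of_forall hM)
  have eS' : ∫ t in Iminus t₀ (2 * R), χ t * ∫ x, Λ ^ 3 * L ^ 2 * truncPow k 3 (v t x) * I x ≤
      ∫ t in Iminus t₀ (2 * R), χ t *
        (ENNReal.ofReal (Λ ^ 3 * L ^ 2 * k ^ 3) * subVol v x₀ k r t).toReal := by
    refine integral_mono_ae (χmul jS) (χmul isd) ?_
    have := hC.ae_nonneg_slice
    rw [← ae_restrict_iff' hJ] at this
    filter_upwards [this] with t ht
    refine mul_le_mul_of_nonneg_left ?_ (hχ0 t)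
    have hS : MeasurableSet {x | x ∈ ball x₀ r ∧ v t x < k} :=
      measurableSet_ball.inter (measurableSet_lt (hv.comp measurable_prodMk_left) measurable_const)
    have e : (ENNReal.ofReal (Λ ^ 3 * L ^ 2 * k ^ 3) * subVol v x₀ k r t).toReal =
        ∫ x, {x | x ∈ ball x₀ r ∧ v t x < k}.indicator (fun _ => Λ ^ 3 * L ^ 2 * k ^ 3) x := by
      rw [integral_indicator hS, setIntegral_const, ENNReal.toReal_mul,
        ENNReal.toReal_ofReal (by positivity), smul_eq_mul, mul_comm]
      rfl
    rw [e]
    refine integral_mono_of_nonneg (Eventually.of_forall fun x => ?_) ?_ ?_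
    · have := truncPow_nonneg k 3 (v t x)
      have := (hI01 x).1
      simp only [Pi.zero_apply]
      positivity
    · exact (integrable_indicator_iff hS).2 (integrableOn_const (hbJ t))
    · filter_upwards [ht] with x hx
      by_cases hxr : x ∈ ball x₀ r
      · by_cases hxk : v t x < k
        · rw [indicator_of_mem (show x ∈ {x | x ∈ ball x₀ r ∧ v t x < k} from ⟨hxr, hxk⟩)]
          have h1 := truncPow_le hk 3 (hx (hrR hxr))
          have h2 := hI01 x
          have h3 := h2.1
          have h4 := truncPow_nonneg k 3 (v t x)
          calc Λ ^ 3 * L ^ 2 * truncPow k 3 (v t x) * I x ≤ Λ ^ 3 * L ^ 2 * k ^ 3 * 1 := by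
                gcongr; exact h2.2
            _ = _ := mul_one _
        · rw [truncPow_eq_zero (by norm_num) (not_lt.1 hxk)]
          simp only [mul_zero, zero_mul]
          exact indicator_nonneg (fun _ _ => by positivity) _
      · have : I x = 0 := by rw [hI, indicator_of_notMem hxr]
        rw [this, mul_zero]
        exact indicator_nonneg (fun _ _ => by positivity) _
  have eJ : ∫ z, jumpForm K v (fun p => truncPow k 2 (v p.1 p.2) * β p) z ≤
      ∫ t in Iminus t₀ (2 * R), χ t * (jumpDensity s Λ v x₀ R k r L t).toReal := by
    have h1 := hC.lintegral_jumpForm_truncPow_le hk hL hLR hr hη.continuous.measurable hη01 hηL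
      hηs hχ.continuous.measurable hχ0 hχs
    have h2 : ∫⁻ t, ENNReal.ofReal (χ t) * jumpDensity s Λ v x₀ R k r L t =
        ∫⁻ t in Iminus t₀ (2 * R), ENNReal.ofReal (χ t) * jumpDensity s Λ v x₀ R k r L t := by
      refine (setLIntegral_eq_of_support_subset fun t ht => ?_).symm
      by_contra h
      exact ht (by simp [hχs t h])
    have h3 : ∫⁻ t in Iminus t₀ (2 * R), ENNReal.ofReal (χ t) * jumpDensity s Λ v x₀ R k r L t
        ≠ ∞ := by
      refine ne_top_of_le_ne_top (b := ENNReal.ofReal M *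
        ∫⁻ t in Iminus t₀ (2 * R), jumpDensity s Λ v x₀ R k r L t)
        (ENNReal.mul_ne_top (by simp) hjd) ?_
      rw [← lintegral_const_mul' _ _ (by simp)]
      refine lintegral_mono fun t => ?_
      gcongr
      exact (le_abs_self _).trans (hM t)
    have h4 : ∫ t in Iminus t₀ (2 * R), χ t * (jumpDensity s Λ v x₀ R k r L t).toReal =
        (∫⁻ t in Iminus t₀ (2 * R), ENNReal.ofReal (χ t) * jumpDensity s Λ v x₀ R k r L t).toReal
        := by
      have hm : Measurable fun t => ENNReal.ofReal (χ t) * jumpDensity s Λ v x₀ R k r L t :=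
        hχ.continuous.measurable.ennreal_ofReal.mul hjm
      rw [← integral_toReal hm.aemeasurable (ae_lt_top hm h3)]
      refine integral_congr_ae (Eventually.of_forall fun t => ?_)
      simp only
      rw [ENNReal.toReal_mul, ENNReal.toReal_ofReal (hχ0 t)]
    rw [h4, ← h2, integral_eq_lintegral_pos_part_sub_lintegral_neg_part iJ, hβ]
    rw [← h2] at h3
    refine (sub_le_self _ ENNReal.toReal_nonneg).trans (ENNReal.toReal_mono h3 h1)
  have eT : ∫ t in Iminus t₀ (2 * R), χ t * (energySource s Λ v x₀ R k r L t).toReal =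
      (∫ t in Iminus t₀ (2 * R), χ t *
        (ENNReal.ofReal (Λ ^ 3 * L ^ 2 * k ^ 3) * subVol v x₀ k r t).toReal) +
      ∫ t in Iminus t₀ (2 * R), χ t * (jumpDensity s Λ v x₀ R k r L t).toReal := by
    rw [← integral_add (χmul isd) (χmul ijd)]
    refine integral_congr_ae ?_
    filter_upwards [ae_lt_top hjm hjd] with t ht
    rw [energySource, ENNReal.toReal_add (ENNReal.mul_ne_top (by simp) (hbJ t)) ht.ne]
    ring
  linarith

end Energy

section TimeLemma

lemma exists_smoothTransition_lipschitz : ∃ C : ℝ, 1 ≤ C ∧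
    (∀ x, |deriv Real.smoothTransition x| ≤ C) ∧
    ∀ x y, |Real.smoothTransition x - Real.smoothTransition y| ≤ C * |x - y| := by
  have hc : HasCompactSupport (deriv Real.smoothTransition) := by
    refine HasCompactSupport.of_support_subset_isCompact (isCompact_Icc (a := (0 : ℝ)) (b := 1))
      fun x hx => ?_
    by_contra h
    refine hx ?_
    rw [mem_Icc, not_and_or, not_le, not_le] at h
    rcases h with h | h
    · have : Real.smoothTransition =ᶠ[𝓝 x] fun _ => 0 := by
        filter_upwards [Iio_mem_nhds h] with y hy using
          Real.smoothTransition.zero_of_nonpos (le_of_lt hy)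
      rw [this.deriv_eq, deriv_const]
    · have : Real.smoothTransition =ᶠ[𝓝 x] fun _ => 1 := by
        filter_upwards [Ioi_mem_nhds h] with y hy using
          Real.smoothTransition.one_of_one_le (le_of_lt hy)
      rw [this.deriv_eq, deriv_const]
  have hs : ContDiff ℝ 1 Real.smoothTransition := Real.smoothTransition.contDiff (n := 1)
  obtain ⟨C, hC⟩ := hc.exists_bound_of_continuous (hs.continuous_deriv le_rfl)
  refine ⟨max C 1, le_max_right _ _, fun x => (hC x).trans (le_max_left _ _), fun x y => ?_⟩
  exact convex_univ.norm_image_sub_le_of_norm_deriv_le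
    (fun z _ => hs.differentiable (by simp) z) (fun z _ => (hC z).trans (le_max_left _ _))
    (mem_univ y) (mem_univ x)

variable {α T₀ T₁ b C : ℝ} {W D g : ℝ → ℝ}

lemma time_cutoff (hC : ∀ x, |deriv Real.smoothTransition x| ≤ C) (hα : α < T₀) (hT : T₀ < T₁)
    (hW : IntegrableOn W (Ioo α b)) (hD : IntegrableOn D (Ioo α b))
    (hg : IntegrableOn g (Ioo α b)) (hW0 : ∀ t, 0 ≤ W t) (hD0 : ∀ t, 0 ≤ D t) (hg0 : ∀ t, 0 ≤ g t)
    (h : ∀ χ : ℝ → ℝ, ContDiff ℝ (⊤ : ℕ∞) χ → (∀ t, 0 ≤ χ t) → HasCompactSupport χ →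
      tsupport χ ⊆ Ioo α b →
      ∫ t in Ioo α b, χ t * D t ≤ (∫ t in Ioo α b, deriv χ t * W t) + ∫ t in Ioo α b, χ t * g t)
    {φ : ℝ → ℝ} (hφ : ContDiff ℝ (⊤ : ℕ∞) φ) (hφ0 : ∀ t, 0 ≤ φ t) (hφc : HasCompactSupport φ)
    (hφs : tsupport φ ⊆ Ioo T₁ b) {a : ℝ} (ha : ∀ t ≤ a, φ t = 0) (hab : a ≤ b) :
    (∫ t, φ t) * (∫ t in Ioo T₁ a, D t) + ∫ t in Ioo α b, φ t * W t ≤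
      (∫ t, φ t) * ∫ t in Ioo T₀ b, (C / (T₁ - T₀) * W t + g t) := by
  rcases le_or_gt b T₁ with hb | hb
  · have h0 : φ = 0 := by
      ext t
      refine image_eq_zero_of_notMem_tsupport fun ht => ?_
      have := hφs ht
      linarith [this.1, this.2]
    simp [h0]
  have hT' : 0 < T₁ - T₀ := sub_pos.2 hT
  have hC0 : 0 ≤ C := (abs_nonneg _).trans (hC 0)
  obtain ⟨c, hc, hcs⟩ : ∃ c ∈ Ico T₁ b, tsupport φ ⊆ Iic c := by
    rcases (tsupport φ).eq_empty_or_nonempty with he | hne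
    · exact ⟨T₁, ⟨le_rfl, hb⟩, by simp [he]⟩
    · obtain ⟨c, hc⟩ := hφc.isCompact.exists_isGreatest hne
      exact ⟨c, ⟨(hφs hc.1).1.le, (hφs hc.1).2⟩, hc.2⟩
  have hφzero : ∀ t, t ∉ Ioc T₁ c → φ t = 0 := fun t ht =>
    image_eq_zero_of_notMem_tsupport fun h' => ht ⟨(hφs h').1, hcs h'⟩
  have hcont := hφ.continuous
  have hφi : Integrable φ := hcont.integrable_of_hasCompactSupport hφc
  obtain ⟨m, hm⟩ : ∃ m, m = ∫ t, φ t := ⟨_, rfl⟩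
  have hm0 : 0 ≤ m := hm ▸ integral_nonneg hφ0
  obtain ⟨κ, hκ⟩ : ∃ κ : ℝ → ℝ, κ = fun t => ∫ x in t..b, φ x := ⟨_, rfl⟩
  have hκd : ∀ t, HasDerivAt κ (-φ t) t := fun t => by
    rw [hκ]
    exact intervalIntegral.integral_hasDerivAt_left (hcont.intervalIntegrable _ _)
      hcont.aestronglyMeasurable.stronglyMeasurableAtFilter hcont.continuousAt
  have hκC : ContDiff ℝ (⊤ : ℕ∞) κ := by
    rw [contDiff_infty_iff_deriv]
    refine ⟨fun t => (hκd t).differentiableAt, ?_⟩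
    rw [show deriv κ = fun t => -φ t from funext fun t => (hκd t).deriv]
    exact hφ.neg
  have hκc : ∀ t, c ≤ t → κ t = 0 := by
    intro t ht
    rw [hκ]
    refine intervalIntegral.integral_zero_ae (Eventually.of_forall fun x hx => hφzero x fun h' => ?_)
    have : min t b < x := hx.1
    have h2 : c ≤ min t b := le_min ht hc.2.le
    linarith [h'.2]
  have hκ01 : ∀ t, 0 ≤ κ t ∧ κ t ≤ m := by
    intro t
    rcases le_total c t with ht | ht
    · rw [hκc t ht]; exact ⟨le_rfl, hm0⟩
    · rw [hκ, hm]
      simp only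
      rw [intervalIntegral.integral_of_le (ht.trans hc.2.le)]
      exact ⟨integral_nonneg hφ0, setIntegral_le_integral hφi (Eventually.of_forall hφ0)⟩
  have hκa : ∀ t ≤ a, κ t = m := by
    intro t ht
    rw [hκ, hm]
    refine intervalIntegral.integral_eq_integral_of_support_subset fun x hx => ⟨?_, ?_⟩
    · by_contra hx'
      exact hx (ha x ((not_lt.1 hx').trans ht))
    · by_contra hx'
      exact hx (hφzero x fun h' => hx' (h'.2.trans hc.2.le))
  obtain ⟨θ, hθ⟩ : ∃ θ : ℝ → ℝ, θ = fun t => Real.smoothTransition ((t - T₀) * (T₁ - T₀)⁻¹) :=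
    ⟨_, rfl⟩
  have hθC : ContDiff ℝ (⊤ : ℕ∞) θ := by
    rw [hθ]
    exact Real.smoothTransition.contDiff.comp ((contDiff_id.sub contDiff_const).mul contDiff_const)
  have hθd : ∀ t, |deriv θ t| ≤ C / (T₁ - T₀) := by
    intro t
    have h1 : HasDerivAt θ (deriv Real.smoothTransition ((t - T₀) * (T₁ - T₀)⁻¹) *
        (1 * (T₁ - T₀)⁻¹)) t := by
      rw [hθ]
      exact HasDerivAt.comp t ((Real.smoothTransition.contDiff (n := 1)).differentiable
        (by simp) _).hasDerivAt (((hasDerivAt_id t).sub_const T₀).mul_const _)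
    rw [h1.deriv, abs_mul, one_mul, abs_of_pos (inv_pos.2 hT'), div_eq_mul_inv]
    exact mul_le_mul_of_nonneg_right (hC _) (inv_nonneg.2 hT'.le)
  have hθ01 : ∀ t, 0 ≤ θ t ∧ θ t ≤ 1 := fun t => by
    rw [hθ]; exact ⟨Real.smoothTransition.nonneg _, Real.smoothTransition.le_one _⟩
  have hθ1 : ∀ t, T₁ ≤ t → θ t = 1 := fun t ht => by
    rw [hθ]
    refine Real.smoothTransition.one_of_one_le ?_
    rw [← div_eq_mul_inv, one_le_div hT']
    linarith
  have hθ0 : ∀ t, t ≤ T₀ → θ t = 0 := fun t ht => by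
    rw [hθ]
    refine Real.smoothTransition.zero_of_nonpos ?_
    exact mul_nonpos_of_nonpos_of_nonneg (by linarith) (inv_nonneg.2 hT'.le)
  have hθd0 : ∀ t, t < T₀ → deriv θ t = 0 := fun t ht => by
    have : θ =ᶠ[𝓝 t] fun _ => 0 := by
      filter_upwards [Iio_mem_nhds ht] with y hy using hθ0 y (le_of_lt hy)
    rw [this.deriv_eq, deriv_const]
  obtain ⟨χ, hχ⟩ : ∃ χ : ℝ → ℝ, χ = fun t => θ t * κ t := ⟨_, rfl⟩
  have hχC : ContDiff ℝ (⊤ : ℕ∞) χ := hχ ▸ hθC.mul hκC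
  have hχ0 : ∀ t, 0 ≤ χ t := fun t => by
    rw [hχ]; exact mul_nonneg (hθ01 t).1 (hκ01 t).1
  have hχm : ∀ t, χ t ≤ m := fun t => by
    rw [hχ]
    exact (mul_le_of_le_one_left (hκ01 t).1 (hθ01 t).2).trans (hκ01 t).2
  have hχsupp : tsupport χ ⊆ Icc T₀ c := by
    refine closure_minimal (fun t ht => ⟨?_, ?_⟩) isClosed_Icc
    · by_contra h'
      exact ht (by rw [hχ]; simp [hθ0 t (not_le.1 h').le])
    · by_contra h'
      exact ht (by rw [hχ]; simp [hκc t (not_le.1 h').le])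
  have hχcs : HasCompactSupport χ := isCompact_Icc.of_isClosed_subset (isClosed_tsupport χ) hχsupp
  have hχt : tsupport χ ⊆ Ioo α b := hχsupp.trans fun t ht =>
    ⟨hα.trans_le ht.1, ht.2.trans_lt hc.2⟩
  have hχd : ∀ t, deriv χ t = deriv θ t * κ t - φ t := by
    intro t
    have h1 : HasDerivAt χ (deriv θ t * κ t + θ t * -φ t) t := by
      rw [hχ]
      exact (hθC.differentiable (by simp) t).hasDerivAt.mul (hκd t)
    rw [h1.deriv]
    by_cases ht : T₁ ≤ t
    · rw [hθ1 t ht]; ring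
    · rw [hφzero t fun h' => ht h'.1.le]; ring
  have hmain := h χ hχC hχ0 hχcs hχt
  have bdmul : ∀ {u f : ℝ → ℝ}, Continuous u → HasCompactSupport u → IntegrableOn f (Ioo α b) →
      IntegrableOn (fun t => u t * f t) (Ioo α b) := by
    intro u f hu huc hf
    obtain ⟨M, hM⟩ := huc.exists_bound_of_continuous hu
    exact Integrable.bdd_mul (c := M) hf hu.aestronglyMeasurable (Eventually.of_forall hM)
  have iW1 := bdmul (hχC.continuous_deriv (by simp)) hχcs.deriv hW
  have iW2 := bdmul hcont hφc hW
  have ig := bdmul hχC.continuous hχcs hg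
  have iD := bdmul hχC.continuous hχcs hD
  have hJsub : Ioo T₀ b ⊆ Ioo α b := Ioo_subset_Ioo_left hα.le
  have e1 : (∫ t in Ioo α b, deriv χ t * W t) + (∫ t in Ioo α b, φ t * W t) +
      ∫ t in Ioo α b, χ t * g t ≤ m * ∫ t in Ioo T₀ b, (C / (T₁ - T₀) * W t + g t) := by
    have iW3 : IntegrableOn (fun t => deriv χ t * W t + φ t * W t) (Ioo α b) := iW1.add iW2
    rw [← integral_add iW1 iW2, ← integral_add iW3 ig]
    have hi : IntegrableOn (fun t => m * (C / (T₁ - T₀) * W t + g t)) (Ioo T₀ b) :=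
      (((hW.mono_set hJsub).const_mul _).add (hg.mono_set hJsub)).const_mul _
    rw [← integral_const_mul, ← integral_indicator measurableSet_Ioo,
      ← integral_indicator measurableSet_Ioo]
    have hnn : ∀ t, 0 ≤ C / (T₁ - T₀) * W t + g t := fun t => by
      have := hW0 t; have := hg0 t; positivity
    refine integral_mono_ae ((integrable_indicator_iff measurableSet_Ioo).2
      (iW3.add ig)) ((integrable_indicator_iff measurableSet_Ioo).2 hi) ?_
    filter_upwards [Measure.ae_ne volume T₀] with t htne
    by_cases ht : t ∈ Ioo T₀ b
    · rw [indicator_of_mem ht, indicator_of_mem (hJsub ht)]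
      rw [hχd]
      have h1 : deriv θ t * κ t ≤ C / (T₁ - T₀) * m := by
        have := (le_abs_self _).trans (hθd t)
        have h3 := hκ01 t
        have h4 : 0 ≤ C / (T₁ - T₀) := by positivity
        exact mul_le_mul this h3.2 h3.1 h4
      have h5 := mul_le_mul_of_nonneg_right h1 (hW0 t)
      have h6 := mul_le_mul_of_nonneg_right (hχm t) (hg0 t)
      linarith
    · rw [indicator_of_notMem ht]
      by_cases ht' : t ∈ Ioo α b
      · have htT : t < T₀ := by
          refine lt_of_le_of_ne (not_lt.1 fun h' => ht ⟨h', ht'.2⟩) htne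
        rw [indicator_of_mem ht']
        rw [hχd, hθd0 t htT, hφzero t fun h' => by linarith [h'.1],
          show χ t = 0 by rw [hχ]; simp [hθ0 t htT.le]]
        simp
      · rw [indicator_of_notMem ht']
  have e2 : m * ∫ t in Ioo T₁ a, D t ≤ ∫ t in Ioo α b, χ t * D t := by
    have hsub : Ioo T₁ a ⊆ Ioo α b := Ioo_subset_Ioo (hα.trans hT).le hab
    rw [← integral_const_mul]
    calc ∫ t in Ioo T₁ a, m * D t = ∫ t in Ioo T₁ a, χ t * D t := by
          refine setIntegral_congr_fun measurableSet_Ioo fun t ht => ?_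
          rw [hχ]
          simp only
          rw [hθ1 t ht.1.le, hκa t ht.2.le, one_mul]
      _ ≤ _ := setIntegral_mono_set iD (Eventually.of_forall fun t => mul_nonneg (hχ0 t) (hD0 t))
          hsub.eventuallyLE
  rw [← hm]
  linarith

/-- From an energy inequality tested with arbitrary cutoffs in time to a pointwise-in-time bound
and an integral bound. -/
lemma time_energy (hC : ∀ x, |deriv Real.smoothTransition x| ≤ C) (hα : α < T₀) (hT : T₀ < T₁)
    (hb : T₁ < b)
    (hW : IntegrableOn W (Ioo α b)) (hD : IntegrableOn D (Ioo α b))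
    (hg : IntegrableOn g (Ioo α b)) (hW0 : ∀ t, 0 ≤ W t) (hD0 : ∀ t, 0 ≤ D t) (hg0 : ∀ t, 0 ≤ g t)
    (h : ∀ χ : ℝ → ℝ, ContDiff ℝ (⊤ : ℕ∞) χ → (∀ t, 0 ≤ χ t) → HasCompactSupport χ →
      tsupport χ ⊆ Ioo α b →
      ∫ t in Ioo α b, χ t * D t ≤ (∫ t in Ioo α b, deriv χ t * W t) + ∫ t in Ioo α b, χ t * g t) :
    (∀ᵐ t, t ∈ Ioo T₁ b → W t ≤ ∫ t in Ioo T₀ b, (C / (T₁ - T₀) * W t + g t)) ∧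
      ∫ t in Ioo T₁ b, D t ≤ ∫ t in Ioo T₀ b, (C / (T₁ - T₀) * W t + g t) := by
  obtain ⟨M, hM⟩ : ∃ M, M = ∫ t in Ioo T₀ b, (C / (T₁ - T₀) * W t + g t) := ⟨_, rfl⟩
  rw [← hM]
  constructor
  · have hloc : LocallyIntegrable ((Ioo α b).indicator W) :=
      ((integrable_indicator_iff measurableSet_Ioo).2 hW).locallyIntegrable
    filter_upwards [moll_tendsto_ae hloc] with τ hτ hτb
    have hτJ : τ ∈ Ioo α b := ⟨(hα.trans hT).trans hτb.1, hτb.2⟩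
    rw [indicator_of_mem hτJ] at hτ
    refine le_of_tendsto hτ ?_
    obtain ⟨ε, hε, hε'⟩ : ∃ ε > 0, closedBall τ ε ⊆ Ioo T₁ b :=
      nhds_basis_closedBall.mem_iff.1 (isOpen_Ioo.mem_nhds hτb)
    have hev : ∀ᶠ n : ℕ in atTop, 1 / ((n : ℝ) + 1) < ε :=
      tendsto_one_div_add_atTop_nhds_zero_nat.eventually (gt_mem_nhds hε)
    filter_upwards [hev] with n hn
    have hz : ∀ t, mollKer ℝ n (τ - t) ≠ 0 → t ∈ closedBall τ ε := by
      intro t ht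
      rw [mem_closedBall', dist_eq_norm]
      by_contra h'
      exact ht (mollKer_eq_zero (hn.le.trans (not_le.1 h').le))
    have hts : tsupport (fun t => mollKer ℝ n (τ - t)) ⊆ closedBall τ ε :=
      closure_minimal hz isClosed_closedBall
    have hcs : HasCompactSupport fun t => mollKer ℝ n (τ - t) :=
      (isCompact_closedBall τ ε).of_isClosed_subset (isClosed_tsupport _) hts
    have hint : ∫ t, mollKer ℝ n (τ - t) = 1 := by
      rw [integral_sub_left_eq_self (mollKer ℝ n) volume τ, mollKer_integral]
    have key := time_cutoff (a := T₁) hC hα hT hW hD hg hW0 hD0 hg0 h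
      ((mollKer_contDiff n).comp (contDiff_const.sub contDiff_id))
      (fun t => mollKer_nonneg n _) hcs (hts.trans hε')
      (fun t ht => by
        by_contra h'
        exact absurd (hε' (hz t h')).1 (not_lt.2 ht)) hb.le
    simp only [Function.comp_apply, id] at key
    rw [hint, Ioo_self, Measure.restrict_empty, integral_zero_measure, mul_zero, zero_add, one_mul,
      ← hM] at key
    rw [moll_apply, ← integral_sub_left_eq_self _ volume τ]
    simp only [sub_sub_cancel]
    refine le_trans (le_of_eq ?_) key
    rw [← integral_indicator measurableSet_Ioo]
    refine integral_congr_ae (Eventually.of_forall fun t => ?_)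
    by_cases ht : t ∈ Ioo α b <;> simp [ht]
  · have hlim : Tendsto (fun n : ℕ => ∫ t in Ioo T₁ (b - 1 / ((n : ℝ) + 1)), D t) atTop
        (𝓝 (∫ t in ⋃ n : ℕ, Ioo T₁ (b - 1 / ((n : ℝ) + 1)), D t)) := by
      refine tendsto_setIntegral_of_monotone (fun _ => measurableSet_Ioo) ?_ ?_
      · intro n n' hn
        refine Ioo_subset_Ioo_right (sub_le_sub_left (one_div_le_one_div_of_le (by positivity) ?_) _)
        have : (n : ℝ) ≤ n' := by exact_mod_cast hn
        linarith
      · refine hD.mono_set (iUnion_subset fun n => Ioo_subset_Ioo (hα.trans hT).le ?_)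
        have : 0 ≤ 1 / ((n : ℝ) + 1) := by positivity
        linarith
    have hU : ⋃ n : ℕ, Ioo T₁ (b - 1 / ((n : ℝ) + 1)) = Ioo T₁ b := by
      ext t
      simp only [mem_iUnion, mem_Ioo]
      constructor
      · rintro ⟨n, h1, h2⟩
        have : 0 ≤ 1 / ((n : ℝ) + 1) := by positivity
        exact ⟨h1, by linarith⟩
      · rintro ⟨h1, h2⟩
        obtain ⟨n, hn⟩ := exists_nat_one_div_lt (sub_pos.2 h2)
        exact ⟨n, h1, by linarith⟩
    rw [hU] at hlim
    refine le_of_tendsto hlim (Eventually.of_forall fun n => ?_)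
    have hn : 0 < 1 / ((n : ℝ) + 1) := by positivity
    obtain ⟨e, he⟩ : ∃ e, e = 1 / ((n : ℝ) + 1) := ⟨_, rfl⟩
    rw [← he] at hn ⊢
    rcases le_or_gt (b - e) T₁ with hle | hlt
    · rw [Ioo_eq_empty_of_le hle, Measure.restrict_empty, integral_zero_measure, hM]
      refine integral_nonneg fun t => ?_
      have h1 := hW0 t
      have h2 := hg0 t
      have h3 : 0 ≤ C := (abs_nonneg _).trans (hC 0)
      have h4 := sub_pos.2 hT
      simp only [Pi.zero_apply]
      positivity
    let f : ContDiffBump (b - e / 2) :=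
      { rIn := e / 8, rOut := e / 4, rIn_pos := by positivity, rIn_lt_rOut := by linarith }
    have hts : tsupport (f.normed volume) ⊆ Icc (b - 3 * e / 4) (b - e / 4) := by
      rw [f.tsupport_normed_eq, Real.closedBall_eq_Icc]
      exact Icc_subset_Icc (by simp only [f]; linarith) (by simp only [f]; linarith)
    have key := time_cutoff (a := b - e) hC hα hT hW hD hg hW0 hD0 hg0 h f.contDiff_normed
      f.nonneg_normed f.hasCompactSupport_normed
      (hts.trans fun t ht => ⟨by linarith [ht.1], by linarith [ht.2]⟩)
      (fun t ht => image_eq_zero_of_notMem_tsupport fun h' => by linarith [(hts h').1])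
      (by linarith)
    rw [f.integral_normed, one_mul, one_mul, ← hM] at key
    have h5 : 0 ≤ ∫ t in Ioo α b, f.normed volume t * W t :=
      integral_nonneg fun t => mul_nonneg (f.nonneg_normed t) (hW0 t)
    linarith

end TimeLemma

lemma enorm_clm_le_sum (L : Ed d →L[ℝ] ℝ) :
    ‖L‖ₑ ≤ ∑ i, ‖L (EuclideanSpace.single i 1)‖ₑ := by
  have h : ‖L‖ ≤ ∑ i, ‖L (EuclideanSpace.single i 1)‖ := by
    refine L.opNorm_le_bound (Finset.sum_nonneg fun i _ => norm_nonneg _) fun x => ?_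
    have e : L x = ∑ i, x i * L (EuclideanSpace.single i 1) := by
      conv_lhs => rw [show x = ∑ i, x i • EuclideanSpace.single i (1 : ℝ) by
        ext j; simp [Pi.single_apply]]
      simp
    rw [e, Finset.sum_mul]
    refine (norm_sum_le _ _).trans (Finset.sum_le_sum fun i _ => ?_)
    rw [norm_mul, mul_comm]
    gcongr
    exact PiLp.norm_apply_le x i
  rw [← ofReal_norm]
  refine (ENNReal.ofReal_le_ofReal h).trans ?_
  rw [ENNReal.ofReal_sum_of_nonneg fun i _ => norm_nonneg _]
  simp only [ofReal_norm]
  exact le_rfl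

/-- The exponent `d / (d - 1)`. -/
def sobolevExp (d : ℕ) : ℝ≥0 := (d : ℝ≥0) / ((d : ℝ≥0) - 1)

/-- The constant of the Gagliardo–Nirenberg–Sobolev inequality. -/
def sobolevConst (d : ℕ) : ℝ≥0 := eLpNormLESNormFDerivOneConst (volume : Measure (Ed d)) (sobolevExp d)

lemma sobolevExp_conj (hd : 2 ≤ d) :
    NNReal.HolderConjugate (Module.finrank ℝ (Ed d)) (sobolevExp d) := by
  rw [finrank_euclideanSpace_fin]
  have h : (1 : ℝ≥0) < d := by exact_mod_cast hd
  exact NNReal.HolderConjugate.conjExponent h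

/-- The weak gradient of `truncPow k 2 f * η ^ 2` in the `i`-th direction. -/
def sliceGrad (k : ℝ) (f : Ed d → ℝ) (F : Ed d → Ed d) (β : Ed d → ℝ) (i : Fin d) (x : Ed d) : ℝ :=
  -(2 * truncPow k 1 (f x)) * F x i * β x
    + truncPow k 2 (f x) * fderiv ℝ β x (EuclideanSpace.single i 1)

lemma weakDeriv_mul_of_test {f : Ed d → ℝ} {F : Ed d → Ed d} {x₀ : Ed d} {ρ : ℝ}
    (hf : MemLp f 2 (volume.restrict (ball x₀ ρ))) (hF : MemLp F 2 (volume.restrict (ball x₀ ρ)))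
    (hgrad : ∀ φ : Ed d → ℝ, ContDiff ℝ (⊤ : ℕ∞) φ → HasCompactSupport φ →
      tsupport φ ⊆ ball x₀ ρ → ∀ e : Ed d,
      ∫ x, f x * (fderiv ℝ φ x) e = - ∫ x, φ x * ⟪F x, e⟫)
    {ζ : Ed d → ℝ} (hζ : ContDiff ℝ (⊤ : ℕ∞) ζ) (hζc : HasCompactSupport ζ)
    (hζs : tsupport ζ ⊆ ball x₀ ρ) (i : Fin d) :
    MemLp (fun x => ζ x * f x) 2 ∧
    MemLp (fun x => ζ x * F x i + fderiv ℝ ζ x (EuclideanSpace.single i 1) * f x) 2 ∧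
    WeakDeriv (fun x => ζ x * f x)
      (fun x => ζ x * F x i + fderiv ℝ ζ x (EuclideanSpace.single i 1) * f x)
      (EuclideanSpace.single i 1) := by
  have hζ1 : ContDiff ℝ 1 ζ := hζ.of_le (by simp)
  have hu : MemLp (fun x => ζ x * f x) 2 :=
    memLp_mul_of_tsupport_subset measurableSet_ball hf hζ.continuous hζc hζs
  have hFi : MemLp (fun x => F x i) 2 (volume.restrict (ball x₀ ρ)) := by
    refine hF.of_le_mul (c := 1) ?_ (ae_of_all _ fun x => ?_)
    · exact (EuclideanSpace.proj (𝕜 := ℝ) i).continuous.comp_aestronglyMeasurable hF.1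
    · rw [one_mul]; exact PiLp.norm_apply_le _ _
  have hD2 : MemLp (fun x => ζ x * F x i) 2 :=
    memLp_mul_of_tsupport_subset measurableSet_ball hFi hζ.continuous hζc hζs
  have hv2 : MemLp (fun x => fderiv ℝ ζ x (EuclideanSpace.single i 1) * f x) 2 :=
    memLp_mul_of_tsupport_subset measurableSet_ball hf
      ((hζ1.continuous_fderiv one_ne_zero).clm_apply continuous_const)
      (hζc.fderiv_apply (𝕜 := ℝ) _) ((tsupport_fderiv_apply_subset ℝ _).trans hζs)
  refine ⟨hu, hD2.add hv2, ?_⟩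
  intro Ψ hΨ hΨc
  have hΨ1 : ContDiff ℝ 1 Ψ := hΨ.of_le (by simp)
  have key := hgrad _ (hζ.mul hΨ) hζc.mul_right
    ((tsupport_mul_subset_left (f := ζ) (g := Ψ)).trans hζs) (EuclideanSpace.single i 1)
  have hΨ2 : MemLp Ψ 2 := hΨ1.continuous.memLp_of_hasCompactSupport hΨc
  have hdΨ : MemLp (fun p => fderiv ℝ Ψ p (EuclideanSpace.single i 1)) 2 :=
    (((hΨ1.continuous_fderiv one_ne_zero).clm_apply continuous_const)
      : Continuous fun p => fderiv ℝ Ψ p (EuclideanSpace.single i 1)).memLp_of_hasCompactSupport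
      (hΨc.fderiv_apply (𝕜 := ℝ) _)
  have i1 : Integrable fun p => ζ p * f p * fderiv ℝ Ψ p (EuclideanSpace.single i 1) :=
    hu.integrable_mul hdΨ
  have i2 : Integrable fun p => fderiv ℝ ζ p (EuclideanSpace.single i 1) * f p * Ψ p :=
    hv2.integrable_mul hΨ2
  have i3 : Integrable fun p => ζ p * F p i * Ψ p := hD2.integrable_mul hΨ2
  have e1 : ∀ p, f p * fderiv ℝ (ζ * Ψ) p
      (EuclideanSpace.single i 1) = ζ p * f p * fderiv ℝ Ψ p (EuclideanSpace.single i 1)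
        + fderiv ℝ ζ p (EuclideanSpace.single i 1) * f p * Ψ p := by
    intro p
    rw [fderiv_mul (hζ1.differentiable one_ne_zero p) (hΨ1.differentiable one_ne_zero p)]
    simp only [add_apply, smul_apply, smul_eq_mul]
    ring
  have e2 : ∀ p, (ζ * Ψ) p * ⟪F p, EuclideanSpace.single i (1 : ℝ)⟫
      = ζ p * F p i * Ψ p := by
    intro p; rw [inner_single_one, Pi.mul_apply]; ring
  change ∫ x, f x * fderiv ℝ (ζ * Ψ) x _ = -∫ x, (ζ * Ψ) x * _ at key
  simp only [e1, e2] at key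
  rw [integral_add i1 i2] at key
  have e3 : ∀ p, (ζ p * F p i + fderiv ℝ ζ p (EuclideanSpace.single i 1) * f p) * Ψ p
      = ζ p * F p i * Ψ p + fderiv ℝ ζ p (EuclideanSpace.single i 1) * f p * Ψ p := fun p => by
    ring
  simp only [e3]
  rw [integral_add i3 i2]
  linarith

lemma sobolev_truncPow (hd : 2 ≤ d) {f : Ed d → ℝ} {F : Ed d → Ed d} {x₀ : Ed d} {ρ : ℝ}
    (hf : MemLp f 2 (volume.restrict (ball x₀ ρ))) (hF : MemLp F 2 (volume.restrict (ball x₀ ρ)))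
    (hf0 : ∀ᵐ x, x ∈ ball x₀ ρ → 0 ≤ f x)
    (hgrad : ∀ φ : Ed d → ℝ, ContDiff ℝ (⊤ : ℕ∞) φ → HasCompactSupport φ →
      tsupport φ ⊆ ball x₀ ρ → ∀ e : Ed d,
      ∫ x, f x * (fderiv ℝ φ x) e = - ∫ x, φ x * ⟪F x, e⟫)
    {k : ℝ} (hk : 0 ≤ k) {β : Ed d → ℝ} (hβ : ContDiff ℝ (⊤ : ℕ∞) β) (hβc : HasCompactSupport β)
    (hβ0 : ∀ x, 0 ≤ β x) (hβt : tsupport β ⊆ ball x₀ ρ) :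
    eLpNorm (fun x => truncPow k 2 (f x) * β x) (sobolevExp d) ≤
      sobolevConst d * ∑ i, eLpNorm (sliceGrad k f F β i) 1 := by
  obtain ⟨ε, hε, -, hεU, ζ, hζ, hζc, hζs, hζ01, hζ1⟩ :=
    exists_contDiff_cutoff hβc isOpen_ball hβt
  have hsub := fun i => weakDeriv_mul_of_test hf hF hgrad hζ hζc hζs i
  obtain ⟨i₀⟩ : Nonempty (Fin d) := ⟨⟨0, by omega⟩⟩
  have hu0 : ∀ᵐ x, 0 ≤ ζ x * f x := by
    filter_upwards [hf0] with x hx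
    by_cases h : x ∈ ball x₀ ρ
    · exact mul_nonneg (hζ01 x).1 (hx h)
    · simp [image_eq_zero_of_notMem_tsupport fun h' => h (hζs h')]
  obtain ⟨ψ, hψ, hψ0, -, hψz, hψlim, hψD, -⟩ := exists_approx_truncPow_mul (hsub i₀).1 hu0 hk hβ
    hβc hβ0 (fun i => (hsub i).2.1) (fun i => (hsub i).2.2) hε
  have hζd : ∀ p ∈ tsupport β, ∀ a, fderiv ℝ ζ p a = 0 := by
    intro p hp a
    have : ζ =ᶠ[𝓝 p] fun _ => 1 := by
      filter_upwards [isOpen_thickening.mem_nhds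
        (self_subset_thickening (by positivity : 0 < 2 * ε) _ hp)] with q hq
      exact hζ1 q (thickening_subset_cthickening _ _ hq)
    rw [this.fderiv_eq]; simp
  have huf : ∀ p ∈ tsupport β, ζ p * f p = f p := fun p hp => by
    rw [hζ1 p (self_subset_cthickening _ hp), one_mul]
  have hfβ : ∀ p, p ∉ tsupport β → ∀ a, fderiv ℝ β p a = 0 := fun p hp a =>
    image_eq_zero_of_notMem_tsupport (f := fun p => fderiv ℝ β p a) fun h =>
      hp (tsupport_fderiv_apply_subset ℝ _ h)
  have hG : ∀ i, (fun p => -(2 * truncPow k 1 (ζ p * f p)) *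
      (ζ p * F p i + fderiv ℝ ζ p (EuclideanSpace.single i 1) * f p) * β p
          + truncPow k 2 (ζ p * f p) * fderiv ℝ β p (EuclideanSpace.single i 1))
        = sliceGrad k f F β i := by
    intro i
    ext p
    by_cases hp : p ∈ tsupport β
    · rw [sliceGrad, huf p hp, hζd p hp, hζ1 p (self_subset_cthickening _ hp)]
      ring
    · rw [sliceGrad, hfβ p hp, image_eq_zero_of_notMem_tsupport hp]
      simp
  simp only [hG] at hψD
  have hΦ : (fun p => truncPow k 2 (ζ p * f p) * β p) = fun p => truncPow k 2 (f p) * β p := by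
    ext p
    by_cases hp : p ∈ tsupport β
    · rw [huf p hp]
    · simp [image_eq_zero_of_notMem_tsupport hp]
  have hlim : ∀ᵐ p, Tendsto (fun n => ψ n p) atTop (𝓝 (truncPow k 2 (f p) * β p)) := by
    filter_upwards [hψlim] with p hp
    rwa [← congrFun hΦ p]
  have hψ1 : ∀ n, ContDiff ℝ 1 (ψ n) := fun n => (hψ n).of_le (by simp)
  set S := cthickening ε (tsupport β) with hS
  have hSc : IsCompact S := IsCompact.cthickening hβc
  have hSm : MeasurableSet S := hSc.isClosed.measurableSet
  have hψc : ∀ n, HasCompactSupport (ψ n) := fun n =>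
    HasCompactSupport.intro hSc fun x hx => hψz n x hx
  have hψt : ∀ n, tsupport (ψ n) ⊆ S := fun n =>
    closure_minimal (fun x hx => by by_contra h; exact hx (hψz n x h)) hSc.isClosed
  set D : ℕ → Fin d → Ed d → ℝ := fun n i =>
    (fun p => fderiv ℝ (ψ n) p (EuclideanSpace.single i 1)) - sliceGrad k f F β i with hD
  have hcm : ∀ n i, AEStronglyMeasurable
      (fun p => fderiv ℝ (ψ n) p (EuclideanSpace.single i (1 : ℝ))) volume := fun n i =>
    (((hψ1 n).continuous_fderiv one_ne_zero).clm_apply continuous_const).aestronglyMeasurable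
  have hGm : ∀ i, AEStronglyMeasurable (sliceGrad k f F β i) volume := by
    intro i
    rw [← hG i]
    have h1 := (hsub i).1.1
    have h2 := (hsub i).2.1.1
    refine AEStronglyMeasurable.add ((AEStronglyMeasurable.mul ?_ h2).mul
      hβ.continuous.aestronglyMeasurable) (AEStronglyMeasurable.mul ?_ ?_)
    · exact (((continuous_truncPow k 1).comp_aestronglyMeasurable h1).const_mul 2).neg
    · exact (continuous_truncPow k 2).comp_aestronglyMeasurable h1
    · exact (((hβ.of_le (by simp) : ContDiff ℝ 1 β).continuous_fderiv one_ne_zero).clm_apply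
        continuous_const).aestronglyMeasurable
  have hD1 : ∀ i, Tendsto (fun n => eLpNorm (D n i) 1) atTop (𝓝 0) := by
    intro i
    have hz : ∀ n, S.indicator (D n i) = D n i := by
      intro n
      ext p
      by_cases hp : p ∈ S
      · simp [hp]
      · have h1 : fderiv ℝ (ψ n) p (EuclideanSpace.single i (1 : ℝ)) = 0 :=
          image_eq_zero_of_notMem_tsupport
            (f := fun p => fderiv ℝ (ψ n) p (EuclideanSpace.single i (1 : ℝ)))
            fun h => hp (hψt n (tsupport_fderiv_apply_subset ℝ _ h))
        have hp' : p ∉ tsupport β := fun h => hp (self_subset_cthickening _ h)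
        simp [hp, hD, h1, sliceGrad, hfβ p hp', image_eq_zero_of_notMem_tsupport hp']
    have hle : ∀ n, eLpNorm (D n i) 1 ≤ eLpNorm (D n i) 2 * volume S ^ (1 / 2 : ℝ) := by
      intro n
      rw [← hz n, eLpNorm_indicator_eq_eLpNorm_restrict hSm,
        eLpNorm_indicator_eq_eLpNorm_restrict hSm]
      refine (eLpNorm_le_eLpNorm_mul_rpow_measure_univ (p := 1) (q := 2) (by norm_num)
        ((hcm n i).sub (hGm i)).restrict).trans (le_of_eq ?_)
      have e : 1 / (1 : ℝ≥0∞).toReal - 1 / (2 : ℝ≥0∞).toReal = 1 / 2 := by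
        rw [ENNReal.toReal_one, ENNReal.toReal_ofNat]; norm_num
      rw [Measure.restrict_apply_univ, e]
    have h0 : Tendsto (fun n => eLpNorm (D n i) 2 * volume S ^ (1 / 2 : ℝ)) atTop (𝓝 0) := by
      have := ENNReal.Tendsto.mul_const (b := volume S ^ (1 / 2 : ℝ)) (hψD i)
        (Or.inr (ENNReal.rpow_ne_top_of_nonneg (by norm_num) hSc.measure_lt_top.ne))
      rwa [zero_mul] at this
    exact tendsto_of_tendsto_of_tendsto_of_le_of_le tendsto_const_nhds h0 (fun _ => bot_le) hle
  have hb : ∀ n, eLpNorm (ψ n) (sobolevExp d) ≤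
      sobolevConst d * ∑ i, (eLpNorm (D n i) 1 + eLpNorm (sliceGrad k f F β i) 1) := by
    intro n
    refine (eLpNorm_le_eLpNorm_fderiv_one volume (hψ1 n) (hψc n) (sobolevExp_conj hd)).trans ?_
    refine mul_le_mul_right ?_ _
    calc eLpNorm (fderiv ℝ (ψ n)) 1 volume
        ≤ ∑ i, eLpNorm (fun p => fderiv ℝ (ψ n) p (EuclideanSpace.single i (1 : ℝ))) 1 := by
          simp only [eLpNorm_one_eq_lintegral_enorm]
          rw [← lintegral_finsetSum' _ fun i _ => (hcm n i).enorm]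
          exact lintegral_mono fun p => enorm_clm_le_sum _
      _ ≤ _ := Finset.sum_le_sum fun i _ => by
          have e : (fun p => fderiv ℝ (ψ n) p (EuclideanSpace.single i (1 : ℝ)))
              = D n i + sliceGrad k f F β i := (sub_add_cancel _ _).symm
          rw [e]
          exact eLpNorm_add_le ((hcm n i).sub (hGm i)) (hGm i) le_rfl
  refine (Lp.eLpNorm_lim_le_liminf_eLpNorm (fun n => (hψ n).continuous.aestronglyMeasurable)
    _ hlim).trans ?_
  refine (liminf_le_liminf (Eventually.of_forall hb)).trans (le_of_eq ?_)
  refine Tendsto.liminf_eq ?_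
  refine ENNReal.Tendsto.const_mul ?_ (Or.inr ENNReal.coe_ne_top)
  refine tendsto_finsetSum _ fun i _ => ?_
  simpa using (hD1 i).add tendsto_const_nhds

section Slices

variable {s Λ : ℝ} {A : ℝ → Ed d → Ed d → Ed d} {K : ℝ → Ed d → Ed d → ℝ}
  {v : ℝ → Ed d → ℝ} {Dv : ℝ → Ed d → Ed d} {t₀ : ℝ} {x₀ : Ed d} {R : ℝ}

/-- A radial cutoff function equal to one on `ball x₀ r'` and vanishing outside `ball x₀ r`. -/
def radialCutoff (x₀ : Ed d) (r' r : ℝ) (x : Ed d) : ℝ :=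
  Real.smoothTransition ((r ^ 2 - ‖x - x₀‖ ^ 2) / (r ^ 2 - r' ^ 2))

lemma radialCutoff_contDiff (x₀ : Ed d) (r' r : ℝ) :
    ContDiff ℝ (⊤ : ℕ∞) (radialCutoff x₀ r' r) :=
  Real.smoothTransition.contDiff.comp
    ((contDiff_const.sub ((contDiff_id.sub contDiff_const).norm_sq ℝ)).div_const _)

lemma radialCutoff_mem (x₀ : Ed d) (r' r : ℝ) (x : Ed d) :
    radialCutoff x₀ r' r x ∈ Icc (0 : ℝ) 1 :=
  ⟨Real.smoothTransition.nonneg _, Real.smoothTransition.le_one _⟩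

lemma radialCutoff_eq_one {r' r : ℝ} (h0 : 0 < r') (h : r' < r) {x : Ed d} (hx : x ∈ ball x₀ r') :
    radialCutoff x₀ r' r x = 1 := by
  rw [mem_ball, dist_eq_norm] at hx
  refine Real.smoothTransition.one_of_one_le ?_
  have h1 : 0 < r ^ 2 - r' ^ 2 := by nlinarith
  rw [le_div_iff₀ h1]
  nlinarith [norm_nonneg (x - x₀)]

lemma radialCutoff_eq_zero {r' r : ℝ} (h0 : 0 < r') (h : r' < r) {x : Ed d}
    (hx : x ∉ ball x₀ r) : radialCutoff x₀ r' r x = 0 := by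
  rw [mem_ball, dist_eq_norm, not_lt] at hx
  refine Real.smoothTransition.zero_of_nonpos (div_nonpos_of_nonpos_of_nonneg ?_ ?_) <;>
    nlinarith

lemma tsupport_radialCutoff_subset {r' r : ℝ} (h0 : 0 < r') (h : r' < r) :
    tsupport (radialCutoff x₀ r' r) ⊆ closedBall x₀ r :=
  closure_minimal (fun x hx => by
    by_contra h'
    exact hx (radialCutoff_eq_zero h0 h fun h'' => h' (ball_subset_closedBall h'')))
    isClosed_closedBall

lemma radialCutoff_lipschitz {C : ℝ}
    (hC : ∀ x y, |Real.smoothTransition x - Real.smoothTransition y| ≤ C * |x - y|)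
    {r' r : ℝ} (h0 : 0 < r') (h : r' < r) (x y : Ed d) :
    |radialCutoff x₀ r' r x - radialCutoff x₀ r' r y| ≤ 2 * C / (r - r') * ‖x - y‖ := by
  have hC0 : 0 ≤ C := by
    have := (abs_nonneg _).trans (hC 1 0)
    simpa using this
  have h1 : 0 < r ^ 2 - r' ^ 2 := by nlinarith
  have key : ∀ z : Ed d, radialCutoff x₀ r' r z
      = Real.smoothTransition ((r ^ 2 - min ‖z - x₀‖ r ^ 2) / (r ^ 2 - r' ^ 2)) := by
    intro z
    by_cases hz : z ∈ ball x₀ r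
    · have hz' := hz
      rw [mem_ball, dist_eq_norm] at hz'
      rw [min_eq_left hz'.le, radialCutoff]
    · have hz' := hz
      rw [mem_ball, dist_eq_norm, not_lt] at hz'
      rw [radialCutoff_eq_zero h0 h hz, min_eq_right hz', sub_self, zero_div,
        Real.smoothTransition.zero_of_nonpos le_rfl]
  have hm : ∀ z : Ed d, 0 ≤ min ‖z - x₀‖ r ∧ min ‖z - x₀‖ r ≤ r := fun z =>
    ⟨le_min (norm_nonneg _) (by linarith), min_le_right _ _⟩
  have hmin : |min ‖x - x₀‖ r - min ‖y - x₀‖ r| ≤ ‖x - y‖ := by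
    refine (abs_min_sub_min_le_max _ _ _ _).trans (max_le ?_ (by simp))
    refine (abs_norm_sub_norm_le _ _).trans (le_of_eq ?_)
    congr 1; abel
  rw [key, key]
  refine (hC _ _).trans ?_
  set a := min ‖x - x₀‖ r
  set b := min ‖y - x₀‖ r
  have e : (r ^ 2 - a ^ 2) / (r ^ 2 - r' ^ 2) - (r ^ 2 - b ^ 2) / (r ^ 2 - r' ^ 2)
      = (b + a) * (b - a) / (r ^ 2 - r' ^ 2) := by ring
  rw [e, abs_div, abs_of_pos h1, abs_mul, abs_sub_comm b a,
    abs_of_nonneg (add_nonneg (hm y).1 (hm x).1)]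
  have h2 : (b + a) * |a - b| ≤ 2 * r * ‖x - y‖ :=
    mul_le_mul (by linarith [(hm x).2, (hm y).2]) hmin (abs_nonneg _) (by linarith)
  have h3 : r * (r - r') ≤ r ^ 2 - r' ^ 2 := by nlinarith
  have h4 : 0 < r * (r - r') := mul_pos (by linarith) (by linarith)
  calc C * ((b + a) * |a - b| / (r ^ 2 - r' ^ 2))
      ≤ C * (2 * r * ‖x - y‖ / (r * (r - r'))) := by
        refine mul_le_mul_of_nonneg_left ?_ hC0
        exact div_le_div₀ (mul_nonneg (by linarith) (norm_nonneg _)) h2 h4 h3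
    _ = _ := by
        have : r ≠ 0 := by linarith
        have : r - r' ≠ 0 := by linarith
        field_simp

lemma CylSuper.ae_memLp_slice (hC : CylSuper s Λ A K v Dv t₀ x₀ R) :
    ∀ᵐ t, t ∈ Iminus t₀ (2 * R) → MemLp (v t) 2 (volume.restrict (ball x₀ (2 * R))) ∧
      MemLp (Dv t) 2 (volume.restrict (ball x₀ (2 * R))) := by
  refine (ae_restrict_iff' (measurableSet_Ioo : MeasurableSet (Iminus t₀ (2 * R)))).1 ?_
  have e : volume.restrict (pCyl t₀ x₀ (2 * R)) = (volume.restrict (Iminus t₀ (2 * R))).prod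
      (volume.restrict (ball x₀ (2 * R))) := by
    rw [Measure.prod_restrict, ← Measure.volume_eq_prod]; rfl
  have h1 := hC.memLp
  have h2 := hC.memLpD
  rw [e] at h1 h2
  have h1' := (memLp_two_iff_integrable_sq_norm h1.1).1 h1
  have h2' := (memLp_two_iff_integrable_sq_norm h2.1).1 h2
  filter_upwards [h1'.prod_right_ae, h2'.prod_right_ae] with t ht1 ht2
  have m1 : Measurable (v t) := hC.meas.comp measurable_prodMk_left
  have m2 : Measurable (Dv t) := hC.measD.comp measurable_prodMk_left
  exact ⟨(memLp_two_iff_integrable_sq_norm m1.aestronglyMeasurable).2 ht1,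
    (memLp_two_iff_integrable_sq_norm m2.aestronglyMeasurable).2 ht2⟩

lemma measurableSet_sublevel (hv : Measurable (Function.uncurry v)) (k r t : ℝ) :
    MeasurableSet {x | x ∈ ball x₀ r ∧ v t x < k} :=
  measurableSet_ball.inter
    (measurableSet_lt (hv.comp measurable_prodMk_left) measurable_const)

variable {k k' r r' : ℝ} {η : Ed d → ℝ}

/-- Two-sided bound of the mass at level `k` by measures of sublevel sets. -/
lemma levelMass_bounds (hv : Measurable (Function.uncurry v)) {t : ℝ} (hk : 0 ≤ k) (hkk : k' ≤ k)
    (hη : Continuous η) (hη01 : ∀ x, η x ∈ Icc (0 : ℝ) 1) (hη0 : ∀ x ∉ ball x₀ r, η x = 0)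
    (hη1 : ∀ x ∈ ball x₀ r', η x = 1) (hv0 : ∀ᵐ x, x ∈ ball x₀ r → 0 ≤ v t x) :
    ENNReal.ofReal ((k - k') ^ 3 / 3) * subVol v x₀ k' r' t
      ≤ ENNReal.ofReal (levelMass v k η t) ∧
    ENNReal.ofReal (levelMass v k η t) ≤ ENNReal.ofReal (k ^ 3) * subVol v x₀ k r t := by
  have m1 : Measurable (v t) := hv.comp measurable_prodMk_left
  have m2 : Measurable fun x => truncPow k 3 (v t x) / 3 * η x ^ 2 :=
    (((continuous_truncPow k 3).measurable.comp m1).div_const 3).mul (hη.measurable.pow_const 2)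
  have hnn : ∀ x, 0 ≤ truncPow k 3 (v t x) / 3 * η x ^ 2 := fun x =>
    mul_nonneg (div_nonneg (truncPow_nonneg _ _ _) (by norm_num)) (sq_nonneg _)
  have hub : ∀ᵐ x, ENNReal.ofReal (truncPow k 3 (v t x) / 3 * η x ^ 2) ≤
      {x | x ∈ ball x₀ r ∧ v t x < k}.indicator (fun _ => ENNReal.ofReal (k ^ 3)) x := by
    filter_upwards [hv0] with x hx
    by_cases hxb : x ∈ ball x₀ r
    · by_cases hxk : v t x < k
      · rw [indicator_of_mem (show x ∈ {x | x ∈ ball x₀ r ∧ v t x < k} from ⟨hxb, hxk⟩)]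
        refine ENNReal.ofReal_le_ofReal ?_
        have h1 := truncPow_le hk 3 (hx hxb)
        have h2 : η x ^ 2 ≤ 1 := pow_le_one₀ (hη01 x).1 (hη01 x).2
        have h3 := truncPow_nonneg k 3 (v t x)
        calc truncPow k 3 (v t x) / 3 * η x ^ 2 ≤ truncPow k 3 (v t x) / 3 * 1 := by gcongr
          _ ≤ k ^ 3 := by linarith
      · rw [truncPow_eq_zero (by norm_num) (not_lt.1 hxk)]
        simp
    · rw [hη0 x hxb]; simp
  have hle := lintegral_mono_ae hub
  rw [lintegral_indicator_const (measurableSet_sublevel hv k r t)] at hle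
  have hfin : ∫⁻ x, ENNReal.ofReal (truncPow k 3 (v t x) / 3 * η x ^ 2) ≠ ∞ := by
    refine ne_top_of_le_ne_top (ENNReal.mul_ne_top ENNReal.ofReal_ne_top ?_) hle
    exact ((measure_mono fun x hx => hx.1).trans_lt measure_ball_lt_top).ne
  have heq : ENNReal.ofReal (levelMass v k η t)
      = ∫⁻ x, ENNReal.ofReal (truncPow k 3 (v t x) / 3 * η x ^ 2) := by
    rw [levelMass, integral_eq_lintegral_of_nonneg_ae (ae_of_all _ hnn) m2.aestronglyMeasurable,
      ENNReal.ofReal_toReal hfin]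
  rw [heq]
  refine ⟨?_, hle⟩
  rw [subVol, ← lintegral_indicator_const (measurableSet_sublevel hv k' r' t)]
  refine lintegral_mono fun x => ?_
  by_cases hx : x ∈ {x | x ∈ ball x₀ r' ∧ v t x < k'}
  · rw [indicator_of_mem hx, hη1 x hx.1, one_pow, mul_one]
    refine ENNReal.ofReal_le_ofReal ?_
    have h1 : k - k' ≤ max (k - v t x) 0 := (by linarith [hx.2] : k - k' ≤ k - v t x).trans
      (le_max_left _ _)
    have h2 : (k - k') ^ 3 ≤ truncPow k 3 (v t x) := pow_le_pow_left₀ (by linarith) h1 3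
    linarith
  · rw [indicator_of_notMem hx]; exact bot_le

lemma eLpNorm_truncPow_ge (hd : 2 ≤ d) (hv : Measurable (Function.uncurry v)) {t : ℝ}
    (hkk : k' ≤ k) (hη1 : ∀ x ∈ ball x₀ r', η x = 1) :
    ENNReal.ofReal ((k - k') ^ 2) * subVol v x₀ k' r' t ^ (1 - 1 / (d : ℝ))
      ≤ eLpNorm (fun x => truncPow k 2 (v t x) * η x ^ 2) (sobolevExp d) := by
  have hc := (sobolevExp_conj hd).coe
  have hd0 : (0 : ℝ) < d := by exact_mod_cast (by omega : 0 < d)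
  have hp : (1 : ℝ) - 1 / d = 1 / (sobolevExp d : ℝ) := by
    have := hc.inv_add_inv_eq_one
    rw [finrank_euclideanSpace_fin] at this
    simp only [NNReal.coe_natCast] at this
    rw [one_div, one_div]; linarith
  have hp0 : (sobolevExp d : ℝ≥0∞) ≠ 0 := by
    exact_mod_cast (sobolevExp_conj hd).symm.pos.ne'
  have e := eLpNorm_indicator_const (μ := (volume : Measure (Ed d))) (c := (k - k') ^ 2)
    (p := sobolevExp d) (measurableSet_sublevel (x₀ := x₀) hv k' r' t) hp0 ENNReal.coe_ne_top
  rw [ENNReal.coe_toReal, ← hp, Real.enorm_of_nonneg (sq_nonneg _)] at e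
  rw [subVol, ← e]
  refine eLpNorm_mono fun x => ?_
  by_cases hx : x ∈ {x | x ∈ ball x₀ r' ∧ v t x < k'}
  · rw [indicator_of_mem hx, hη1 x hx.1, one_pow, mul_one, Real.norm_of_nonneg (sq_nonneg _),
      Real.norm_of_nonneg (truncPow_nonneg _ _ _)]
    exact pow_le_pow_left₀ (by linarith)
      ((by linarith [hx.2] : k - k' ≤ k - v t x).trans (le_max_left _ _)) 2
  · rw [indicator_of_notMem hx, norm_zero]; exact norm_nonneg _

lemma levelEnergy_nonneg (hΛ : 0 ≤ Λ) (t : ℝ) : 0 ≤ levelEnergy Λ v Dv k η t :=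
  integral_nonneg fun _ => mul_nonneg (mul_nonneg (mul_nonneg (inv_nonneg.2 hΛ)
    (truncPow_nonneg _ _ _)) (sq_nonneg _)) (sq_nonneg _)

lemma levelMass_nonneg (t : ℝ) : 0 ≤ levelMass v k η t :=
  integral_nonneg fun _ => mul_nonneg (div_nonneg (truncPow_nonneg _ _ _) (by norm_num))
    (sq_nonneg _)

lemma ofReal_levelEnergy (hΛ : 0 ≤ Λ) (hv : Measurable (Function.uncurry v))
    (hD : Measurable (Function.uncurry Dv)) {t : ℝ} (hk : 0 ≤ k) (hη : Continuous η)
    (hη01 : ∀ x, η x ∈ Icc (0 : ℝ) 1) {ρ : ℝ} (hη0 : ∀ x ∉ ball x₀ ρ, η x = 0)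
    (hv0 : ∀ᵐ x, x ∈ ball x₀ ρ → 0 ≤ v t x)
    (hF : MemLp (Dv t) 2 (volume.restrict (ball x₀ ρ))) :
    ENNReal.ofReal (levelEnergy Λ v Dv k η t)
      = ∫⁻ x, ENNReal.ofReal (Λ⁻¹ * truncPow k 1 (v t x) * η x ^ 2 * ‖Dv t x‖ ^ 2) := by
  have m1 : Measurable (v t) := hv.comp measurable_prodMk_left
  have m2 : Measurable (Dv t) := hD.comp measurable_prodMk_left
  have m3 : Measurable fun x => Λ⁻¹ * truncPow k 1 (v t x) * η x ^ 2 * ‖Dv t x‖ ^ 2 :=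
    ((((continuous_truncPow k 1).measurable.comp m1).const_mul _).mul
      (hη.measurable.pow_const 2)).mul (m2.norm.pow_const 2)
  have hnn : ∀ x, 0 ≤ Λ⁻¹ * truncPow k 1 (v t x) * η x ^ 2 * ‖Dv t x‖ ^ 2 := fun x =>
    mul_nonneg (mul_nonneg (mul_nonneg (inv_nonneg.2 hΛ) (truncPow_nonneg _ _ _)) (sq_nonneg _))
      (sq_nonneg _)
  have hi : Integrable fun x => Λ⁻¹ * truncPow k 1 (v t x) * η x ^ 2 * ‖Dv t x‖ ^ 2 := by
    have h1 : Integrable fun x => (ball x₀ ρ).indicator (fun x => ‖Dv t x‖ ^ 2) x :=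
      (integrable_indicator_iff measurableSet_ball).2
        ((memLp_two_iff_integrable_sq_norm m2.aestronglyMeasurable).1 hF)
    refine (h1.const_mul (Λ⁻¹ * k)).mono' m3.aestronglyMeasurable ?_
    filter_upwards [hv0] with x hx
    rw [Real.norm_of_nonneg (hnn x)]
    by_cases hxb : x ∈ ball x₀ ρ
    · rw [indicator_of_mem hxb]
      have h1 := truncPow_le hk 1 (hx hxb)
      rw [pow_one] at h1
      have h2 : η x ^ 2 ≤ 1 := pow_le_one₀ (hη01 x).1 (hη01 x).2
      have h3 := truncPow_nonneg k 1 (v t x)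
      have h4 := inv_nonneg.2 hΛ
      calc Λ⁻¹ * truncPow k 1 (v t x) * η x ^ 2 * ‖Dv t x‖ ^ 2
          ≤ Λ⁻¹ * k * 1 * ‖Dv t x‖ ^ 2 := by gcongr
        _ = _ := by ring
    · rw [hη0 x hxb, indicator_of_notMem hxb]; simp
  rw [levelEnergy, ofReal_integral_eq_lintegral_ofReal hi (ae_of_all _ hnn)]

lemma lintegral_sliceGrad_le (hΛ : 0 < Λ) (hv : Measurable (Function.uncurry v))
    (hD : Measurable (Function.uncurry Dv)) {t : ℝ} (hk : 0 ≤ k) (hη : ContDiff ℝ (⊤ : ℕ∞) η)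
    (hη01 : ∀ x, η x ∈ Icc (0 : ℝ) 1) {L : ℝ} (hL : 0 ≤ L)
    (hηL : ∀ x y, |η x - η y| ≤ L * ‖x - y‖) {ρ : ℝ} (hrρ : r ≤ ρ)
    (hη0 : ∀ x ∉ ball x₀ r, η x = 0) (hv0 : ∀ᵐ x, x ∈ ball x₀ ρ → 0 ≤ v t x)
    (hF : MemLp (Dv t) 2 (volume.restrict (ball x₀ ρ))) {μ : ℝ} (hμ : 0 < μ) (i : Fin d) :
    eLpNorm (sliceGrad k (v t) (Dv t) (fun x => η x ^ 2) i) 1 ≤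
      ENNReal.ofReal (Λ * μ) * ENNReal.ofReal (levelEnergy Λ v Dv k η t)
        + ENNReal.ofReal (k / μ + 2 * L * k ^ 2) * subVol v x₀ k r t := by
  have m1 : Measurable (v t) := hv.comp measurable_prodMk_left
  have hηρ : ∀ x ∉ ball x₀ ρ, η x = 0 := fun x hx => hη0 x fun h => hx (ball_subset_ball hrρ h)
  rw [ofReal_levelEnergy hΛ.le hv hD hk hη.continuous hη01 hηρ hv0 hF, subVol,
    ← lintegral_indicator_const (measurableSet_sublevel hv k r t),
    ← lintegral_const_mul' _ _ ENNReal.ofReal_ne_top, ← lintegral_add_right _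
      (measurable_const.indicator (measurableSet_sublevel hv k r t)),
    eLpNorm_one_eq_lintegral_enorm]
  refine lintegral_mono_ae ?_
  filter_upwards [hv0] with x hx
  have hη1 : ContDiff ℝ 1 η := hη.of_le (by simp)
  have hfd : fderiv ℝ (fun x => η x ^ 2) x (EuclideanSpace.single i 1)
      = 2 * η x * fderiv ℝ η x (EuclideanSpace.single i 1) := by
    rw [show (fun x => η x ^ 2) = fun x => η x * η x by ext; ring,
      fderiv_fun_mul (hη1.differentiable one_ne_zero x) (hη1.differentiable one_ne_zero x)]
    simp only [add_apply, smul_apply, smul_eq_mul]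
    ring
  by_cases hS : x ∈ {x | x ∈ ball x₀ r ∧ v t x < k}
  · rw [indicator_of_mem hS, ← ENNReal.ofReal_mul (by positivity), Real.enorm_eq_ofReal_abs]
    have hw := truncPow_le hk 1 (hx (ball_subset_ball hrρ hS.1))
    have hw0 := truncPow_nonneg k 1 (v t x)
    rw [← ENNReal.ofReal_add (mul_nonneg (by positivity) (mul_nonneg (mul_nonneg (mul_nonneg
      (inv_nonneg.2 hΛ.le) hw0) (sq_nonneg _)) (sq_nonneg _))) (by positivity)]
    refine ENNReal.ofReal_le_ofReal ?_
    have hf' : |fderiv ℝ η x (EuclideanSpace.single i 1)| ≤ L := by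
      have h1 : ‖fderiv ℝ η x‖ ≤ L := norm_fderiv_le_of_lip' ℝ hL
        (Eventually.of_forall fun y => by rw [Real.norm_eq_abs]; exact hηL y x)
      have h2 := (fderiv ℝ η x).le_opNorm (EuclideanSpace.single i (1 : ℝ))
      rw [PiLp.norm_single, norm_one, mul_one] at h2
      exact h2.trans h1
    rw [sliceGrad, hfd]
    have e2 : truncPow k 2 (v t x) = truncPow k 1 (v t x) ^ 2 := by simp [truncPow]
    rw [e2]
    rw [pow_one] at hw
    generalize truncPow k 1 (v t x) = w at hw hw0 ⊢
    have hDi : |Dv t x i| ≤ ‖Dv t x‖ := PiLp.norm_apply_le (Dv t x) i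
    have he0 := (hη01 x).1
    have he1 := (hη01 x).2
    have he2 : η x ^ 2 ≤ 1 := pow_le_one₀ he0 he1
    have n0 := norm_nonneg (Dv t x)
    refine (abs_add_le _ _).trans (le_trans (b := 2 * w * ‖Dv t x‖ * η x ^ 2
      + w ^ 2 * (2 * η x * L)) ?_ ?_)
    · refine add_le_add (le_of_eq_of_le (b := 2 * w * |Dv t x i| * η x ^ 2) ?_ ?_) ?_
      · rw [abs_mul, abs_mul, abs_neg, abs_of_nonneg (by positivity : 0 ≤ 2 * w),
          abs_of_nonneg (sq_nonneg (η x))]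
      · gcongr
      · rw [abs_mul, abs_mul, abs_of_nonneg (sq_nonneg w),
          abs_of_nonneg (by positivity : 0 ≤ 2 * η x)]
        gcongr
    · have h1 : 2 * ‖Dv t x‖ ≤ μ * ‖Dv t x‖ ^ 2 + 1 / μ := by
        have h2 : 0 ≤ (μ * ‖Dv t x‖ - 1) ^ 2 / μ := by positivity
        have h3 : (μ * ‖Dv t x‖ - 1) ^ 2 / μ = μ * ‖Dv t x‖ ^ 2 + 1 / μ - 2 * ‖Dv t x‖ := by
          field_simp; ring
        linarith
      have h4 : 2 * w * ‖Dv t x‖ * η x ^ 2 ≤ w * η x ^ 2 * (μ * ‖Dv t x‖ ^ 2 + 1 / μ) := by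
        calc 2 * w * ‖Dv t x‖ * η x ^ 2 = w * η x ^ 2 * (2 * ‖Dv t x‖) := by ring
          _ ≤ _ := by gcongr
      have h5 : w * η x ^ 2 * (1 / μ) ≤ k / μ := by
        calc w * η x ^ 2 * (1 / μ) ≤ k * 1 * (1 / μ) := by gcongr
          _ = k / μ := by ring
      have h6 : w ^ 2 * (2 * η x * L) ≤ 2 * L * k ^ 2 := by
        calc w ^ 2 * (2 * η x * L) ≤ k ^ 2 * (2 * 1 * L) := by gcongr
          _ = _ := by ring
      have h7 : Λ * μ * (Λ⁻¹ * w * η x ^ 2 * ‖Dv t x‖ ^ 2) = w * η x ^ 2 * (μ * ‖Dv t x‖ ^ 2) := by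
        field_simp
      rw [h7]
      linarith
  · have h0 : sliceGrad k (v t) (Dv t) (fun x => η x ^ 2) i x = 0 := by
      rw [sliceGrad, hfd]
      by_cases hxb : x ∈ ball x₀ r
      · have hxk : k ≤ v t x := not_lt.1 fun h => hS ⟨hxb, h⟩
        rw [truncPow_eq_zero one_ne_zero hxk, truncPow_eq_zero two_ne_zero hxk]
        ring
      · rw [hη0 x hxb]; ring
    rw [h0, enorm_zero]
    exact bot_le

end Slices

lemma ENNReal.le_of_ofReal_mul_le {c e : ℝ} {a X : ℝ≥0∞} (hc : 0 < c)
    (h : ENNReal.ofReal c * a ≤ ENNReal.ofReal e * X) : a ≤ ENNReal.ofReal (e / c) * X := by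
  have h1 : ENNReal.ofReal c⁻¹ * ENNReal.ofReal c = 1 := by
    rw [← ENNReal.ofReal_mul (inv_nonneg.2 hc.le), inv_mul_cancel₀ hc.ne', ENNReal.ofReal_one]
  calc a = ENNReal.ofReal c⁻¹ * (ENNReal.ofReal c * a) := by rw [← mul_assoc, h1, one_mul]
    _ ≤ ENNReal.ofReal c⁻¹ * (ENNReal.ofReal e * X) := by gcongr
    _ = _ := by
      rw [← mul_assoc, ← ENNReal.ofReal_mul (inv_nonneg.2 hc.le), div_eq_inv_mul]

/-- The sublevel measure weighted with the tail, integrated in time. -/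
def weightedVol (s : ℝ) (v : ℝ → Ed d → ℝ) (t₀ : ℝ) (x₀ : Ed d) (R H k r T : ℝ) : ℝ≥0∞ :=
  ∫⁻ t in Ioo T t₀,
    subVol v x₀ k r t * (1 + ENNReal.ofReal (R ^ 2 / H) * negTail s v x₀ R t)

lemma energySource_le {s Λ : ℝ} (hd : 2 ≤ d) (hs : s ∈ Ioo (0 : ℝ) 1) (hΛ : 1 ≤ Λ)
    {v : ℝ → Ed d → ℝ} {x₀ : Ed d} {R H k r L B ℓ t : ℝ} (hR : 0 < R) (hH : 0 < H)
    (hk : 0 ≤ k) (hkH : k ≤ H) (hL : L = B * ℓ / R) :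
    energySource s Λ v x₀ R k r L t ≤
      ENNReal.ofReal ((Λ ^ 3 * B ^ 2 + 8 * Λ * B ^ 2 * ((levyConst d s).toReal
        + 2 ^ ((d : ℝ) + 2 * s))) * (ℓ ^ 2 * H ^ 3 / R ^ 2)) *
      (subVol v x₀ k r t * (1 + ENNReal.ofReal (R ^ 2 / H) * negTail s v x₀ R t)) := by
  obtain ⟨lc, hlc⟩ : ∃ lc, lc = (levyConst d s).toReal := ⟨_, rfl⟩
  obtain ⟨P, hP⟩ : ∃ P, P = ℓ ^ 2 * H ^ 3 / R ^ 2 := ⟨_, rfl⟩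
  obtain ⟨w, hw⟩ : ∃ w : ℝ, w = 2 ^ ((d : ℝ) + 2 * s) := ⟨_, rfl⟩
  have hw0 : 0 < w := by rw [hw]; positivity
  have hlc0 : 0 ≤ lc := by rw [hlc]; exact ENNReal.toReal_nonneg
  have hP0 : 0 ≤ P := by rw [hP]; positivity
  have hΛ0 : 0 < Λ := by linarith
  have hlce : levyConst d s = ENNReal.ofReal lc := by
    rw [hlc, ENNReal.ofReal_toReal (levyConst_ne_top hd hs)]
  rw [energySource, jumpDensity, ← hlc, hlce, ← hP, ← hw]
  set a := subVol v x₀ k r t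
  set n := negTail s v x₀ R t
  have hk2 : k ^ 2 ≤ H ^ 2 := by gcongr
  have hk3 : k ^ 3 ≤ H ^ 3 := by gcongr
  have hL2 : L ^ 2 = B ^ 2 * ℓ ^ 2 / R ^ 2 := by rw [hL]; field_simp
  have c2 : ENNReal.ofReal (Λ ^ 3 * L ^ 2 * k ^ 3) ≤ ENNReal.ofReal (Λ ^ 3 * B ^ 2 * P) := by
    refine ENNReal.ofReal_le_ofReal ?_
    calc Λ ^ 3 * L ^ 2 * k ^ 3 ≤ Λ ^ 3 * L ^ 2 * H ^ 3 := by gcongr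
      _ = _ := by rw [hL2, hP]; ring
  have c3 : ENNReal.ofReal (8 * k ^ 2 * Λ * L ^ 2) * (ENNReal.ofReal lc * ENNReal.ofReal k)
      ≤ ENNReal.ofReal (8 * Λ * B ^ 2 * lc * P) := by
    rw [← ENNReal.ofReal_mul hlc0, ← ENNReal.ofReal_mul (by positivity)]
    refine ENNReal.ofReal_le_ofReal ?_
    calc 8 * k ^ 2 * Λ * L ^ 2 * (lc * k) = 8 * Λ * L ^ 2 * lc * k ^ 3 := by ring
      _ ≤ 8 * Λ * L ^ 2 * lc * H ^ 3 := by gcongr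
      _ = _ := by rw [hL2, hP]; ring
  have c4 : ENNReal.ofReal (8 * k ^ 2 * Λ * L ^ 2) * ENNReal.ofReal (w * R ^ 2)
      ≤ ENNReal.ofReal (8 * Λ * B ^ 2 * w * P) * ENNReal.ofReal (R ^ 2 / H) := by
    rw [← ENNReal.ofReal_mul (by positivity), ← ENNReal.ofReal_mul (by positivity)]
    refine ENNReal.ofReal_le_ofReal ?_
    calc 8 * k ^ 2 * Λ * L ^ 2 * (w * R ^ 2) ≤ 8 * H ^ 2 * Λ * L ^ 2 * (w * R ^ 2) := by gcongr
      _ = _ := by rw [hL2, hP]; field_simp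
  have hsum : ENNReal.ofReal ((Λ ^ 3 * B ^ 2 + 8 * Λ * B ^ 2 * (lc + w)) * P)
      = ENNReal.ofReal (Λ ^ 3 * B ^ 2 * P) + ENNReal.ofReal (8 * Λ * B ^ 2 * lc * P)
        + ENNReal.ofReal (8 * Λ * B ^ 2 * w * P) := by
    rw [← ENNReal.ofReal_add (by positivity) (by positivity),
      ← ENNReal.ofReal_add (by positivity) (by positivity)]
    congr 1; ring
  rw [hsum]
  generalize ENNReal.ofReal (Λ ^ 3 * B ^ 2 * P) = C2 at *
  generalize ENNReal.ofReal (8 * Λ * B ^ 2 * lc * P) = C3 at *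
  generalize ENNReal.ofReal (8 * Λ * B ^ 2 * w * P) = C4 at *
  calc ENNReal.ofReal (Λ ^ 3 * L ^ 2 * k ^ 3) * a + ENNReal.ofReal (8 * k ^ 2 * Λ * L ^ 2) * a *
        (ENNReal.ofReal lc * ENNReal.ofReal k + ENNReal.ofReal (w * R ^ 2) * n)
      = ENNReal.ofReal (Λ ^ 3 * L ^ 2 * k ^ 3) * a
        + ENNReal.ofReal (8 * k ^ 2 * Λ * L ^ 2) * (ENNReal.ofReal lc * ENNReal.ofReal k) * a
        + ENNReal.ofReal (8 * k ^ 2 * Λ * L ^ 2) * ENNReal.ofReal (w * R ^ 2) * (a * n) := by ring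
    _ ≤ C2 * a + C3 * a + C4 * ENNReal.ofReal (R ^ 2 / H) * (a * n) := by gcongr
    _ ≤ C2 * a + C3 * a + C4 * ENNReal.ofReal (R ^ 2 / H) * (a * n)
        + (C4 * a + (C2 + C3) * (a * (ENNReal.ofReal (R ^ 2 / H) * n))) := le_self_add
    _ = _ := by ring

set_option maxHeartbeats 800000 in
lemma exists_level_step {s Λ : ℝ} (hd : 2 ≤ d) (hs : s ∈ Ioo (0 : ℝ) 1) (hΛ : 1 ≤ Λ) :
    ∃ M : ℝ, 1 ≤ M ∧ ∀ {A : ℝ → Ed d → Ed d → Ed d} {K : ℝ → Ed d → Ed d → ℝ}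
      {v : ℝ → Ed d → ℝ} {Dv : ℝ → Ed d → Ed d} {t₀ : ℝ} {x₀ : Ed d} {R : ℝ},
      CylSuper s Λ A K v Dv t₀ x₀ R → ∀ {H ℓ k k' r r' T₀ T₁ : ℝ}, 0 < H → 1 ≤ ℓ → 0 ≤ k → k ≤ H →
      H / ℓ ≤ k - k' → r ≤ R → 0 < r' → R / ℓ ≤ r - r' → t₀ - (2 * R) ^ 2 < T₀ →
      R ^ 2 / ℓ ≤ T₁ - T₀ → T₁ < t₀ →
      (∀ᵐ t, t ∈ Ioo T₁ t₀ → subVol v x₀ k' r' t ≤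
        ENNReal.ofReal (M * ℓ ^ 5 / R ^ 2) * weightedVol s v t₀ x₀ R H k r T₀) ∧
      ∫⁻ t in Ioo T₁ t₀, subVol v x₀ k' r' t ^ (1 - 1 / (d : ℝ)) ≤
        ENNReal.ofReal (M * ℓ ^ 5 / R) * weightedVol s v t₀ x₀ R H k r T₀ := by
  obtain ⟨C, hC1, hCd, hCl⟩ := exists_smoothTransition_lipschitz
  obtain ⟨B, hB⟩ : ∃ B, B = 2 * C := ⟨_, rfl⟩
  obtain ⟨N, hN⟩ : ∃ N, N = Λ ^ 3 * B ^ 2 + 8 * Λ * B ^ 2 * ((levyConst d s).toReal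
        + 2 ^ ((d : ℝ) + 2 * s)) := ⟨_, rfl⟩
  have hB0 : 0 < B := by linarith
  have hN0 : 0 ≤ N := by
    rw [hN]
    have h1 : 0 ≤ (levyConst d s).toReal := ENNReal.toReal_nonneg
    have h2 : 0 ≤ Λ := by linarith
    positivity
  obtain ⟨M₁, hM₁⟩ : ∃ M₁, M₁ = C + N := ⟨_, rfl⟩
  obtain ⟨M₂, hM₂⟩ : ∃ M₂, M₂ = (sobolevConst d : ℝ) * d * (Λ * M₁ + (1 + 2 * B)) := ⟨_, rfl⟩
  have hM₁1 : 1 ≤ M₁ := by linarith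
  have hM₂0 : 0 ≤ M₂ := by
    rw [hM₂]
    exact mul_nonneg (mul_nonneg (NNReal.coe_nonneg _) (Nat.cast_nonneg _)) (by nlinarith)
  refine ⟨3 * M₁ + M₂, by linarith, ?_⟩
  intro A K v Dv t₀ x₀ R hC H ℓ k k' r r' T₀ T₁ hH hℓ hk hkH hkk hrR hr' hrr hT₀ hTT hT₁
  have hR := hC.R_mem.1
  have hR1 := hC.R_mem.2
  have hΛ0 : 0 < Λ := by linarith
  have hℓ0 : 0 < ℓ := by linarith
  have hHℓ : 0 < H / ℓ := by positivity
  have hRℓ : 0 < R / ℓ := by positivity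
  have hTℓ : 0 < R ^ 2 / ℓ := by positivity
  have hrr' : r' < r := by linarith
  have hkk' : k' ≤ k := by linarith
  have hv := hC.meas
  obtain ⟨L, hL⟩ : ∃ L, L = B * ℓ / R := ⟨_, rfl⟩
  have hLR : L * R = B * ℓ := by rw [hL]; field_simp
  have hBℓ : 1 ≤ B * ℓ := by nlinarith
  have hL1 : 1 ≤ L := by
    rw [hL, le_div_iff₀ hR]; linarith
  set η := radialCutoff x₀ r' r with hη
  have hηs : ContDiff ℝ (⊤ : ℕ∞) η := radialCutoff_contDiff _ _ _
  have hη01 : ∀ x, η x ∈ Icc (0 : ℝ) 1 := radialCutoff_mem _ _ _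
  have hη1 : ∀ x ∈ ball x₀ r', η x = 1 := fun x hx => radialCutoff_eq_one hr' hrr' hx
  have hη0 : ∀ x ∉ ball x₀ r, η x = 0 := fun x hx => radialCutoff_eq_zero hr' hrr' hx
  have hηt' : tsupport η ⊆ closedBall x₀ r := tsupport_radialCutoff_subset hr' hrr'
  have hηc : HasCompactSupport η :=
    (isCompact_closedBall x₀ r).of_isClosed_subset (isClosed_tsupport _) hηt'
  have hηt : tsupport η ⊆ ball x₀ (2 * R) :=
    hηt'.trans (closedBall_subset_ball (by linarith))
  have hηL : ∀ x y, |η x - η y| ≤ L * ‖x - y‖ := fun x y => by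
    refine (radialCutoff_lipschitz hCl hr' hrr' x y).trans ?_
    refine mul_le_mul_of_nonneg_right ?_ (norm_nonneg _)
    rw [hL, ← hB]
    calc B / (r - r') ≤ B / (R / ℓ) := by gcongr
      _ = B * ℓ / R := by field_simp
  obtain ⟨hWi, hDi, hen⟩ := hC.energy hk hL1 (by rw [hLR]; exact hBℓ) hrR hηs hηc hηt hη01 hηL hη0
  have hgm := (measurable_energySource (s := s) (Λ := Λ) (x₀ := x₀) (R := R) hv k r L)
  have hgfin := hC.lintegral_energySource_ne_top k r L
  have hgi : IntegrableOn (fun t => (energySource s Λ v x₀ R k r L t).toReal)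
      (Iminus t₀ (2 * R)) := integrable_toReal_of_lintegral_ne_top hgm.aemeasurable hgfin
  clear_value η
  obtain ⟨hW, hD⟩ := time_energy hCd hT₀ (by linarith) hT₁ hWi hDi hgi
    (fun t => levelMass_nonneg t) (fun t => levelEnergy_nonneg hΛ0.le t)
    (fun t => ENNReal.toReal_nonneg) hen
  have hsubT₀ : Ioo T₀ t₀ ⊆ Iminus t₀ (2 * R) := Ioo_subset_Ioo_left hT₀.le
  have hsubT₁ : Ioo T₁ t₀ ⊆ Iminus t₀ (2 * R) := Ioo_subset_Ioo_left (by linarith)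
  have hnn := hC.ae_nonneg_slice
  have hrsub : ball x₀ r ⊆ ball x₀ (2 * R) := ball_subset_ball (by linarith)
  have hbounds : ∀ᵐ t, t ∈ Iminus t₀ (2 * R) →
      ENNReal.ofReal ((k - k') ^ 3 / 3) * subVol v x₀ k' r' t
        ≤ ENNReal.ofReal (levelMass v k η t) ∧
      ENNReal.ofReal (levelMass v k η t) ≤ ENNReal.ofReal (k ^ 3) * subVol v x₀ k r t := by
    filter_upwards [hnn] with t ht htJ
    exact levelMass_bounds hv hk hkk' hηs.continuous hη01 hη0 hη1
      ((ht htJ).mono fun x hx hxb => hx (hrsub hxb))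
  obtain ⟨X, hX⟩ : ∃ X, X = weightedVol s v t₀ x₀ R H k r T₀ := ⟨_, rfl⟩
  obtain ⟨E, hE⟩ : ∃ E, E = ∫ t in Ioo T₀ t₀, (C / (T₁ - T₀) * levelMass v k η t
      + (energySource s Λ v x₀ R k r L t).toReal) := ⟨_, rfl⟩
  rw [← hE] at hW hD
  rw [← hX]
  have hsumle : ENNReal.ofReal (C * (ℓ ^ 2 * H ^ 3 / R ^ 2)) +
      ENNReal.ofReal (N * (ℓ ^ 2 * H ^ 3 / R ^ 2)) =
      ENNReal.ofReal (M₁ * (ℓ ^ 2 * H ^ 3 / R ^ 2)) := by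
    rw [← ENNReal.ofReal_add (by positivity) (by positivity), hM₁, add_mul]
  have hpt : ∀ᵐ t, t ∈ Ioo T₀ t₀ → ENNReal.ofReal (C / (T₁ - T₀) * levelMass v k η t
      + (energySource s Λ v x₀ R k r L t).toReal) ≤
      ENNReal.ofReal (M₁ * (ℓ ^ 2 * H ^ 3 / R ^ 2)) *
      (subVol v x₀ k r t * (1 + ENNReal.ofReal (R ^ 2 / H) * negTail s v x₀ R t)) := by
    filter_upwards [hbounds] with t ht htT
    have h1 := (ht (hsubT₀ htT)).2
    have hTT0 : 0 < T₁ - T₀ := by linarith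
    have h2 : ENNReal.ofReal (C / (T₁ - T₀) * levelMass v k η t) ≤
        ENNReal.ofReal (C * (ℓ ^ 2 * H ^ 3 / R ^ 2)) * (subVol v x₀ k r t *
          (1 + ENNReal.ofReal (R ^ 2 / H) * negTail s v x₀ R t)) := by
      rw [ENNReal.ofReal_mul (by positivity)]
      calc ENNReal.ofReal (C / (T₁ - T₀)) * ENNReal.ofReal (levelMass v k η t)
          ≤ ENNReal.ofReal (C / (T₁ - T₀)) * (ENNReal.ofReal (k ^ 3) * subVol v x₀ k r t) := by
            gcongr
        _ = ENNReal.ofReal (C / (T₁ - T₀) * k ^ 3) * (subVol v x₀ k r t * 1) := by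
            rw [ENNReal.ofReal_mul (by positivity), mul_one, mul_assoc]
        _ ≤ _ := by
            refine mul_le_mul' (ENNReal.ofReal_le_ofReal ?_) ?_
            · calc C / (T₁ - T₀) * k ^ 3 ≤ C / (R ^ 2 / ℓ) * H ^ 3 := by gcongr
                _ = C * (ℓ * H ^ 3 / R ^ 2) := by field_simp
                _ ≤ C * (ℓ ^ 2 * H ^ 3 / R ^ 2) := by
                    gcongr
                    nlinarith
            · gcongr
              exact le_self_add
    have h3 := energySource_le (Λ := Λ) (v := v) (x₀ := x₀) (r := r) (t := t) hd hs hΛ hR hH hk hkH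
      hL
    rw [← hN] at h3
    refine ENNReal.ofReal_add_le.trans ?_
    rw [← hsumle, add_mul]
    exact add_le_add h2 (ENNReal.ofReal_toReal_le.trans h3)
  have hEX : ENNReal.ofReal E ≤ ENNReal.ofReal (M₁ * (ℓ ^ 2 * H ^ 3 / R ^ 2)) * X := by
    have hnonneg : ∀ t, 0 ≤ C / (T₁ - T₀) * levelMass v k η t
        + (energySource s Λ v x₀ R k r L t).toReal := fun t =>
      add_nonneg (mul_nonneg (div_nonneg (by linarith) (by linarith)) (levelMass_nonneg t))
        ENNReal.toReal_nonneg
    have hint : IntegrableOn (fun t => C / (T₁ - T₀) * levelMass v k η t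
        + (energySource s Λ v x₀ R k r L t).toReal) (Ioo T₀ t₀) :=
      ((hWi.mono_set hsubT₀).const_mul _).add (hgi.mono_set hsubT₀)
    rw [hE, ofReal_integral_eq_lintegral_ofReal hint (ae_of_all _ hnonneg), hX, weightedVol,
      ← lintegral_const_mul' _ _ ENNReal.ofReal_ne_top]
    exact lintegral_mono_ae ((ae_restrict_iff' measurableSet_Ioo).2 hpt)
  constructor
  · filter_upwards [hW, hbounds] with t ht1 ht2 ht
    have h1 : ENNReal.ofReal ((H / ℓ) ^ 3 / 3) * subVol v x₀ k' r' t ≤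
        ENNReal.ofReal (M₁ * (ℓ ^ 2 * H ^ 3 / R ^ 2)) * X :=
      calc ENNReal.ofReal ((H / ℓ) ^ 3 / 3) * subVol v x₀ k' r' t
          ≤ ENNReal.ofReal ((k - k') ^ 3 / 3) * subVol v x₀ k' r' t := by gcongr
        _ ≤ ENNReal.ofReal (levelMass v k η t) := (ht2 (hsubT₁ ht)).1
        _ ≤ ENNReal.ofReal E := ENNReal.ofReal_le_ofReal (ht1 ht)
        _ ≤ _ := hEX
    refine (ENNReal.le_of_ofReal_mul_le (by positivity) h1).trans ?_
    refine mul_le_mul' (ENNReal.ofReal_le_ofReal ?_) le_rfl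
    calc M₁ * (ℓ ^ 2 * H ^ 3 / R ^ 2) / ((H / ℓ) ^ 3 / 3) = 3 * M₁ * ℓ ^ 5 / R ^ 2 := by
          field_simp
      _ ≤ (3 * M₁ + M₂) * ℓ ^ 5 / R ^ 2 := by gcongr; linarith
  · have hslice := hC.ae_memLp_slice
    have hS : ∀ᵐ t, t ∈ Ioo T₁ t₀ →
        ENNReal.ofReal ((H / ℓ) ^ 2) * subVol v x₀ k' r' t ^ (1 - 1 / (d : ℝ)) ≤
        ENNReal.ofReal (sobolevConst d * d) * (ENNReal.ofReal (Λ * (R / H)) *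
          ENNReal.ofReal (levelEnergy Λ v Dv k η t) +
          ENNReal.ofReal ((1 + 2 * B) * (ℓ * H ^ 2 / R)) * subVol v x₀ k r t) := by
      filter_upwards [hnn, hslice] with t ht1 ht2 ht
      have htJ := hsubT₁ ht
      have hη2 : ContDiff ℝ (⊤ : ℕ∞) fun x => η x ^ 2 := hηs.pow 2
      have hη2t : tsupport (fun x => η x ^ 2) ⊆ tsupport η :=
        closure_mono fun x hx h => hx (by simp [h])
      have h1 := sobolev_truncPow hd (ht2 htJ).1 (ht2 htJ).2 (ht1 htJ) (hC.grad t htJ) hk hη2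
        (hηc.of_isClosed_subset (isClosed_tsupport _) hη2t) (fun x => sq_nonneg _)
        (hη2t.trans hηt)
      have h2 := eLpNorm_truncPow_ge (x₀ := x₀) hd hv (t := t) hkk' hη1
      have h3 : ∀ i, eLpNorm (sliceGrad k (v t) (Dv t) (fun x => η x ^ 2) i) 1 ≤
          ENNReal.ofReal (Λ * (R / H)) * ENNReal.ofReal (levelEnergy Λ v Dv k η t) +
          ENNReal.ofReal ((1 + 2 * B) * (ℓ * H ^ 2 / R)) * subVol v x₀ k r t := by
        intro i
        refine (lintegral_sliceGrad_le hΛ0 hv hC.measD hk hηs hη01 (by linarith) hηL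
          (by linarith : r ≤ 2 * R) hη0 (ht1 htJ) (ht2 htJ).2 (div_pos hR hH) i).trans ?_
        gcongr
        calc k / (R / H) + 2 * L * k ^ 2 ≤ H / (R / H) + 2 * L * H ^ 2 := by gcongr
          _ = 1 * H ^ 2 / R + 2 * B * (ℓ * H ^ 2 / R) := by rw [hL]; field_simp
          _ ≤ ℓ * H ^ 2 / R + 2 * B * (ℓ * H ^ 2 / R) := by gcongr
          _ = _ := by ring
      calc ENNReal.ofReal ((H / ℓ) ^ 2) * subVol v x₀ k' r' t ^ (1 - 1 / (d : ℝ))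
          ≤ ENNReal.ofReal ((k - k') ^ 2) * subVol v x₀ k' r' t ^ (1 - 1 / (d : ℝ)) := by gcongr
        _ ≤ _ := h2
        _ ≤ _ := h1
        _ ≤ sobolevConst d * ∑ i : Fin d, (ENNReal.ofReal (Λ * (R / H)) *
              ENNReal.ofReal (levelEnergy Λ v Dv k η t) +
            ENNReal.ofReal ((1 + 2 * B) * (ℓ * H ^ 2 / R)) * subVol v x₀ k r t) := by
            gcongr with i; exact h3 i
        _ = _ := by
            rw [Finset.sum_const, Finset.card_univ, Fintype.card_fin, nsmul_eq_mul,
              ENNReal.ofReal_mul (NNReal.coe_nonneg _), ENNReal.ofReal_coe_nnreal,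
              ENNReal.ofReal_natCast, mul_assoc]
    have hDX : ∫⁻ t in Ioo T₁ t₀, ENNReal.ofReal (levelEnergy Λ v Dv k η t) ≤
        ENNReal.ofReal (M₁ * (ℓ ^ 2 * H ^ 3 / R ^ 2)) * X := by
      rw [← ofReal_integral_eq_lintegral_ofReal (hDi.mono_set hsubT₁)
        (ae_of_all _ fun t => levelEnergy_nonneg hΛ0.le t)]
      exact (ENNReal.ofReal_le_ofReal hD).trans hEX
    have haX : ∫⁻ t in Ioo T₁ t₀, subVol v x₀ k r t ≤ X := by
      rw [hX, weightedVol]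
      refine (lintegral_mono_set (Ioo_subset_Ioo_left (by linarith))).trans
        (lintegral_mono fun t => ?_)
      calc subVol v x₀ k r t = subVol v x₀ k r t * 1 := (mul_one _).symm
        _ ≤ _ := by gcongr; exact le_self_add
    have hI := lintegral_mono_ae ((ae_restrict_iff' measurableSet_Ioo).2 hS)
    have hma := measurable_subVol (x₀ := x₀) hv k r
    rw [lintegral_const_mul' _ _ ENNReal.ofReal_ne_top,
      lintegral_const_mul' _ _ ENNReal.ofReal_ne_top, lintegral_add_right _ (hma.const_mul _),
      lintegral_const_mul' _ _ ENNReal.ofReal_ne_top,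
      lintegral_const_mul' _ _ ENNReal.ofReal_ne_top] at hI
    have hI2 : ENNReal.ofReal ((H / ℓ) ^ 2) *
        ∫⁻ t in Ioo T₁ t₀, subVol v x₀ k' r' t ^ (1 - 1 / (d : ℝ)) ≤
        ENNReal.ofReal (M₂ * (ℓ ^ 2 * H ^ 2 / R)) * X := by
      refine hI.trans ?_
      calc _ ≤ ENNReal.ofReal (sobolevConst d * d) * (ENNReal.ofReal (Λ * (R / H)) *
          (ENNReal.ofReal (M₁ * (ℓ ^ 2 * H ^ 3 / R ^ 2)) * X) +
          ENNReal.ofReal ((1 + 2 * B) * (ℓ * H ^ 2 / R)) * X) := by gcongr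
        _ = ENNReal.ofReal (sobolevConst d * d * (Λ * (R / H) * (M₁ * (ℓ ^ 2 * H ^ 3 / R ^ 2))
            + (1 + 2 * B) * (ℓ * H ^ 2 / R))) * X := by
            rw [ENNReal.ofReal_mul (p := (sobolevConst d : ℝ) * d) (q := Λ * (R / H) *
                (M₁ * (ℓ ^ 2 * H ^ 3 / R ^ 2)) + (1 + 2 * B) * (ℓ * H ^ 2 / R)) (by positivity),
              ENNReal.ofReal_add (by positivity) (by positivity),
              ENNReal.ofReal_mul (p := Λ * (R / H)) (by positivity)]
            generalize ENNReal.ofReal ((sobolevConst d : ℝ) * d) = c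
            ring
        _ ≤ _ := by
            refine mul_le_mul' (ENNReal.ofReal_le_ofReal ?_) le_rfl
            rw [hM₂, mul_assoc _ (Λ * M₁ + (1 + 2 * B)), add_mul (Λ * M₁)]
            refine mul_le_mul_of_nonneg_left (add_le_add (le_of_eq ?_) ?_) (by positivity)
            · field_simp
            · have : ℓ * H ^ 2 / R ≤ ℓ ^ 2 * H ^ 2 / R := by
                gcongr
                exact le_self_pow₀ hℓ two_ne_zero
              gcongr
    refine (ENNReal.le_of_ofReal_mul_le (by positivity) hI2).trans ?_
    refine mul_le_mul' (ENNReal.ofReal_le_ofReal ?_) le_rfl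
    calc M₂ * (ℓ ^ 2 * H ^ 2 / R) / (H / ℓ) ^ 2 = M₂ * ℓ ^ 4 / R := by
          field_simp
      _ ≤ (3 * M₁ + M₂) * ℓ ^ 5 / R := by
          gcongr
          · linarith
          · norm_num

lemma lintegral_mul_le_of_ae_le {α : Type*} [MeasurableSpace α] {μ : Measure α} {f g : α → ℝ≥0∞}
    (hf : AEMeasurable f μ) (hg : AEMeasurable g μ) {p q κ : ℝ} (hpq : p.HolderConjugate q)
    (hκ : 0 ≤ κ) (hκp : κ ≤ p) {m N : ℝ≥0∞} (hm : ∀ᵐ x ∂μ, f x ≤ m)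
    (hN : ∫⁻ x, f x ^ κ ∂μ ≤ N) :
    ∫⁻ x, f x * g x ∂μ ≤ (m ^ (p - κ) * N) ^ (1 / p) * (∫⁻ x, g x ^ q ∂μ) ^ (1 / q) := by
  refine (ENNReal.lintegral_mul_le_Lp_mul_Lq μ hpq hf hg).trans (mul_le_mul' ?_ le_rfl)
  refine ENNReal.rpow_le_rpow ?_ (one_div_nonneg.2 hpq.nonneg)
  have h1 : ∫⁻ x, f x ^ p ∂μ ≤ ∫⁻ x, m ^ (p - κ) * f x ^ κ ∂μ := by
    refine lintegral_mono_ae (hm.mono fun x hx => ?_)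
    calc f x ^ p = f x ^ (p - κ) * f x ^ κ := by
          rw [← ENNReal.rpow_add_of_nonneg _ _ (by linarith) hκ, sub_add_cancel]
      _ ≤ _ := mul_le_mul' (ENNReal.rpow_le_rpow hx (by linarith)) le_rfl
  refine h1.trans ?_
  rw [lintegral_const_mul'' _ (hf.pow_const κ)]
  exact mul_le_mul' le_rfl hN

lemma ENNReal.tendsto_zero_of_le_geometric_mul_rpow {X : ℕ → ℝ≥0∞} {C b α β ε : ℝ} (hC : 0 ≤ C)
    (hb : 0 ≤ b) (hα : 0 < α) (hβ : β ∈ Ioo (0 : ℝ) 1) (hbβ : b * β ^ α ≤ 1) (hε : 0 ≤ ε)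
    (hCε : C * ε ^ α ≤ β) (h0 : X 0 ≤ ENNReal.ofReal ε)
    (hX : ∀ j, X (j + 1) ≤ ENNReal.ofReal (C * b ^ j) * X j ^ (1 + α)) :
    Tendsto X atTop (𝓝 0) := by
  have key : ∀ j, X j ≤ ENNReal.ofReal (ε * β ^ j) := by
    intro j
    induction j with
    | zero => simpa using h0
    | succ j ih =>
      have hj : 0 ≤ β ^ j := pow_nonneg hβ.1.le _
      refine (hX j).trans ((mul_le_mul' le_rfl (ENNReal.rpow_le_rpow ih (by linarith))).trans ?_)
      rw [ENNReal.ofReal_rpow_of_nonneg (by positivity) (by linarith),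
        ← ENNReal.ofReal_mul (by positivity)]
      refine ENNReal.ofReal_le_ofReal ?_
      have h1 : (ε * β ^ j) ^ (1 + α) = ε * β ^ j * (ε ^ α * (β ^ α) ^ j) := by
        rw [Real.rpow_add_of_nonneg (by positivity) zero_le_one hα.le, Real.rpow_one,
          Real.mul_rpow hε hj, Real.rpow_pow_comm hβ.1.le]
      calc C * b ^ j * (ε * β ^ j) ^ (1 + α)
          = (C * ε ^ α) * (b * β ^ α) ^ j * (ε * β ^ j) := by rw [h1, mul_pow]; ring
        _ ≤ β * 1 * (ε * β ^ j) := by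
            have := hβ.1.le
            have h2 : 0 ≤ b * β ^ α := by positivity
            gcongr
            exact pow_le_one₀ h2 hbβ
        _ = ε * β ^ (j + 1) := by ring
  have hlim : Tendsto (fun j => ENNReal.ofReal (ε * β ^ j)) atTop (𝓝 0) := by
    have := (_root_.tendsto_pow_atTop_nhds_zero_of_lt_one hβ.1.le hβ.2).const_mul ε
    rw [mul_zero] at this
    simpa using ENNReal.tendsto_ofReal this
  exact tendsto_of_tendsto_of_tendsto_of_le_of_le tendsto_const_nhds hlim (fun _ => bot_le) key

lemma Tail_negPart_eq {v : ℝ → Ed d → ℝ} (hv : Measurable (Function.uncurry v)) (s : ℝ) (x₀ : Ed d)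
    (R t : ℝ) : Tail s (fun y => max (-v t y) 0) x₀ (2 * R)
      = (2 * R) ^ 2 * (negTail s v x₀ R t).toReal := by
  have hvt : Measurable (v t) := hv.comp measurable_prodMk_left
  rw [Tail, integral_eq_lintegral_of_nonneg_ae (ae_of_all _ fun y => by positivity)
    (Measurable.aestronglyMeasurable (by fun_prop)), negTail]
  congr 2
  refine lintegral_congr fun y => ?_
  rw [abs_of_nonneg (le_max_right _ _), jumpKer, ← ENNReal.ofReal_mul (le_max_right _ _),
    mul_one_div]

lemma CylSuper.lintegral_tailWeight_rpow_le {s Λ : ℝ} {A : ℝ → Ed d → Ed d → Ed d}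
    {K : ℝ → Ed d → Ed d → ℝ} {v : ℝ → Ed d → ℝ} {Dv : ℝ → Ed d → Ed d} {t₀ : ℝ} {x₀ : Ed d}
    {R : ℝ} (hC : CylSuper s Λ A K v Dv t₀ x₀ R) {q H : ℝ} (hq : q ∈ Ioc (1 : ℝ) 2) (hH : 0 < H)
    (htail : (⨍ t in Iminus t₀ (2 * R),
      (Tail s (fun y => max (-v t y) 0) x₀ (2 * R)) ^ q) ^ (1 / q) ≤ H) :
    ∫⁻ t in Iminus t₀ (2 * R), (1 + ENNReal.ofReal (R ^ 2 / H) * negTail s v x₀ R t) ^ q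
      ≤ ENNReal.ofReal (16 * R ^ 2) := by
  have hR := hC.R_mem.1
  have hq0 : 0 < q := by linarith [hq.1]
  have hmeas := measurable_negTail (s := s) (x₀ := x₀) (R := R) hC.meas
  have hvol : volume (Iminus t₀ (2 * R)) = ENNReal.ofReal (4 * R ^ 2) := by
    rw [Iminus, Real.volume_Ioo]; congr 1; ring
  have hfin : ∀ᵐ t ∂volume.restrict (Iminus t₀ (2 * R)), negTail s v x₀ R t < ∞ :=
    ae_lt_top hmeas hC.lintegral_negTail_ne_top
  have hqfin : ∫⁻ t in Iminus t₀ (2 * R), negTail s v x₀ R t ^ q ≠ ∞ := by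
    have h1 : ∫⁻ t in Iminus t₀ (2 * R), (1 + negTail s v x₀ R t ^ 2) ≠ ∞ := by
      rw [lintegral_add_left measurable_const, lintegral_const, Measure.restrict_apply_univ, hvol]
      exact ENNReal.add_ne_top.2
        ⟨ENNReal.mul_ne_top ENNReal.one_ne_top ENNReal.ofReal_ne_top, hC.lintegral_negTail_sq_ne_top⟩
    refine ne_top_of_le_ne_top h1 (lintegral_mono fun t => ?_)
    rcases le_total (negTail s v x₀ R t) 1 with h | h
    · exact (ENNReal.rpow_le_one h hq0.le).trans le_self_add
    · rw [← ENNReal.rpow_two]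
      exact (ENNReal.rpow_le_rpow_of_exponent_le h hq.2).trans le_add_self
  have hTq : ∀ᵐ t ∂volume.restrict (Iminus t₀ (2 * R)),
      (ENNReal.ofReal (4 * R ^ 2) * negTail s v x₀ R t) ^ q =
        ENNReal.ofReal ((Tail s (fun y => max (-v t y) 0) x₀ (2 * R)) ^ q) := by
    filter_upwards [hfin] with t ht
    rw [Tail_negPart_eq hC.meas, ← ENNReal.ofReal_rpow_of_nonneg (by positivity) hq0.le,
      ENNReal.ofReal_mul (p := (2 * R) ^ 2) (by positivity), ENNReal.ofReal_toReal ht.ne]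
    congr 3; ring
  have hTnn : ∀ t, 0 ≤ (Tail s (fun y => max (-v t y) 0) x₀ (2 * R)) ^ q := fun t => by
    rw [Tail_negPart_eq hC.meas]; positivity
  have hTm : Measurable fun t => (Tail s (fun y => max (-v t y) 0) x₀ (2 * R)) ^ q := by
    simp_rw [Tail_negPart_eq hC.meas]
    exact (hmeas.ennreal_toReal.const_mul _).pow_const q
  have hTint : ∫⁻ t in Iminus t₀ (2 * R), (ENNReal.ofReal (4 * R ^ 2) * negTail s v x₀ R t) ^ q ≤
      ENNReal.ofReal (4 * R ^ 2 * H ^ q) := by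
    rw [lintegral_congr_ae hTq]
    have hint : IntegrableOn (fun t => (Tail s (fun y => max (-v t y) 0) x₀ (2 * R)) ^ q)
        (Iminus t₀ (2 * R)) := by
      refine ⟨hTm.aestronglyMeasurable, ?_⟩
      rw [hasFiniteIntegral_iff_ofReal (ae_of_all _ hTnn), ← lintegral_congr_ae hTq]
      simp_rw [ENNReal.mul_rpow_of_nonneg _ _ hq0.le]
      rw [lintegral_const_mul _ (hmeas.pow_const q)]
      exact (ENNReal.mul_ne_top
        (ENNReal.rpow_ne_top_of_nonneg hq0.le ENNReal.ofReal_ne_top) hqfin).lt_top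
    rw [← ofReal_integral_eq_lintegral_ofReal hint (ae_of_all _ hTnn)]
    refine ENNReal.ofReal_le_ofReal ?_
    rw [setAverage_eq, Measure.real, hvol, ENNReal.toReal_ofReal (by positivity), smul_eq_mul]
      at htail
    have hI0 := integral_nonneg_of_ae (μ := volume.restrict (Iminus t₀ (2 * R)))
      (ae_of_all _ hTnn)
    have h1 := Real.rpow_le_rpow (by positivity) htail hq0.le
    rw [← Real.rpow_mul (mul_nonneg (by positivity) hI0), one_div_mul_cancel hq0.ne',
      Real.rpow_one, inv_mul_le_iff₀ (by positivity)] at h1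
    exact h1
  have hτ : ∫⁻ t in Iminus t₀ (2 * R), (ENNReal.ofReal (R ^ 2 / H) * negTail s v x₀ R t) ^ q ≤
      ENNReal.ofReal (4 * R ^ 2) := by
    calc ∫⁻ t in Iminus t₀ (2 * R), (ENNReal.ofReal (R ^ 2 / H) * negTail s v x₀ R t) ^ q
        ≤ ∫⁻ t in Iminus t₀ (2 * R), ENNReal.ofReal ((1 / H) ^ q) *
            (ENNReal.ofReal (4 * R ^ 2) * negTail s v x₀ R t) ^ q := by
          refine lintegral_mono fun t => ?_
          rw [← ENNReal.ofReal_rpow_of_nonneg (by positivity) hq0.le,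
            ← ENNReal.mul_rpow_of_nonneg _ _ hq0.le, ← mul_assoc,
            ← ENNReal.ofReal_mul (by positivity)]
          refine ENNReal.rpow_le_rpow (mul_le_mul' (ENNReal.ofReal_le_ofReal ?_) le_rfl) hq0.le
          rw [div_eq_mul_one_div, mul_comm]
          gcongr
          nlinarith [sq_nonneg R]
      _ = ENNReal.ofReal ((1 / H) ^ q) * ∫⁻ t in Iminus t₀ (2 * R),
            (ENNReal.ofReal (4 * R ^ 2) * negTail s v x₀ R t) ^ q :=
          lintegral_const_mul' _ _ ENNReal.ofReal_ne_top
      _ ≤ ENNReal.ofReal ((1 / H) ^ q) * ENNReal.ofReal (4 * R ^ 2 * H ^ q) := by gcongr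
      _ = ENNReal.ofReal (4 * R ^ 2) := by
          rw [← ENNReal.ofReal_mul (by positivity), mul_left_comm,
            ← Real.mul_rpow (by positivity) hH.le, one_div_mul_cancel hH.ne', Real.one_rpow,
            mul_one]
  calc ∫⁻ t in Iminus t₀ (2 * R), (1 + ENNReal.ofReal (R ^ 2 / H) * negTail s v x₀ R t) ^ q
      ≤ ∫⁻ t in Iminus t₀ (2 * R),
          2 * (1 + (ENNReal.ofReal (R ^ 2 / H) * negTail s v x₀ R t) ^ q) := by
        refine lintegral_mono fun t => ?_
        refine (ENNReal.rpow_add_le_mul_rpow_add_rpow _ _ hq.1.le).trans ?_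
        rw [ENNReal.one_rpow]
        refine mul_le_mul' ?_ le_rfl
        calc (2 : ℝ≥0∞) ^ (q - 1) ≤ 2 ^ (1 : ℝ) :=
              ENNReal.rpow_le_rpow_of_exponent_le one_le_two (by linarith [hq.2])
          _ = 2 := ENNReal.rpow_one _
    _ = 2 * (ENNReal.ofReal (4 * R ^ 2) + ∫⁻ t in Iminus t₀ (2 * R),
          (ENNReal.ofReal (R ^ 2 / H) * negTail s v x₀ R t) ^ q) := by
        rw [lintegral_const_mul' _ _ (by simp), lintegral_add_left measurable_const,
          lintegral_const, Measure.restrict_apply_univ, hvol, one_mul]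
    _ ≤ 2 * (ENNReal.ofReal (4 * R ^ 2) + ENNReal.ofReal (4 * R ^ 2)) := by gcongr
    _ = ENNReal.ofReal (16 * R ^ 2) := by
        rw [← ENNReal.ofReal_add (by positivity) (by positivity), ← ENNReal.ofReal_ofNat,
          ← ENNReal.ofReal_mul (by norm_num)]
        congr 1; ring

lemma measurable_tailWeight {v : ℝ → Ed d → ℝ} (hv : Measurable (Function.uncurry v)) (s : ℝ)
    (x₀ : Ed d) (R H : ℝ) :
    Measurable fun t => 1 + ENNReal.ofReal (R ^ 2 / H) * negTail s v x₀ R t :=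
  ((measurable_negTail hv).const_mul _).const_add _

lemma ofReal_rpow_mul_rpow {a b c e x y : ℝ} (ha : 0 ≤ a) (hb : 0 ≤ b) (hc : 0 ≤ c) (he : 0 ≤ e)
    (hx : 0 ≤ x) (hy : 0 ≤ y) : ENNReal.ofReal ((a ^ e * b) ^ x * c ^ y)
      = (ENNReal.ofReal a ^ e * ENNReal.ofReal b) ^ x * ENNReal.ofReal c ^ y := by
  rw [ENNReal.ofReal_rpow_of_nonneg ha he, ENNReal.ofReal_rpow_of_nonneg hc hy,
    ← ENNReal.ofReal_mul (by positivity), ENNReal.ofReal_rpow_of_nonneg (by positivity) hx,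
    ← ENNReal.ofReal_mul (by positivity)]

lemma holder_scaling {D R p q e : ℝ} (hD : 0 < D) (hR : 0 < R) (hpq : p.HolderConjugate q) :
    ((D / R ^ 2) ^ (p - (1 - e)) * (D / R)) ^ (1 / p) * (16 * R ^ 2) ^ (1 / q)
      ≤ 16 * D ^ (1 + e / p) * R ^ (-((1 + 2 * e) / p)) := by
  have hp := hpq.pos
  have hq1 : 1 / q = 1 - 1 / p := by
    have := hpq.inv_add_inv_eq_one
    rw [one_div, one_div]; linarith
  have h2 : R ^ 2 = R ^ (2 : ℝ) := (Real.rpow_two R).symm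
  have h1 : (D / R ^ 2) ^ (p - (1 - e)) * (D / R)
      = D ^ (p + e) * R ^ (-2 * (p - (1 - e)) - 1) := by
    rw [h2, Real.div_rpow hD.le (by positivity), ← Real.rpow_mul hR.le, Real.rpow_sub hR, neg_mul,
      Real.rpow_neg hR.le, Real.rpow_one,
      show p + e = (p - (1 - e)) + 1 by ring, Real.rpow_add hD, Real.rpow_one]
    field_simp
  rw [h1, Real.mul_rpow (by positivity) (by positivity), ← Real.rpow_mul hD.le,
    ← Real.rpow_mul hR.le, Real.mul_rpow (by norm_num) (by positivity), h2, ← Real.rpow_mul hR.le]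
  have h16 : (16 : ℝ) ^ (1 / q) ≤ 16 := by
    calc (16 : ℝ) ^ (1 / q) ≤ 16 ^ (1 : ℝ) :=
          Real.rpow_le_rpow_of_exponent_le (by norm_num) (by
            rw [hq1]; linarith [one_div_pos.2 hp])
      _ = 16 := Real.rpow_one _
  calc D ^ ((p + e) * (1 / p)) * R ^ ((-2 * (p - (1 - e)) - 1) * (1 / p)) *
        (16 ^ (1 / q) * R ^ (2 * (1 / q)))
      = 16 ^ (1 / q) * D ^ ((p + e) * (1 / p)) *
          R ^ ((-2 * (p - (1 - e)) - 1) * (1 / p) + 2 * (1 / q)) := by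
        rw [Real.rpow_add hR]; ring
    _ = 16 ^ (1 / q) * D ^ (1 + e / p) * R ^ (-((1 + 2 * e) / p)) := by
        congr 2
        · congr 1; field_simp
        · rw [hq1]; field_simp; ring
    _ ≤ _ := by gcongr

lemma exists_weightedVol_step {s Λ p q : ℝ} (hd : 2 ≤ d) (hs : s ∈ Ioo (0 : ℝ) 1) (hΛ : 1 ≤ Λ)
    (hpq : p.HolderConjugate q) :
    ∃ M : ℝ, 1 ≤ M ∧ ∀ {A : ℝ → Ed d → Ed d → Ed d} {K : ℝ → Ed d → Ed d → ℝ}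
      {v : ℝ → Ed d → ℝ} {Dv : ℝ → Ed d → Ed d} {t₀ : ℝ} {x₀ : Ed d} {R : ℝ},
      CylSuper s Λ A K v Dv t₀ x₀ R → ∀ {H ℓ k k' r r' T₀ T₁ : ℝ}, 0 < H → 1 ≤ ℓ → 0 ≤ k → k ≤ H →
      H / ℓ ≤ k - k' → r ≤ R → 0 < r' → R / ℓ ≤ r - r' → t₀ - (2 * R) ^ 2 < T₀ →
      R ^ 2 / ℓ ≤ T₁ - T₀ → T₁ < t₀ →
      ∫⁻ t in Iminus t₀ (2 * R), (1 + ENNReal.ofReal (R ^ 2 / H) * negTail s v x₀ R t) ^ q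
        ≤ ENNReal.ofReal (16 * R ^ 2) →
      weightedVol s v t₀ x₀ R H k' r' T₁ ≤
        ENNReal.ofReal (16 * (M * ℓ ^ 5) ^ (1 + 1 / (d : ℝ) / p) *
          R ^ (-((1 + 2 * (1 / (d : ℝ))) / p))) *
        weightedVol s v t₀ x₀ R H k r T₀ ^ (1 + 1 / (d : ℝ) / p) := by
  obtain ⟨M, hM, hstep⟩ := exists_level_step hd hs hΛ
  refine ⟨M, hM, ?_⟩
  intro A K v Dv t₀ x₀ R hC H ℓ k k' r r' T₀ T₁ hH hℓ hk hkH hkk hrR hr' hrr hT₀ hTT hT₁ hθ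
  obtain ⟨h1, h2⟩ := hstep hC hH hℓ hk hkH hkk hrR hr' hrr hT₀ hTT hT₁
  generalize weightedVol s v t₀ x₀ R H k r T₀ = X at *
  have hR := hC.R_mem.1
  have hp := hpq.lt
  have hp0 := hpq.pos
  have hd2 : (2 : ℝ) ≤ d := by exact_mod_cast hd
  obtain ⟨e, he⟩ : ∃ e, e = 1 / (d : ℝ) := ⟨_, rfl⟩
  have he0 : 0 < e := by rw [he]; positivity
  have he1 : e ≤ 1 := by rw [he, div_le_one (by linarith)]; linarith
  rw [← he] at h2 ⊢
  obtain ⟨D, hD⟩ : ∃ D, D = M * ℓ ^ 5 := ⟨_, rfl⟩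
  have hD0 : 0 < D := by rw [hD]; positivity
  rw [← hD] at h1 h2 ⊢
  have hsub : Ioo T₁ t₀ ⊆ Iminus t₀ (2 * R) :=
    Ioo_subset_Ioo_left (by have : 0 < R ^ 2 / ℓ := by positivity
                            linarith)
  have hpe : 0 ≤ p - (1 - e) := by linarith
  calc weightedVol s v t₀ x₀ R H k' r' T₁
      ≤ ((ENNReal.ofReal (D / R ^ 2) * X) ^ (p - (1 - e)) * (ENNReal.ofReal (D / R) * X)) ^ (1 / p)
        * (∫⁻ t in Ioo T₁ t₀,
            (1 + ENNReal.ofReal (R ^ 2 / H) * negTail s v x₀ R t) ^ q) ^ (1 / q) :=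
        lintegral_mul_le_of_ae_le (measurable_subVol hC.meas k' r').aemeasurable
          (measurable_tailWeight hC.meas s x₀ R H).aemeasurable hpq (by linarith) (by linarith)
          ((ae_restrict_iff' measurableSet_Ioo).2 h1) h2
    _ ≤ ((ENNReal.ofReal (D / R ^ 2) * X) ^ (p - (1 - e)) * (ENNReal.ofReal (D / R) * X)) ^ (1 / p)
        * ENNReal.ofReal (16 * R ^ 2) ^ (1 / q) := by
        refine mul_le_mul' le_rfl (ENNReal.rpow_le_rpow ((lintegral_mono_set hsub).trans hθ) ?_)
        exact one_div_nonneg.2 hpq.symm.nonneg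
    _ = ENNReal.ofReal (((D / R ^ 2) ^ (p - (1 - e)) * (D / R)) ^ (1 / p)
          * (16 * R ^ 2) ^ (1 / q)) * X ^ (1 + e / p) := by
        rw [ofReal_rpow_mul_rpow (by positivity) (by positivity) (by positivity) hpe
            (one_div_nonneg.2 hp0.le) (one_div_nonneg.2 hpq.symm.nonneg),
          ENNReal.mul_rpow_of_nonneg _ _ hpe]
        have hX : X ^ (p - (1 - e)) * X = X ^ (p + e) := by
          nth_rw 2 [← ENNReal.rpow_one X]
          rw [← ENNReal.rpow_add_of_nonneg _ _ hpe zero_le_one]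
          congr 1; ring
        have hX' : (X ^ (p + e)) ^ (1 / p) = X ^ (1 + e / p) := by
          rw [← ENNReal.rpow_mul]; congr 1; field_simp
        rw [mul_mul_mul_comm, hX, ENNReal.mul_rpow_of_nonneg _ _ (one_div_nonneg.2 hp0.le), hX']
        ring
    _ ≤ _ := mul_le_mul' (ENNReal.ofReal_le_ofReal (holder_scaling hD0 hR hpq)) le_rfl

lemma lintegral_subVol {v : ℝ → Ed d → ℝ} (hv : Measurable (Function.uncurry v)) (x₀ : Ed d)
    (k r a b : ℝ) : ∫⁻ t in Ioo a b, subVol v x₀ k r t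
      = volume {p : ℝ × Ed d | p ∈ Ioo a b ×ˢ ball x₀ r ∧ v p.1 p.2 < k} := by
  have hm : MeasurableSet {p : ℝ × Ed d | p ∈ Ioo a b ×ˢ ball x₀ r ∧ v p.1 p.2 < k} :=
    (measurableSet_Ioo.prod measurableSet_ball).inter (hv measurableSet_Iio)
  rw [Measure.volume_eq_prod, Measure.prod_apply hm, ← lintegral_indicator measurableSet_Ioo]
  refine lintegral_congr fun t => ?_
  by_cases ht : t ∈ Ioo a b
  · rw [indicator_of_mem ht, subVol]
    congr 1
    ext x
    simp only [mem_ofPred_eq, mem_preimage, mem_prod, ht, true_and]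
  · rw [indicator_of_notMem ht]
    symm
    convert measure_empty (μ := (volume : Measure (Ed d)))
    exact eq_empty_of_forall_notMem fun x hx => ht hx.1.1

lemma volume_ball_eq_ofReal (x₀ : Ed d) {r : ℝ} (hr : 0 < r) :
    volume (ball x₀ r) = ENNReal.ofReal ((volume (ball (0 : Ed d) 1)).toReal * r ^ d) := by
  rw [Measure.addHaar_ball_of_pos _ _ hr, finrank_euclideanSpace_fin, mul_comm,
    ENNReal.ofReal_mul ENNReal.toReal_nonneg, ENNReal.ofReal_toReal measure_ball_lt_top.ne]

lemma CylSuper.weightedVol_le_of_measure_le {s Λ : ℝ} {A : ℝ → Ed d → Ed d → Ed d}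
    {K : ℝ → Ed d → Ed d → ℝ} {v : ℝ → Ed d → ℝ} {Dv : ℝ → Ed d → Ed d} {t₀ : ℝ} {x₀ : Ed d}
    {R : ℝ} (hC : CylSuper s Λ A K v Dv t₀ x₀ R) {p q δ lam H : ℝ} (hpq : p.HolderConjugate q)
    (hδ : δ ∈ Ioc (0 : ℝ) 1) (hlam : 0 ≤ lam)
    (hvol : volume {p : ℝ × Ed d | p ∈ Iminus t₀ (δ * R) ×ˢ ball x₀ R ∧ v p.1 p.2 ≤ H} ≤
      ENNReal.ofReal lam * volume (Iminus t₀ (δ * R) ×ˢ ball x₀ R))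
    (hθ : ∫⁻ t in Iminus t₀ (2 * R), (1 + ENNReal.ofReal (R ^ 2 / H) * negTail s v x₀ R t) ^ q
      ≤ ENNReal.ofReal (16 * R ^ 2)) :
    weightedVol s v t₀ x₀ R H H R (t₀ - (δ * R) ^ 2) ≤
      ENNReal.ofReal (16 * (volume (ball (0 : Ed d) 1)).toReal * lam ^ (1 / p) *
        (R ^ d * R ^ 2)) := by
  have hR := hC.R_mem.1
  have hp := hpq.lt
  have hp0 := hpq.pos
  have hq0 := hpq.symm.pos
  obtain ⟨ω, hω⟩ : ∃ ω, ω = (volume (ball (0 : Ed d) 1)).toReal := ⟨_, rfl⟩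
  have hω0 : 0 ≤ ω := by rw [hω]; exact ENNReal.toReal_nonneg
  have hball := volume_ball_eq_ofReal x₀ hR
  rw [← hω] at hball ⊢
  have hδR : δ * R ≤ R := mul_le_of_le_one_left hR.le hδ.2
  have hδ0 := mul_pos hδ.1 hR
  have hsub : Ioo (t₀ - (δ * R) ^ 2) t₀ ⊆ Iminus t₀ (2 * R) :=
    Ioo_subset_Ioo_left (by nlinarith)
  have hN : ∫⁻ t in Ioo (t₀ - (δ * R) ^ 2) t₀, subVol v x₀ H R t ^ (1 : ℝ)
      ≤ ENNReal.ofReal (lam * R ^ 2 * (ω * R ^ d)) := by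
    simp_rw [ENNReal.rpow_one]
    rw [lintegral_subVol hC.meas]
    refine (measure_mono fun p hp => ?_).trans (hvol.trans ?_)
    · exact ⟨hp.1, hp.2.le⟩
    · rw [Measure.volume_eq_prod, Measure.prod_prod, hball, Iminus, Real.volume_Ioo,
        ← ENNReal.ofReal_mul (by nlinarith), ← ENNReal.ofReal_mul hlam]
      refine ENNReal.ofReal_le_ofReal ?_
      rw [mul_assoc, sub_sub_cancel]
      gcongr
  have hm : ∀ᵐ t ∂volume.restrict (Ioo (t₀ - (δ * R) ^ 2) t₀), subVol v x₀ H R t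
      ≤ ENNReal.ofReal (ω * R ^ d) :=
    ae_of_all _ fun t => hball ▸ subVol_le H R t
  calc weightedVol s v t₀ x₀ R H H R (t₀ - (δ * R) ^ 2)
      ≤ (ENNReal.ofReal (ω * R ^ d) ^ (p - 1) * ENNReal.ofReal (lam * R ^ 2 * (ω * R ^ d))) ^ (1 / p)
        * (∫⁻ t in Ioo (t₀ - (δ * R) ^ 2) t₀,
            (1 + ENNReal.ofReal (R ^ 2 / H) * negTail s v x₀ R t) ^ q) ^ (1 / q) :=
        lintegral_mul_le_of_ae_le (measurable_subVol hC.meas H R).aemeasurable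
          (measurable_tailWeight hC.meas s x₀ R H).aemeasurable hpq zero_le_one hp.le hm hN
    _ ≤ (ENNReal.ofReal (ω * R ^ d) ^ (p - 1) * ENNReal.ofReal (lam * R ^ 2 * (ω * R ^ d))) ^ (1 / p)
        * ENNReal.ofReal (16 * R ^ 2) ^ (1 / q) := by
        refine mul_le_mul' le_rfl (ENNReal.rpow_le_rpow ((lintegral_mono_set hsub).trans hθ) ?_)
        exact one_div_nonneg.2 hq0.le
    _ = ENNReal.ofReal (((ω * R ^ d) ^ (p - 1) * (lam * R ^ 2 * (ω * R ^ d))) ^ (1 / p) *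
          (16 * R ^ 2) ^ (1 / q)) := by
        rw [ofReal_rpow_mul_rpow (by positivity) (by positivity) (by positivity) (by linarith)
            (one_div_nonneg.2 hp0.le) (one_div_nonneg.2 hq0.le)]
    _ ≤ _ := by
        refine ENNReal.ofReal_le_ofReal ?_
        have h1 : (ω * R ^ d) ^ (p - 1) * (lam * R ^ 2 * (ω * R ^ d))
            = lam * R ^ 2 * (ω * R ^ d) ^ p := by
          have : (ω * R ^ d) ^ p = (ω * R ^ d) ^ (p - 1) * (ω * R ^ d) := by
            nth_rw 3 [← Real.rpow_one (ω * R ^ d)]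
            rw [← Real.rpow_add_of_nonneg (by positivity) (by linarith) zero_le_one,
              sub_add_cancel]
          rw [this]; ring
        have h16 : (16 : ℝ) ^ (1 / q) ≤ 16 := by
          calc (16 : ℝ) ^ (1 / q) ≤ 16 ^ (1 : ℝ) :=
                Real.rpow_le_rpow_of_exponent_le (by norm_num) (by
                  rw [div_le_one hq0]; exact hpq.symm.lt.le)
            _ = 16 := Real.rpow_one _
        have hRR : (R ^ 2) ^ (1 / p) * (R ^ 2) ^ (1 / q) = R ^ 2 := by
          rw [← Real.rpow_add (by positivity), one_div, one_div, hpq.inv_add_inv_eq_one,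
            Real.rpow_one]
        rw [h1, Real.mul_rpow (by positivity) (by positivity), Real.mul_rpow hlam (by positivity),
          ← Real.rpow_mul (by positivity), mul_one_div_cancel hp0.ne', Real.rpow_one,
          Real.mul_rpow (by norm_num) (by positivity)]
        calc lam ^ (1 / p) * (R ^ 2) ^ (1 / p) * (ω * R ^ d) * (16 ^ (1 / q) * (R ^ 2) ^ (1 / q))
            = 16 ^ (1 / q) * ω * lam ^ (1 / p) *
                (R ^ d * ((R ^ 2) ^ (1 / p) * (R ^ 2) ^ (1 / q))) := by ring
          _ ≤ _ := by rw [hRR]; gcongr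

lemma weightedVol_mono {s : ℝ} {v : ℝ → Ed d → ℝ} {t₀ : ℝ} {x₀ : Ed d} {R H k k' r r' T T' : ℝ}
    (hk : k' ≤ k) (hr : r' ≤ r) (hT : T ≤ T') :
    weightedVol s v t₀ x₀ R H k' r' T' ≤ weightedVol s v t₀ x₀ R H k r T :=
  (lintegral_mono_set (Ioo_subset_Ioo_left hT)).trans
    (lintegral_mono fun t => mul_le_mul' (subVol_mono hk hr t) le_rfl)

lemma ae_le_of_weightedVol_eq_zero {s : ℝ} {v : ℝ → Ed d → ℝ} (hv : Measurable (Function.uncurry v))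
    {t₀ : ℝ} {x₀ : Ed d} {R H k r T : ℝ} (h : weightedVol s v t₀ x₀ R H k r T = 0) :
    ∀ᵐ p : ℝ × Ed d, p ∈ Ioo T t₀ ×ˢ ball x₀ r → k ≤ v p.1 p.2 := by
  have h1 : ∫⁻ t in Ioo T t₀, subVol v x₀ k r t = 0 := by
    refine le_antisymm (le_trans (lintegral_mono fun t => ?_) h.le) bot_le
    calc subVol v x₀ k r t = subVol v x₀ k r t * 1 := (mul_one _).symm
      _ ≤ _ := mul_le_mul' le_rfl le_self_add
  rw [lintegral_subVol hv] at h1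
  rw [ae_iff]
  convert h1 using 2
  ext p
  simp only [mem_ofPred_eq, not_forall, not_le, exists_prop]

lemma exists_iteration_radius {α β G c d' : ℝ} (hα : 0 < α) (hβ : 0 < β) (hG : 0 < G)
    (hd' : d' = c * α) : ∃ e > 0, ∀ R : ℝ, 0 < R → 16 * G * R ^ (-d') * (e * R ^ c) ^ α ≤ β := by
  refine ⟨(β / (16 * G)) ^ (1 / α), by positivity, fun R hR => le_of_eq ?_⟩
  rw [Real.mul_rpow (by positivity) (by positivity), ← Real.rpow_mul (by positivity),
    one_div_mul_cancel hα.ne', Real.rpow_one, ← Real.rpow_mul hR.le, ← hd', Real.rpow_neg hR.le]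
  have := Real.rpow_pos_of_pos hR d'
  field_simp

set_option maxHeartbeats 600000 in
lemma exists_growth_constant {s Λ q δ : ℝ} (hd : 2 ≤ d) (hs : s ∈ Ioo (0 : ℝ) 1) (hΛ : 1 ≤ Λ)
    (hq : q ∈ Ioc (1 : ℝ) 2) (hδ : δ ∈ Ioc (0 : ℝ) 1) :
    ∃ lam ∈ Ioo (0 : ℝ) 1, ∀ {A : ℝ → Ed d → Ed d → Ed d} {K : ℝ → Ed d → Ed d → ℝ}
      {v : ℝ → Ed d → ℝ} {Dv : ℝ → Ed d → Ed d} {t₀ : ℝ} {x₀ : Ed d} {R : ℝ},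
      CylSuper s Λ A K v Dv t₀ x₀ R → ∀ {H : ℝ}, 0 < H →
      volume {p : ℝ × Ed d | p ∈ Iminus t₀ (δ * R) ×ˢ ball x₀ R ∧ v p.1 p.2 ≤ H} ≤
        ENNReal.ofReal lam * volume (Iminus t₀ (δ * R) ×ˢ ball x₀ R) →
      (⨍ t in Iminus t₀ (2 * R),
        (Tail s (fun y => max (-v t y) 0) x₀ (2 * R)) ^ q) ^ (1 / q) ≤ H →
      ∀ᵐ p : ℝ × Ed d, p ∈ Iminus t₀ (δ * R / 2) ×ˢ ball x₀ (R / 2) → H / 2 ≤ v p.1 p.2 := by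
  obtain ⟨p, hpq⟩ : ∃ p : ℝ, p.HolderConjugate q :=
    ⟨_, (Real.HolderConjugate.conjExponent hq.1).symm⟩
  have hp0 := hpq.pos
  obtain ⟨M, hM, hstep⟩ := exists_weightedVol_step hd hs hΛ hpq
  have hd0 : (0 : ℝ) < d := by exact_mod_cast (by omega : 0 < d)
  have hδ0 := hδ.1
  obtain ⟨α, hα⟩ : ∃ α, α = 1 / (d : ℝ) / p := ⟨_, rfl⟩
  have hα0 : 0 < α := by rw [hα]; positivity
  obtain ⟨b, hb⟩ : ∃ b : ℝ, b = 32 ^ (1 + α) := ⟨_, rfl⟩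
  have hb1 : 1 < b := by rw [hb]; exact Real.one_lt_rpow (by norm_num) (by linarith)
  have hb0 : 0 < b := by linarith
  obtain ⟨β, hβ⟩ : ∃ β : ℝ, β = b ^ (-(1 / α)) := ⟨_, rfl⟩
  have hβ01 : β ∈ Ioo (0 : ℝ) 1 := by
    rw [hβ]
    exact ⟨by positivity, Real.rpow_lt_one_of_one_lt_of_neg hb1 (neg_neg_of_pos (by positivity))⟩
  have hbβ : b * β ^ α ≤ 1 := by
    rw [hβ, ← Real.rpow_mul hb0.le, neg_mul, one_div_mul_cancel hα0.ne', Real.rpow_neg_one,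
      mul_inv_cancel₀ hb0.ne']
  obtain ⟨G, hG⟩ : ∃ G, G = (M * (4 / δ ^ 2) ^ 5) ^ (1 + α) := ⟨_, rfl⟩
  have hG0 : 0 < G := by rw [hG]; positivity
  have hscale : (1 + 2 * (1 / (d : ℝ))) / p = ((d : ℝ) + 2) * α := by rw [hα]; field_simp
  obtain ⟨e, he0, he⟩ := exists_iteration_radius hα0 hβ01.1 hG0 hscale
  obtain ⟨ω, hω⟩ : ∃ ω, ω = (volume (ball (0 : Ed d) 1)).toReal := ⟨_, rfl⟩
  have hω0 : 0 < ω := by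
    rw [hω]
    exact ENNReal.toReal_pos (measure_ball_pos _ _ one_pos).ne' measure_ball_lt_top.ne
  have hlam0 : 0 < min (1 / 2) ((e / (16 * ω)) ^ p) := lt_min (by norm_num) (by positivity)
  refine ⟨min (1 / 2) ((e / (16 * ω)) ^ p), ⟨hlam0, (min_le_left _ _).trans_lt (by norm_num)⟩, ?_⟩
  intro A K v Dv t₀ x₀ R hC H hH hvol htail
  have hR := hC.R_mem.1
  have hθ := hC.lintegral_tailWeight_rpow_le hq hH htail
  have hδR2 : (δ * R) ^ 2 ≤ R ^ 2 := by
    have h := mul_le_of_le_one_left hR.le hδ.2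
    gcongr
  obtain ⟨X, hX⟩ : ∃ X : ℕ → ℝ≥0∞, X = fun j => weightedVol s v t₀ x₀ R H
      (H / 2 * (1 + (1 / 2) ^ j)) (R / 2 * (1 + (1 / 2) ^ j))
      (t₀ - (δ * R / 2) ^ 2 * (1 + 3 * (1 / 2) ^ j)) := ⟨_, rfl⟩
  have hRd : R ^ d * R ^ 2 = R ^ ((d : ℝ) + 2) := by
    rw [Real.rpow_add hR, Real.rpow_natCast, Real.rpow_two]
  have hX0 : X 0 ≤ ENNReal.ofReal (e * R ^ ((d : ℝ) + 2)) := by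
    have h1 := hC.weightedVol_le_of_measure_le hpq hδ hlam0.le hvol hθ
    rw [← hω, hRd] at h1
    have h2 : X 0 = weightedVol s v t₀ x₀ R H H R (t₀ - (δ * R) ^ 2) := by
      rw [hX]
      simp only [pow_zero]
      congr 1 <;> ring
    rw [h2]
    refine h1.trans (ENNReal.ofReal_le_ofReal ?_)
    gcongr
    calc 16 * ω * min (1 / 2) ((e / (16 * ω)) ^ p) ^ (1 / p)
        ≤ 16 * ω * ((e / (16 * ω)) ^ p) ^ (1 / p) := by
          gcongr
          exact min_le_right _ _
      _ = e := by
          rw [← Real.rpow_mul (by positivity), mul_one_div_cancel hp0.ne', Real.rpow_one]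
          field_simp
  have hXstep : ∀ j, X (j + 1) ≤
      ENNReal.ofReal (16 * G * R ^ (-((1 + 2 * (1 / (d : ℝ))) / p)) * b ^ j) *
        X j ^ (1 + α) := by
    intro j
    obtain ⟨u, hu⟩ : ∃ u : ℝ, u = (1 / 2) ^ j := ⟨_, rfl⟩
    have hu0 : 0 < u := by rw [hu]; positivity
    have hu1 : u ≤ 1 := by rw [hu]; exact pow_le_one₀ (by norm_num) (by norm_num)
    have hδ2 : δ ^ 2 ≤ 1 := pow_le_one₀ hδ0.le hδ.2
    have hδu : δ ^ 2 * u ≤ u := mul_le_of_le_one_left hu0.le hδ2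
    have hX1 : X (j + 1) = weightedVol s v t₀ x₀ R H (H / 2 * (1 + u / 2)) (R / 2 * (1 + u / 2))
        (t₀ - (δ * R / 2) ^ 2 * (1 + 3 * (u / 2))) := by
      rw [hX, hu, pow_succ]
      ring_nf
    have hXj : X j = weightedVol s v t₀ x₀ R H (H / 2 * (1 + u)) (R / 2 * (1 + u))
        (t₀ - (δ * R / 2) ^ 2 * (1 + 3 * u)) := by rw [hX, hu]
    obtain ⟨ℓ, hℓ⟩ : ∃ ℓ : ℝ, ℓ = 4 / (δ ^ 2 * u) := ⟨_, rfl⟩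
    have hℓinv : ∀ a : ℝ, a / ℓ = a * (δ ^ 2 * u / 4) := fun a => by rw [hℓ]; field_simp
    have hℓ1 : 1 ≤ ℓ := by
      rw [hℓ, one_le_div (by positivity)]; linarith
    have hδRu : 0 < (δ * R) ^ 2 * u := by positivity
    have hδRu' : (δ * R) ^ 2 * u ≤ (δ * R) ^ 2 := mul_le_of_le_one_right (by positivity) hu1
    have hR2 : 0 < R ^ 2 := by positivity
    have hHu : H * (δ ^ 2 * u) ≤ H * u := by gcongr
    have hRu : R * (δ ^ 2 * u) ≤ R * u := by gcongr
    have h := hstep hC (H := H) (ℓ := ℓ) (k := H / 2 * (1 + u)) (k' := H / 2 * (1 + u / 2))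
      (r := R / 2 * (1 + u)) (r' := R / 2 * (1 + u / 2))
      (T₀ := t₀ - (δ * R / 2) ^ 2 * (1 + 3 * u))
      (T₁ := t₀ - (δ * R / 2) ^ 2 * (1 + 3 * (u / 2))) hH hℓ1 (by positivity) (by nlinarith)
      (by rw [hℓinv]; linarith) (by nlinarith) (by positivity) (by rw [hℓinv]; linarith)
      (by linarith) (by rw [hℓinv]; linarith) (by linarith) hθ
    rw [hX1, hXj]
    rw [← hα] at h
    refine h.trans (mul_le_mul' (ENNReal.ofReal_le_ofReal (le_of_eq ?_)) le_rfl)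
    have hMℓ : (M * ℓ ^ 5) ^ (1 + α) = G * b ^ j := by
      have h1 : M * ℓ ^ 5 = M * (4 / δ ^ 2) ^ 5 * 32 ^ j := by
        have h2 : u⁻¹ ^ 5 = 32 ^ j := by
          rw [hu, ← inv_pow, one_div, inv_inv, ← pow_mul, mul_comm, pow_mul]; norm_num
        rw [hℓ, ← h2]; field_simp
      rw [h1, Real.mul_rpow (by positivity) (by positivity), hG, hb, Real.rpow_pow_comm
        (by norm_num)]
    rw [hMℓ]; ring
  have hlim := ENNReal.tendsto_zero_of_le_geometric_mul_rpow (by positivity) hb0.le hα0 hβ01 hbβ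
    (by positivity) (he R hR) hX0 hXstep
  have hzero : weightedVol s v t₀ x₀ R H (H / 2) (R / 2) (t₀ - (δ * R / 2) ^ 2) = 0 := by
    refine le_antisymm (ge_of_tendsto' hlim fun j => ?_) bot_le
    rw [hX]
    have hj : (0 : ℝ) < (1 / 2) ^ j := by positivity
    exact weightedVol_mono (le_mul_of_one_le_right (by positivity) (by linarith))
      (le_mul_of_one_le_right (by positivity) (by linarith))
      (sub_le_sub_left (le_mul_of_one_le_right (by positivity) (by linarith)) _)
  exact ae_le_of_weightedVol_eq_zero hC.meas hzero

/-- **Lemma 3.3: De Giorgi type growth lemma.** -/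
theorem de_giorgi_growth_lemma
    (d : ℕ) (hd : 2 ≤ d) (s Λ q δ : ℝ)
    (hs : s ∈ Set.Ioo (0 : ℝ) 1) (hΛ : 1 ≤ Λ)
    (hq : q ∈ Set.Ioc (1 : ℝ) 2) (hδ : δ ∈ Set.Ioc (0 : ℝ) 1) :
    ∃ lam ∈ Set.Ioo (0 : ℝ) 1,
      ∀ (T : ℝ), 0 < T → ∀ (Ω : Set (Ed d)), IsOpen Ω → Bornology.IsBounded Ω →
      ∀ (A : ℝ → Ed d → Ed d → Ed d), VectorFieldHyp d Λ A →
      ∀ (K : ℝ → Ed d → Ed d → ℝ), KernelHyp d s Λ K →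
      ∀ (v : ℝ → Ed d → ℝ) (Dv : ℝ → Ed d → Ed d),
        LocalWeakReg d s (Set.Ioo 0 T) Ω v Dv →
        IsLocalWeakSupersolutionHom A K (Set.Ioo 0 T) Ω v Dv →
        ∀ R ∈ Set.Ioc (0 : ℝ) 1, ∀ (t₀ : ℝ) (x₀ : Ed d),
          closure ((Iminus t₀ (2 * R)) ×ˢ Metric.ball x₀ (2 * R)) ⊆ (Set.Ioo 0 T) ×ˢ Ω →
          ∀ H : ℝ, 0 < H →
            -- `v ≥ 0` in `Q_{2R}(t₀,x₀)`
            (∀ᵐ p ∂(volume : Measure (ℝ × Ed d)),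
              p ∈ pCyl t₀ x₀ (2 * R) → 0 ≤ v p.1 p.2) →
            -- measure density assumption (3.9)
            volume {p : ℝ × Ed d |
                p ∈ (Iminus t₀ (δ * R)) ×ˢ Metric.ball x₀ R ∧ v p.1 p.2 ≤ H} ≤
              ENNReal.ofReal lam * volume ((Iminus t₀ (δ * R)) ×ˢ Metric.ball x₀ R) →
            -- tail smallness assumption (3.10)
            (⨍ t in Iminus t₀ (2 * R),
                (Tail s (fun y => max (-v t y) 0) x₀ (2 * R)) ^ q) ^ (1 / q) ≤ H →
            -- conclusion
            ∀ᵐ p ∂(volume : Measure (ℝ × Ed d)),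
              p ∈ (Iminus t₀ (δ * R / 2)) ×ˢ Metric.ball x₀ (R / 2) →
                H / 2 ≤ v p.1 p.2 := by
  obtain ⟨lam, hlam, h⟩ := exists_growth_constant hd hs hΛ hq hδ
  refine ⟨lam, hlam, ?_⟩
  intro T _ Ω _ _ A hA K hK v Dv hreg hsup R hR t₀ x₀ hcl H hH hnn hvol htail
  exact h (hreg.cylSuper hd hs hΛ hR hA hK hsup hcl hnn) hH hvol htail
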